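/- arXiv:1411.3120 — 4 statements merged into one kernel-verified Lean document; each statement's English description precedes it below -/
import Mathlib

section
/- Let μ be symmetric and let the masses M_0, …, M_{2r+1} in the Sobolev inner product at c = 0 all be strictly positive. Suppose there are sequences a_n, b_n > 0 with a_n^{−1/2}/(A n^a) → 1 and b_n/(B n^b) → 1 for some A, B, b > 0 and a ∈ ℝ, and ν > −1 with 2a+1 = 2b(ν+1); suppose uniformly on compact subsets of ℂ that (−1)^n a_n^{1/2} p_{2n}(z/b_n) → φ_ν(z) and (−1)^n a_n^{1/2} p_{2n+1}(z/b_n) → z·φ_{ν+1}(z); and suppose the leading coefficients γ_n of p_n satisfy lim_n (γ_{2n}/γ_{2n+1}) · b_n/n = 1/(2b) and lim_n (γ_{2n+1}/γ_{2n+2}) · b_n/n = 1/(2b). Then, uniformly on compact subsets of ℂ, (−1)^n a_n^{1/2} q_{2n}(z/b_n) → (−1)^{r+1} z^{2r+2} φ_{ν+2r+2}(z) and (−1)^n a_n^{1/2} q_{2n+1}(z/b_n) → (−1)^{r+1} z^{2r+3} φ_{ν+2r+3}(z). -/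
open MeasureTheory Polynomial Filter Topology

noncomputable section

/-- The support of a Borel measure on `ℝ`. -/
def measSupport (μ : Measure ℝ) : Set ℝ := {x | ∀ U ∈ nhds x, μ U ≠ 0}

/-- `P` is a sequence of orthonormal polynomials with respect to the measure `μ`. -/
def IsOPS (μ : Measure ℝ) (P : ℕ → Polynomial ℝ) : Prop :=
  (∀ n, (P n).degree = n) ∧ (∀ n, 0 < (P n).leadingCoeff) ∧
    ∀ n m, (∫ x, (P n).eval x * (P m).eval x ∂μ) = if n = m then 1 else 0

/-- The discrete Sobolev inner product. -/
def sobInner (μ : Measure ℝ) (c : ℝ) (r : ℕ) (M : ℕ → ℝ) (p q : Polynomial ℝ) : ℝ :=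
  (∫ x, p.eval x * q.eval x ∂μ) +
    ∑ i ∈ Finset.range (r + 1),
      M i * (Polynomial.derivative^[i] p).eval c * (Polynomial.derivative^[i] q).eval c

/-- `Q` is the sequence of orthonormal polynomials for the Sobolev inner product. -/
def IsSobOPS (μ : Measure ℝ) (c : ℝ) (r : ℕ) (M : ℕ → ℝ) (Q : ℕ → Polynomial ℝ) : Prop :=
  (∀ n, (Q n).degree = n) ∧ (∀ n, 0 < (Q n).leadingCoeff) ∧
    ∀ n m, sobInner μ c r M (Q n) (Q m) = if n = m then 1 else 0

/-- `φ_ν(z) = Σ_{k≥0} (-1)^k z^{2k} / (k! Γ(k+ν+1)) = z^{-ν} J_ν(2z)`. -/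
def phi (ν : ℝ) (z : ℂ) : ℂ :=
  ∑' k : ℕ, ((-1 : ℂ) ^ k * z ^ (2 * k)) /
    ((k.factorial : ℂ) * Complex.Gamma ((k : ℂ) + (ν : ℂ) + 1))

/-- The power-series form of Cauchy's coefficient estimate for entire functions. -/
lemma norm_coeff_mul_pow_le {d : ℕ → ℂ}
    (hd : ∀ R : ℝ, 0 < R → Summable fun j => ‖d j‖ * R ^ j) {R C : ℝ} (hR : 0 < R)
    (h : ∀ z : ℂ, ‖z‖ = R → ‖∑' j, d j * z ^ j‖ ≤ C) (j : ℕ) : ‖d j‖ * R ^ j ≤ C := by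
  set p := FormalMultilinearSeries.ofScalars ℂ d with hp
  have hrad : p.radius = ⊤ := by
    refine p.radius_eq_top_of_summable_norm fun r => ?_
    simp only [hp, FormalMultilinearSeries.ofScalars_norm]
    rcases eq_or_ne r 0 with rfl | hr
    · refine summable_of_ne_finset_zero (s := {0}) fun b hb => ?_
      have : b ≠ 0 := by simpa using hb
      simp [this]
    · exact hd r (by positivity)
  have hball : HasFPowerSeriesOnBall p.sum p 0 ⊤ := by
    have := p.hasFPowerSeriesOnBall (by simp [hrad])
    rwa [hrad] at this
  have hdiff : Differentiable ℂ p.sum := fun z =>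
    (hball.analyticAt_of_mem (by simp)).differentiableAt
  have hsum (z : ℂ) : p.sum z = ∑' j, d j * z ^ j := by
    simp [hp, FormalMultilinearSeries.sum, mul_comm]
  have h1 := Complex.norm_iteratedDeriv_le_of_forall_mem_sphere_norm_le (c := 0) j hR
    hdiff.diffContOnCl (C := C) fun z hz => by
      rw [hsum]; exact h z (by simpa using hz)
  have h2 := hball.factorial_smul 1 j
  rw [← iteratedDeriv_eq_iteratedFDeriv] at h2
  rw [← h2] at h1
  have h3 : p j (fun _ => (1 : ℂ)) = d j := by
    simp [hp]
  rw [h3, nsmul_eq_mul, norm_mul, Complex.norm_natCast, mul_div_assoc] at h1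
  have h4 := le_of_mul_le_mul_left h1 (by positivity)
  rwa [le_div_iff₀ (by positivity)] at h4

/-- Locally uniform convergence of `z ^ ε * ∑ x n j z ^ (2 j)` controls all coefficients
simultaneously. -/
lemma eventually_coeff_le_of_tendstoUniformlyOn {ε : ℕ} {x : ℕ → ℕ → ℝ} {g : ℕ → ℝ}
    (hx : ∀ n, (x n).support.Finite)
    (hg : ∀ R : ℝ, 0 < R → Summable fun j => |g j| * R ^ j)
    (h : ∀ K : Set ℂ, IsCompact K → TendstoUniformlyOn
      (fun (n : ℕ) (z : ℂ) => z ^ ε * ∑' j, (x n j : ℂ) * z ^ (2 * j))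
      (fun z => z ^ ε * ∑' j, (g j : ℂ) * z ^ (2 * j)) atTop K)
    {ρ δ : ℝ} (hρ : 0 < ρ) (hδ : 0 < δ) :
    ∀ᶠ n in atTop, ∀ j, |x n j - g j| * ρ ^ j ≤ δ := by
  have hxs (n : ℕ) (R : ℝ) : Summable fun j => |x n j| * R ^ j :=
    summable_of_hasFiniteSupport ((hx n).subset fun j hj => by
      simp only [Function.mem_support, ne_eq, mul_eq_zero, abs_eq_zero, not_or] at hj ⊢
      exact hj.1)
  have hpos : 0 < δ * √ρ ^ ε := by positivity
  filter_upwards [Metric.tendstoUniformlyOn_iff.1 (h _ (isCompact_closedBall 0 (√ρ))) _ hpos]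
    with n hn
  have hsummable (a : ℕ → ℝ) (ha : ∀ R : ℝ, 0 < R → Summable fun j => |a j| * R ^ j) (w : ℂ)
      (hw : w ≠ 0) : Summable fun j => (a j : ℂ) * w ^ j := by
    refine Summable.of_norm ?_
    simpa using ha ‖w‖ (by positivity)
  have key := norm_coeff_mul_pow_le (d := fun j => ((x n j - g j : ℝ) : ℂ)) (R := ρ) (C := δ)
    (fun R hR => by
      refine Summable.of_nonneg_of_le (fun j => by positivity) (fun j => ?_)
        ((hxs n R).add (hg R hR))
      rw [Complex.norm_real, Real.norm_eq_abs, ← add_mul]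
      gcongr
      exact abs_sub _ _) hρ (fun w hw => by
      obtain ⟨z, rfl⟩ := IsAlgClosed.exists_pow_nat_eq w (n := 2) (by norm_num)
      have hz : ‖z‖ = √ρ := by
        rw [← hw, norm_pow, Real.sqrt_sq (norm_nonneg _)]
      have hz0 : z ^ 2 ≠ 0 := by
        rw [← norm_pos_iff, hw]; exact hρ
      have h1 := hn z (by simp [hz])
      have h2 : ∑' j, ((x n j - g j : ℝ) : ℂ) * (z ^ 2) ^ j =
          (∑' j, (x n j : ℂ) * z ^ (2 * j)) - ∑' j, (g j : ℂ) * z ^ (2 * j) := by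
        simp_rw [pow_mul]
        rw [← (hsummable _ (fun R _ => hxs n R) _ hz0).tsum_sub (hsummable _ hg _ hz0)]
        exact tsum_congr fun j => by push_cast; ring
      rw [h2]
      rw [dist_comm, dist_eq_norm, ← mul_sub, norm_mul, norm_pow, hz, mul_comm] at h1
      exact (lt_of_mul_lt_mul_right h1 (by positivity)).le)
  intro j
  simpa only [Complex.norm_real, Real.norm_eq_abs] using key j

/-- Coefficientwise convergence with geometric bounds yields locally uniform convergence. -/
lemma tendstoUniformlyOn_of_coeff {ε : ℕ} {x : ℕ → ℕ → ℝ} {g : ℕ → ℝ}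
    (hlim : ∀ j, Tendsto (fun n => x n j) atTop (𝓝 (g j)))
    (hbd : ∀ ρ : ℝ, 0 < ρ → ∃ C : ℝ, ∀ᶠ n in atTop, ∀ j, |x n j| * ρ ^ j ≤ C)
    {K : Set ℂ} (hK : IsCompact K) : TendstoUniformlyOn
      (fun (n : ℕ) (z : ℂ) => z ^ ε * ∑' j, (x n j : ℂ) * z ^ (2 * j))
      (fun z => z ^ ε * ∑' j, (g j : ℂ) * z ^ (2 * j)) atTop K := by
  obtain ⟨R, hR0, hR⟩ : ∃ R : ℝ, 0 < R ∧ ∀ z ∈ K, ‖z‖ ≤ R := by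
    obtain ⟨R, hR⟩ := hK.isBounded.exists_norm_le
    exact ⟨max R 1, by positivity, fun z hz => (hR z hz).trans (le_max_left _ _)⟩
  obtain ⟨C, hC⟩ := hbd (2 * R ^ 2) (by positivity)
  have hgC (j : ℕ) : |g j| * (2 * R ^ 2) ^ j ≤ C :=
    le_of_tendsto ((hlim j).abs.mul_const _) (hC.mono fun n hn => hn j)
  have hsplit {y : ℝ} {j : ℕ} (hy : |y| * (2 * R ^ 2) ^ j ≤ C) :
      |y| * R ^ (2 * j) ≤ C * (1 / 2) ^ j := by
    rw [mul_pow, ← pow_mul] at hy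
    have h2 : (0 : ℝ) < 2 ^ j := by positivity
    rw [one_div, inv_pow, ← div_eq_mul_inv, le_div_iff₀ h2]
    linarith
  have hgeo : Summable fun j : ℕ => C * (1 / 2 : ℝ) ^ j :=
    (summable_geometric_two).mul_left C
  have hsum {y : ℕ → ℝ} (hy : ∀ j, |y j| * (2 * R ^ 2) ^ j ≤ C) {z : ℂ} (hz : z ∈ K) :
      Summable fun j => (y j : ℂ) * z ^ (2 * j) := by
    refine Summable.of_norm_bounded hgeo fun j => ?_
    rw [norm_mul, Complex.norm_real, Real.norm_eq_abs, norm_pow]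
    refine le_trans ?_ (hsplit (hy j))
    gcongr
    exact hR z hz
  have hdiff {y : ℝ} {j : ℕ} (hy : |y| * (2 * R ^ 2) ^ j ≤ C) :
      |y - g j| * R ^ (2 * j) ≤ 2 * (C * (1 / 2) ^ j) := by
    have h1 := mul_le_mul_of_nonneg_right (abs_sub y (g j)) (pow_nonneg hR0.le (2 * j))
    linarith [hsplit hy, hsplit (hgC j)]
  have htend : Tendsto (fun n => ∑' j, |x n j - g j| * R ^ (2 * j)) atTop (𝓝 0) := by
    have := tendsto_tsum_of_dominated_convergence (𝓕 := atTop)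
      (f := fun n j => |x n j - g j| * R ^ (2 * j)) (g := fun _ => (0 : ℝ))
      (hgeo.mul_left 2) (fun j => by
        have := (((hlim j).sub_const (g j)).abs).mul_const (R ^ (2 * j))
        simpa using this) (by
        filter_upwards [hC] with n hn j
        rw [Real.norm_of_nonneg (by positivity)]
        exact hdiff (hn j))
    simpa using this
  rw [Metric.tendstoUniformlyOn_iff]
  intro δ hδ
  have hev : ∀ᶠ n in atTop, ∑' j, |x n j - g j| * R ^ (2 * j) < δ / R ^ ε :=
    htend.eventually_lt_const (by positivity)
  filter_upwards [hC, hev] with n hn hlt z hz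
  have hs : Summable fun j => |x n j - g j| * R ^ (2 * j) := by
    exact Summable.of_nonneg_of_le (fun j => by positivity) (fun j => hdiff (hn j))
      (hgeo.mul_left 2)
  rw [dist_comm, dist_eq_norm, ← mul_sub, ← (hsum hn hz).tsum_sub (hsum hgC hz), norm_mul, norm_pow]
  have h1 : ‖∑' j, ((x n j : ℂ) * z ^ (2 * j) - (g j : ℂ) * z ^ (2 * j))‖ ≤
      ∑' j, |x n j - g j| * R ^ (2 * j) := by
    refine tsum_of_norm_bounded hs.hasSum fun j => ?_
    rw [← sub_mul, ← Complex.ofReal_sub, norm_mul, Complex.norm_real, Real.norm_eq_abs, norm_pow]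
    gcongr
    exact hR z hz
  have h2 : ‖z‖ ^ ε ≤ R ^ ε := by
    gcongr
    exact hR z hz
  calc _ ≤ R ^ ε * ∑' j, |x n j - g j| * R ^ (2 * j) := by gcongr
    _ < R ^ ε * (δ / R ^ ε) := by gcongr
    _ = δ := by field_simp

/-- Power-law summation: if `h k ~ L k ^ θ` with `θ > -1`, the partial sums are asymptotic to
`L n ^ (θ + 1) / (θ + 1)`. -/
lemma tendsto_sum_range_div_rpow {h : ℕ → ℝ} {θ L : ℝ} (hθ : -1 < θ)
    (hh : Tendsto (fun k : ℕ => h k / (k : ℝ) ^ θ) atTop (𝓝 L)) :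
    Tendsto (fun n : ℕ => (∑ k ∈ Finset.range n, h k) / (n : ℝ) ^ (θ + 1)) atTop
      (𝓝 (L / (θ + 1))) := by
  have hθ1 : 0 < θ + 1 := by linarith
  set T : ℕ → ℝ := fun n => (n : ℝ) ^ (θ + 1) / (θ + 1) with hT
  set g : ℕ → ℝ := fun k => T (k + 1) - T k with hg
  have hgpos (k : ℕ) : 0 < g k := by
    simp only [hg, hT, sub_pos]
    gcongr
    simp
  have hgsum (n : ℕ) : ∑ k ∈ Finset.range n, g k = T n := by
    rw [Finset.sum_range_sub]
    simp [hT, Real.zero_rpow hθ1.ne']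
  have hTtop : Tendsto T atTop atTop :=
    ((tendsto_rpow_atTop hθ1).comp tendsto_natCast_atTop_atTop).atTop_div_const hθ1
  have hgk : Tendsto (fun k : ℕ => g k / (k : ℝ) ^ θ) atTop (𝓝 1) := by
    have hder : HasDerivAt (fun x : ℝ => x ^ (θ + 1) / (θ + 1)) 1 1 := by
      have := (Real.hasDerivAt_rpow_const (x := 1) (p := θ + 1) (by simp)).div_const (θ + 1)
      simpa [hθ1.ne'] using this
    have hslope := (hasDerivAt_iff_tendsto_slope.1 hder)
    have hseq : Tendsto (fun k : ℕ => 1 + 1 / (k : ℝ)) atTop (𝓝[≠] 1) := by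
      refine tendsto_nhdsWithin_iff.2 ⟨?_, ?_⟩
      · simpa using (tendsto_one_div_atTop_nhds_zero_nat (𝕜 := ℝ)).const_add 1
      · filter_upwards [eventually_gt_atTop 0] with k hk
        have : (0 : ℝ) < 1 / k := by positivity
        simp only [Set.mem_compl_iff, Set.mem_singleton_iff]
        linarith
    refine (hslope.comp hseq).congr' ?_
    filter_upwards [eventually_gt_atTop 0] with k hk
    have hk' : (0 : ℝ) < k := by positivity
    have h1 : (1 + 1 / (k : ℝ)) = (k + 1) / k := by field_simp
    simp only [Function.comp, slope_def_field, hg, hT]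
    rw [h1, Real.div_rpow (by positivity) hk'.le, Real.one_rpow, Real.rpow_add_one hk'.ne' θ]
    have hkθ : (k : ℝ) ^ θ ≠ 0 := by positivity
    push_cast
    have h2 : ((k : ℝ) + 1) / k - 1 ≠ 0 := by
      rw [← h1]; simp; exact hk.ne'
    field_simp
    ring
  have hlo : (fun k => h k - L * g k) =o[atTop] g := by
    refine Asymptotics.isLittleO_of_tendsto (fun k hk => absurd hk (hgpos k).ne') ?_
    have := (hh.div hgk one_ne_zero).sub_const L
    simp only [div_one, sub_self] at this
    refine this.congr' ?_
    filter_upwards [eventually_gt_atTop 0] with k hk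
    have hkθ : (k : ℝ) ^ θ ≠ 0 := by positivity
    have := (hgpos k).ne'
    simp only [Pi.div_apply]
    field_simp
  have hsum := hlo.sum_range (fun k => (hgpos k).le) (by simpa only [hgsum] using hTtop)
  have hlim := hsum.tendsto_div_nhds_zero
  simp only [hgsum, Finset.sum_sub_distrib, ← Finset.mul_sum] at hlim
  have hlim2 := (hlim.add_const L).div_const (θ + 1)
  rw [zero_add] at hlim2
  refine hlim2.congr' ?_
  filter_upwards [eventually_gt_atTop 0] with n hn
  have : (n : ℝ) ^ (θ + 1) ≠ 0 := by positivity
  simp only [hT]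
  field_simp
  ring

/-- Partial fraction expansion of `∏ (x - i) / (x + α + i)`. -/
lemma exists_partialFraction {α : ℝ} (hα : 0 < α) (N : ℕ) :
    ∃ y : ℕ → ℝ, ∀ x : ℝ, 0 ≤ x →
      ∏ i ∈ Finset.range N, (x - i) / (α + i + x) =
        1 - ∑ i ∈ Finset.range N, y i / (α + i + x) := by
  induction N with
  | zero => exact ⟨0, by simp⟩
  | succ N ih =>
    obtain ⟨y, hy⟩ := ih
    set e : ℕ → ℝ := fun i => (α + 2 * N) / (N - i) with he
    refine ⟨fun i => if i = N then (α + 2 * N) + ∑ i ∈ Finset.range N, y i * e i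
      else y i * (1 - e i), fun x hx => ?_⟩
    have hN : (α + N + x) ≠ 0 := by positivity
    rw [Finset.prod_range_succ, hy x hx, Finset.sum_range_succ]
    have h1 : ∑ i ∈ Finset.range N, (if i = N then (α + 2 * N) + ∑ i ∈ Finset.range N, y i * e i
        else y i * (1 - e i)) / (α + i + x) =
        (∑ i ∈ Finset.range N, y i / (α + i + x)) * ((x - N) / (α + N + x)) -
          (∑ i ∈ Finset.range N, y i * e i) / (α + N + x) := by
      rw [Finset.sum_mul, Finset.sum_div, ← Finset.sum_sub_distrib]
      refine Finset.sum_congr rfl fun i hi => ?_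
      have hiN : i < N := Finset.mem_range.1 hi
      have h2 : (N : ℝ) - i ≠ 0 := sub_ne_zero.2 (by exact_mod_cast hiN.ne')
      have h3 : α + i + x ≠ 0 := by positivity
      rw [if_neg hiN.ne]
      simp only [he]
      field_simp
      ring
    rw [h1]
    simp only [if_true]
    field_simp
    ring

/-- Cauchy matrices `1 / (α + i + j)` with `α > 0` are nonsingular. -/
lemma eq_zero_of_cauchy_sum_eq_zero {α : ℝ} (hα : 0 < α) {N : ℕ} {y : Fin N → ℝ}
    (hy : ∀ j : Fin N, ∑ i : Fin N, y i / (α + i + j) = 0) : y = 0 := by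
  classical
  set P : ℝ[X] := ∑ i : Fin N, C (y i) * ∏ l ∈ Finset.univ.erase i, (X + C (α + (l : ℕ)))
    with hP
  have heval (x : ℝ) : P.eval x =
      ∑ i : Fin N, y i * ∏ l ∈ Finset.univ.erase i, (x + (α + (l : ℕ))) := by
    simp [hP, eval_finsetSum, eval_prod]
  have hdeg : P.degree < N := by
    refine (Polynomial.degree_sum_le _ _).trans_lt ?_
    rw [Finset.sup_lt_iff (by simp [bot_lt_iff_ne_bot])]
    intro i _
    refine ((degree_mul_le _ _).trans (add_le_add degree_C_le le_rfl)).trans_lt ?_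
    rw [zero_add, degree_prod]
    simp only [degree_X_add_C, Finset.sum_const, Finset.card_erase_of_mem (Finset.mem_univ i),
      Finset.card_univ, Fintype.card_fin, nsmul_eq_mul, mul_one]
    have : N - 1 < N := Nat.sub_lt i.pos one_pos
    exact_mod_cast this
  have hzero : P = 0 := by
    refine Polynomial.eq_zero_of_degree_lt_of_eval_finset_eq_zero
      (Finset.univ.image fun j : Fin N => ((j : ℕ) : ℝ)) ?_ ?_
    · rw [Finset.card_image_of_injective]
      · simpa using hdeg
      · exact fun a b hab => Fin.ext (by exact_mod_cast hab)
    · intro x hx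
      obtain ⟨j, -, rfl⟩ := Finset.mem_image.1 hx
      have hne (l : Fin N) : ((j : ℕ) : ℝ) + (α + (l : ℕ)) ≠ 0 := by positivity
      have : P.eval ((j : ℕ) : ℝ) = (∏ l : Fin N, (((j : ℕ) : ℝ) + (α + (l : ℕ)))) *
          ∑ i : Fin N, y i / (α + i + j) := by
        rw [heval, Finset.mul_sum]
        refine Finset.sum_congr rfl fun i _ => ?_
        rw [← Finset.mul_prod_erase _ _ (Finset.mem_univ i)]
        have := hne i
        have h2 : α + (i : ℕ) + (j : ℕ) ≠ 0 := by positivity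
        field_simp
        ring
      rw [this, hy, mul_zero]
  funext i
  have h1 := heval (-(α + (i : ℕ)))
  rw [hzero, eval_zero, Finset.sum_eq_single i] at h1
  · have h2 : ∏ l ∈ Finset.univ.erase i, (-(α + (i : ℕ)) + (α + (l : ℕ))) ≠ 0 := by
      refine Finset.prod_ne_zero_iff.2 fun l hl => ?_
      have : l ≠ i := Finset.ne_of_mem_erase hl
      have h3 : ((l : ℕ) : ℝ) ≠ (i : ℕ) := by
        exact_mod_cast fun h => this (Fin.ext h)
      intro h4
      exact h3 (by linarith)
    simpa using (mul_eq_zero.1 h1.symm).resolve_right h2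
  · intro k _ hk
    rw [Finset.prod_eq_zero (Finset.mem_erase.2 ⟨hk.symm, Finset.mem_univ i⟩) (by ring), mul_zero]
  · simp

lemma tendsto_atTop_of_div_rpow {b : ℕ → ℝ} {β B : ℝ} (hβ : 0 < β) (hB : 0 < B)
    (hb : Tendsto (fun k : ℕ => b k / (k : ℝ) ^ β) atTop (𝓝 B)) : Tendsto b atTop atTop := by
  have := hb.pos_mul_atTop hB ((tendsto_rpow_atTop hβ).comp tendsto_natCast_atTop_atTop)
  refine this.congr' ?_
  filter_upwards [eventually_gt_atTop 0] with k hk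
  have : (k : ℝ) ^ β ≠ 0 := by positivity
  simp only [Function.comp]
  field_simp

/-- A sequence of power growth is almost increasing. -/
lemma eventually_forall_lt_le_four_mul {b : ℕ → ℝ} {β B : ℝ} (hβ : 0 < β) (hB : 0 < B)
    (hb0 : ∀ k, 0 < b k)
    (hb : Tendsto (fun k : ℕ => b k / (k : ℝ) ^ β) atTop (𝓝 B)) :
    ∀ᶠ n in atTop, ∀ k < n, b k ≤ 4 * b n := by
  have h1 : ∀ᶠ k : ℕ in atTop, B / 2 * (k : ℝ) ^ β ≤ b k ∧ b k ≤ 2 * B * (k : ℝ) ^ β := by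
    filter_upwards [hb.eventually_const_le (show B / 2 < B by linarith),
      hb.eventually_le_const (show B < 2 * B by linarith), eventually_gt_atTop 0] with k h1 h2 hk
    have : 0 < (k : ℝ) ^ β := by positivity
    rw [le_div_iff₀ this] at h1
    rw [div_le_iff₀ this] at h2
    exact ⟨h1, h2⟩
  obtain ⟨N, hN⟩ := eventually_atTop.1 h1
  filter_upwards [eventually_ge_atTop N, (tendsto_atTop_of_div_rpow hβ hB hb).eventually_ge_atTop
    (∑ k ∈ Finset.range N, b k)] with n hn hsum k hk
  rcases lt_or_ge k N with hkN | hkN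
  · have := Finset.single_le_sum (f := b) (fun i _ => (hb0 i).le) (Finset.mem_range.2 hkN)
    linarith [hb0 n]
  · have h2 : (k : ℝ) ^ β ≤ (n : ℝ) ^ β := by gcongr
    have h3 := mul_le_mul_of_nonneg_left h2 hB.le
    linarith [(hN k hkN).2, (hN n hn).1]

/-- The Gram sums of scaled coefficients, normalised by their power growth. -/
def scaledGram (s b : ℕ → ℝ) (τ : ℕ → ℕ → ℝ) (n i j : ℕ) : ℝ :=
  (∑ k ∈ Finset.range n, (s k * b k ^ (2 * i) * τ k i) * (s k * b k ^ (2 * j) * τ k j)) /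
    (n * s n ^ 2 * b n ^ (2 * (i + j)))

lemma tendsto_weight_div_rpow {s b : ℕ → ℝ} {α β S B : ℝ}
    (hs : Tendsto (fun k : ℕ => s k ^ 2 / (k : ℝ) ^ (2 * β * α - 1)) atTop (𝓝 S))
    (hb : Tendsto (fun k : ℕ => b k / (k : ℝ) ^ β) atTop (𝓝 B)) (l : ℕ) :
    Tendsto (fun k : ℕ => s k ^ 2 * b k ^ (2 * l) / (k : ℝ) ^ (2 * β * (α + l) - 1)) atTop
      (𝓝 (S * B ^ (2 * l))) := by
  refine (hs.mul (hb.pow (2 * l))).congr' ?_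
  filter_upwards [eventually_gt_atTop 0] with k hk
  have hk' : (0 : ℝ) < k := by positivity
  have h1 : (k : ℝ) ^ (2 * β * (α + l) - 1) = (k : ℝ) ^ (2 * β * α - 1) * ((k : ℝ) ^ β) ^ (2 * l) := by
    rw [← Real.rpow_mul_natCast hk'.le, ← Real.rpow_add hk']
    congr 1
    push_cast
    ring
  rw [h1, div_pow]
  field_simp

lemma tendsto_scaledGram {s b : ℕ → ℝ} {τ : ℕ → ℕ → ℝ} {f : ℕ → ℝ} {α β S B : ℝ}
    (hα : 0 < α) (hβ : 0 < β) (hS : 0 < S) (hB : 0 < B)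
    (hs0 : ∀ k, s k ≠ 0) (hb0 : ∀ k, 0 < b k)
    (hs : Tendsto (fun k : ℕ => s k ^ 2 / (k : ℝ) ^ (2 * β * α - 1)) atTop (𝓝 S))
    (hb : Tendsto (fun k : ℕ => b k / (k : ℝ) ^ β) atTop (𝓝 B))
    (hτ : ∀ i, Tendsto (fun n => τ n i) atTop (𝓝 (f i))) (i j : ℕ) :
    Tendsto (fun n => scaledGram s b τ n i j) atTop
      (𝓝 (f i * f j / (2 * β * (α + i + j)))) := by
  have hw := tendsto_weight_div_rpow hs hb (i + j)
  have hpos : 0 < 2 * β * (α + (i + j : ℕ)) := by positivity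
  have h1 := tendsto_sum_range_div_rpow
    (h := fun k => (s k * b k ^ (2 * i) * τ k i) * (s k * b k ^ (2 * j) * τ k j))
    (θ := 2 * β * (α + (i + j : ℕ)) - 1) (L := S * B ^ (2 * (i + j)) * (f i * f j)) (by linarith) (by
      refine (hw.mul ((hτ i).mul (hτ j))).congr fun k => ?_
      ring)
  have hne : S * B ^ (2 * (i + j)) ≠ 0 := by positivity
  have h2 := h1.div hw hne
  have h3 : S * B ^ (2 * (i + j)) * (f i * f j) / (2 * β * (α + (i + j : ℕ)) - 1 + 1) /
      (S * B ^ (2 * (i + j))) = f i * f j / (2 * β * (α + i + j)) := by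
    have : (α + i + j) ≠ 0 := by positivity
    rw [sub_add_cancel]
    push_cast
    rw [← add_assoc α]
    field_simp
  rw [h3] at h2
  refine h2.congr' ?_
  filter_upwards [eventually_gt_atTop 0] with n hn
  have hn' : (0 : ℝ) < n := by positivity
  simp only [Pi.div_apply, scaledGram]
  rw [Real.rpow_add_one hn'.ne']
  have := hs0 n
  have := (hb0 n).ne'
  have : (n : ℝ) ^ (2 * β * (α + (i + j : ℕ)) - 1) ≠ 0 := by positivity
  field_simp

lemma exists_bound_scaledGram {s b : ℕ → ℝ} {τ : ℕ → ℕ → ℝ} {α β S B : ℝ}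
    (hα : 0 < α) (hβ : 0 < β) (hS : 0 < S) (hB : 0 < B)
    (hs0 : ∀ k, s k ≠ 0) (hb0 : ∀ k, 0 < b k)
    (hs : Tendsto (fun k : ℕ => s k ^ 2 / (k : ℝ) ^ (2 * β * α - 1)) atTop (𝓝 S))
    (hb : Tendsto (fun k : ℕ => b k / (k : ℝ) ^ β) atTop (𝓝 B))
    (hτbd : ∀ ρ : ℝ, 0 < ρ → ∃ C : ℝ, ∀ k i, |τ k i| * ρ ^ i ≤ C) (i : ℕ)
    {ρ : ℝ} (hρ : 0 < ρ) :
    ∃ C : ℝ, ∀ᶠ n in atTop, ∀ j, |scaledGram s b τ n i j| * ρ ^ j ≤ C := by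
  obtain ⟨C₁, hC₁⟩ := hτbd (4 ^ 2) (by positivity)
  obtain ⟨C₂, hC₂⟩ := hτbd (4 ^ 2 * ρ) (by positivity)
  have hC₁0 : 0 ≤ C₁ := le_trans (by positivity) (hC₁ 0 0)
  have hW := (tendsto_scaledGram (τ := fun _ _ => 1) (f := fun _ => 1) hα hβ hS hB hs0 hb0 hs hb
    (fun _ => tendsto_const_nhds) 0 0)
  obtain ⟨W, hW⟩ := hW.isBoundedUnder_le
  refine ⟨W * (C₁ * C₂), ?_⟩
  filter_upwards [eventually_map.1 hW, eventually_forall_lt_le_four_mul hβ hB hb0 hb,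
    eventually_gt_atTop 0] with n hWn hbn hn j
  have hn' : (0 : ℝ) < n := by positivity
  have hsn : 0 < s n ^ 2 := by have := hs0 n; positivity
  have hbn0 := hb0 n
  have hterm (k : ℕ) (hk : k ∈ Finset.range n) :
      |(s k * b k ^ (2 * i) * τ k i) * (s k * b k ^ (2 * j) * τ k j)| * ρ ^ j ≤
        s k ^ 2 * (C₁ * C₂) * b n ^ (2 * (i + j)) := by
    have hbk := hb0 k
    have hbk' := hbn k (Finset.mem_range.1 hk)
    have h1 : |(s k * b k ^ (2 * i) * τ k i) * (s k * b k ^ (2 * j) * τ k j)| * ρ ^ j =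
        s k ^ 2 * (b k ^ (2 * i) * |τ k i|) * (b k ^ (2 * j) * (|τ k j| * ρ ^ j)) := by
      simp only [abs_mul, abs_pow, abs_of_pos hbk]
      rw [← sq_abs (s k)]
      ring
    have h2 : b k ^ (2 * i) * |τ k i| ≤ b n ^ (2 * i) * C₁ := by
      calc _ ≤ (4 * b n) ^ (2 * i) * |τ k i| := by gcongr
        _ = b n ^ (2 * i) * (|τ k i| * (4 ^ 2) ^ i) := by rw [mul_pow, pow_mul 4]; ring
        _ ≤ _ := by gcongr; exact hC₁ k i
    have h3 : b k ^ (2 * j) * (|τ k j| * ρ ^ j) ≤ b n ^ (2 * j) * C₂ := by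
      calc _ ≤ (4 * b n) ^ (2 * j) * (|τ k j| * ρ ^ j) := by gcongr
        _ = b n ^ (2 * j) * (|τ k j| * (4 ^ 2 * ρ) ^ j) := by
          rw [mul_pow, mul_pow, pow_mul 4]; ring
        _ ≤ _ := by gcongr; exact hC₂ k j
    rw [h1]
    calc _ ≤ s k ^ 2 * (b n ^ (2 * i) * C₁) * (b n ^ (2 * j) * C₂) := by gcongr
      _ = _ := by ring
  have hC0 : 0 ≤ C₁ * C₂ := mul_nonneg hC₁0 (le_trans (by positivity) (hC₂ 0 0))
  have hD : 0 < n * s n ^ 2 * b n ^ (2 * (i + j)) := by positivity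
  rw [scaledGram, abs_div, abs_of_pos hD, div_mul_eq_mul_div, div_le_iff₀ hD]
  calc _ ≤ (∑ k ∈ Finset.range n,
        |(s k * b k ^ (2 * i) * τ k i) * (s k * b k ^ (2 * j) * τ k j)|) * ρ ^ j := by
        gcongr
        exact Finset.abs_sum_le_sum_abs _ _
    _ ≤ ∑ k ∈ Finset.range n, s k ^ 2 * (C₁ * C₂) * b n ^ (2 * (i + j)) := by
        rw [Finset.sum_mul]
        exact Finset.sum_le_sum hterm
    _ = (scaledGram s b (fun _ _ => 1) n 0 0) * (C₁ * C₂) * (n * s n ^ 2 * b n ^ (2 * (i + j))) := by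
        rw [← Finset.sum_mul, ← Finset.sum_mul]
        simp only [scaledGram, mul_zero, add_zero, pow_zero, mul_one, ← sq]
        have := hs0 n
        field_simp
    _ ≤ _ := by
        gcongr

/-- The limiting Gram matrix is nonsingular. -/
lemma det_gram_ne_zero {N : ℕ} {α β : ℝ} (hα : 0 < α) (hβ : 0 < β) {f : ℕ → ℝ}
    (hf : ∀ i, f i ≠ 0) :
    (Matrix.of fun j i : Fin N => f i * f j / (2 * β * (α + (i : ℕ) + (j : ℕ)))).det ≠ 0 := by
  intro hdet
  obtain ⟨v, hv0, hv⟩ := Matrix.exists_mulVec_eq_zero_iff.2 hdet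
  refine hv0 ?_
  have := eq_zero_of_cauchy_sum_eq_zero hα (y := fun i : Fin N => f i * v i) fun j => by
    have h1 := congrFun hv j
    simp only [Matrix.mulVec, dotProduct, Matrix.of_apply, Pi.zero_apply] at h1
    have h2 : ∑ i : Fin N, f i * f j / (2 * β * (α + (i : ℕ) + (j : ℕ))) * v i =
        f j / (2 * β) * ∑ i : Fin N, f i * v i / (α + (i : ℕ) + (j : ℕ)) := by
      rw [Finset.mul_sum]
      refine Finset.sum_congr rfl fun i _ => ?_
      have : α + (i : ℕ) + (j : ℕ) ≠ 0 := by positivity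
      field_simp
    rw [h2] at h1
    exact (mul_eq_zero.1 h1).resolve_left (div_ne_zero (hf j) (by positivity))
  funext i
  have h3 := congrFun this i
  simpa [hf] using h3

/-- Solutions of nonsingular linear systems depend continuously on the data. -/
lemma exists_tendsto_solution {N : ℕ} {Λ : ℕ → Matrix (Fin N) (Fin N) ℝ}
    {G : Matrix (Fin N) (Fin N) ℝ} (hG : G.det ≠ 0) (hΛ : Tendsto Λ atTop (𝓝 G))
    {v : ℕ → Fin N → ℝ} {F : Fin N → ℝ} (hv : Tendsto v atTop (𝓝 F)) :
    ∃ (U : Fin N → ℝ) (Un : ℕ → Fin N → ℝ), G.mulVec U = F ∧ Tendsto Un atTop (𝓝 U) ∧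
      ∀ᶠ n in atTop, ∀ {x : Fin N → ℝ} {c : ℝ}, (Λ n).mulVec x = c • v n → x = c • Un n := by
  have hdet : Tendsto (fun n => (Λ n).det) atTop (𝓝 G.det) :=
    ((Continuous.matrix_det continuous_id).tendsto G).comp hΛ
  have hadj : Tendsto (fun n => (Λ n).adjugate) atTop (𝓝 G.adjugate) :=
    ((Continuous.matrix_adjugate continuous_id).tendsto G).comp hΛ
  refine ⟨G.det⁻¹ • (G.adjugate.mulVec F), fun n => (Λ n).det⁻¹ • ((Λ n).adjugate.mulVec (v n)),
    ?_, ?_, ?_⟩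
  · rw [Matrix.mulVec_smul, Matrix.mulVec_mulVec, Matrix.mul_adjugate, Matrix.smul_mulVec,
      Matrix.one_mulVec, smul_smul, inv_mul_cancel₀ hG, one_smul]
  · refine (hdet.inv₀ hG).smul (tendsto_pi_nhds.2 fun i => ?_)
    simp only [Matrix.mulVec, dotProduct]
    exact tendsto_finsetSum _ fun j _ =>
      (tendsto_pi_nhds.1 (tendsto_pi_nhds.1 hadj i) j).mul (tendsto_pi_nhds.1 hv j)
  · filter_upwards [hdet.eventually_ne hG] with n hn x c hx
    have h1 := congrArg (fun v => (Λ n).det⁻¹ • (Λ n).adjugate.mulVec v) hx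
    simp only [Matrix.mulVec_mulVec, Matrix.adjugate_mul, Matrix.smul_mulVec, Matrix.one_mulVec,
      smul_smul, inv_mul_cancel₀ hn, one_smul, Matrix.mulVec_smul] at h1
    rw [h1, smul_smul, mul_comm]

/-- Asymptotics of the solution of the linear system which expresses the coefficients of discrete
Sobolev orthonormal polynomials through those of the standard orthonormal polynomials. -/
lemma sobolev_coeff_asymptotics {N : ℕ} {α β S B : ℝ} (hα : 0 < α) (hβ : 0 < β) (hS : 0 < S)
    (hB : 0 < B) {s b : ℕ → ℝ} (hs0 : ∀ k, s k ≠ 0) (hb0 : ∀ k, 0 < b k)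
    (hs : Tendsto (fun k : ℕ => s k ^ 2 / (k : ℝ) ^ (2 * β * α - 1)) atTop (𝓝 S))
    (hb : Tendsto (fun k : ℕ => b k / (k : ℝ) ^ β) atTop (𝓝 B))
    {τ : ℕ → ℕ → ℝ} {f : ℕ → ℝ} (hτ : ∀ i, Tendsto (fun n => τ n i) atTop (𝓝 (f i)))
    (hf : ∀ i, f i ≠ 0)
    (hτbd : ∀ ρ : ℝ, 0 < ρ → ∃ C : ℝ, ∀ k i, |τ k i| * ρ ^ i ≤ C)
    {m : ℕ → ℝ} (hm : ∀ i < N, 0 < m i) {ξ : ℕ → ℕ → ℝ} {c : ℕ → ℝ} (hc : ∀ n, 0 < c n)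
    (hξ : ∀ n j, s n * b n ^ (2 * j) * ξ n j = c n * (s n * b n ^ (2 * j) * τ n j) -
      ∑ i : Fin N, m i * (s n * b n ^ (2 * (i : ℕ)) * ξ n i) *
        ∑ k ∈ Finset.range n,
          (s k * b k ^ (2 * (i : ℕ)) * τ k i) * (s k * b k ^ (2 * j) * τ k j))
    (hnorm : ∀ n, c n * (c n + ∑ i : Fin N, m i * (s n * b n ^ (2 * (i : ℕ)) * ξ n i) *
      (s n * b n ^ (2 * (i : ℕ)) * τ n i)) = 1) :
    (∀ j : ℕ, Tendsto (fun n => ξ n j) atTop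
      (𝓝 (f j * ∏ i ∈ Finset.range N, ((j : ℝ) - i) / (α + i + j)))) ∧
    ∀ ρ : ℝ, 0 < ρ → ∃ C : ℝ, ∀ᶠ n in atTop, ∀ j, |ξ n j| * ρ ^ j ≤ C := by
  classical
  set w : ℕ → ℕ → ℝ := fun n i => m i * (n * s n ^ 2 * b n ^ (4 * i)) with hw
  set u : ℕ → Fin N → ℝ := fun n i => w n i * ξ n i with hu
  have hwpos {n : ℕ} (hn : 0 < n) (i : Fin N) : 0 < w n i := by
    have := hs0 n
    have := hb0 n
    have := hm i i.2
    simp only [hw]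
    positivity
  have hξ' {n : ℕ} (hn : 0 < n) (j : ℕ) :
      ξ n j = c n * τ n j - ∑ i : Fin N, u n i * scaledGram s b τ n i j := by
    have h1 : s n * b n ^ (2 * j) ≠ 0 := mul_ne_zero (hs0 n) (pow_pos (hb0 n) _).ne'
    have hn' : (n : ℝ) ≠ 0 := by positivity
    have := hs0 n
    have := (hb0 n).ne'
    refine mul_left_cancel₀ h1 ?_
    rw [hξ, mul_sub, Finset.mul_sum]
    congr 1
    · ring
    · refine Finset.sum_congr rfl fun i _ => ?_
      simp only [hu, hw, scaledGram]
      have h2 : b n ^ (4 * (i : ℕ)) = b n ^ (2 * (i : ℕ)) * b n ^ (2 * (i : ℕ)) := by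
        rw [← pow_add]; congr 1; ring
      rw [h2, mul_add, pow_add]
      field_simp
  have hwtop (i : Fin N) : Tendsto (fun n => (w n i)⁻¹) atTop (𝓝 0) := by
    refine Tendsto.inv_tendsto_atTop ?_
    have h1 := tendsto_weight_div_rpow hs hb (2 * (i : ℕ))
    have hpos : 0 < 2 * β * (α + (2 * (i : ℕ) : ℕ)) := by positivity
    have h2 := h1.pos_mul_atTop (by positivity)
      ((tendsto_rpow_atTop hpos).comp tendsto_natCast_atTop_atTop)
    refine ((h2.const_mul_atTop (hm i i.2))).congr' ?_
    filter_upwards [eventually_gt_atTop 0] with n hn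
    have hn' : (0 : ℝ) < n := by positivity
    have h3 : (n : ℝ) ^ (2 * β * (α + (2 * (i : ℕ) : ℕ))) =
        (n : ℝ) ^ (2 * β * (α + (2 * (i : ℕ) : ℕ)) - 1) * n := by
      rw [← Real.rpow_add_one hn'.ne', sub_add_cancel]
    have h4 : (n : ℝ) ^ (2 * β * (α + (2 * (i : ℕ) : ℕ)) - 1) ≠ 0 := by positivity
    simp only [Function.comp, hw]
    rw [h3, ← mul_assoc 2 2]
    field_simp
    norm_num
  set Λ : ℕ → Matrix (Fin N) (Fin N) ℝ := fun n =>
    Matrix.of fun j i => scaledGram s b τ n i j + if j = i then (w n i)⁻¹ else 0 with hΛ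
  set G : Matrix (Fin N) (Fin N) ℝ :=
    Matrix.of fun j i => f i * f j / (2 * β * (α + (i : ℕ) + (j : ℕ))) with hG
  have hG0 : G.det ≠ 0 := det_gram_ne_zero hα hβ hf
  have hgram := tendsto_scaledGram hα hβ hS hB hs0 hb0 hs hb hτ
  have hΛlim : Tendsto Λ atTop (𝓝 G) := by
    refine tendsto_pi_nhds.2 fun j => tendsto_pi_nhds.2 fun i => ?_
    simp only [hΛ, hG, Matrix.of_apply]
    have h1 := hgram i j
    by_cases hij : j = i
    · subst hij
      simpa using h1.add (hwtop j)
    · simpa only [hij, if_false, add_zero] using h1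
  set F : Fin N → ℝ := fun i => f i with hF
  obtain ⟨U, Un, hGU, hUlim, hsolve⟩ := exists_tendsto_solution hG0 hΛlim
    (v := fun n i => τ n i) (F := F) (tendsto_pi_nhds.2 fun i => hτ i)
  have hsys {n : ℕ} (hn : 0 < n) : (Λ n).mulVec (u n) = c n • fun i : Fin N => τ n i := by
    funext j
    have h1 := hξ' hn j
    have h2 : ξ n j = (w n j)⁻¹ * u n j := by
      simp only [hu]
      rw [inv_mul_cancel_left₀ (hwpos hn j).ne']
    simp only [Matrix.mulVec, dotProduct, hΛ, Matrix.of_apply, add_mul, Finset.sum_add_distrib,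
      ite_mul, zero_mul, Finset.sum_ite_eq, Finset.mem_univ, if_true, Pi.smul_apply, smul_eq_mul]
    rw [← h2, h1]
    simp only [mul_comm (u n _)]
    ring
  have hueq : ∀ᶠ n in atTop, u n = c n • Un n := by
    filter_upwards [hsolve, eventually_gt_atTop 0] with n h hn
    exact h (hsys hn)
  have hclim : Tendsto c atTop (𝓝 1) := by
    have h1 : Tendsto (fun n : ℕ => 1 + (∑ i : Fin N, Un n i * τ n i) * (n : ℝ)⁻¹) atTop (𝓝 1) := by
      have h2 : Tendsto (fun n => ∑ i : Fin N, Un n i * τ n i) atTop (𝓝 (∑ i : Fin N, U i * f i)) :=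
        tendsto_finsetSum _ fun i _ => (tendsto_pi_nhds.1 hUlim i).mul (hτ i)
      simpa using (h2.mul (tendsto_inv_atTop_nhds_zero_nat (𝕜 := ℝ))).const_add 1
    have h3 := (h1.inv₀ one_ne_zero).sqrt
    rw [inv_one, Real.sqrt_one] at h3
    refine h3.congr' ?_
    filter_upwards [hueq, eventually_gt_atTop 0] with n hn hn0
    have hn' : (n : ℝ) ≠ 0 := by positivity
    have h4 := hnorm n
    have h5 : ∑ i : Fin N, m i * (s n * b n ^ (2 * (i : ℕ)) * ξ n i) *
        (s n * b n ^ (2 * (i : ℕ)) * τ n i) = c n * ((∑ i : Fin N, Un n i * τ n i) * (n : ℝ)⁻¹) := by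
      rw [Finset.sum_mul, Finset.mul_sum]
      refine Finset.sum_congr rfl fun i _ => ?_
      have h6 := congrFun hn i
      simp only [hu, hw, Pi.smul_apply, smul_eq_mul] at h6
      have h7 : b n ^ (4 * (i : ℕ)) = b n ^ (2 * (i : ℕ)) * b n ^ (2 * (i : ℕ)) := by
        rw [← pow_add]; congr 1; ring
      have h8 : c n * (Un n i * τ n i * (n : ℝ)⁻¹) = (c n * Un n i) * τ n i * (n : ℝ)⁻¹ := by ring
      rw [h8, ← h6, h7]
      field_simp
    rw [h5] at h4
    have h9 : (1 + (∑ i : Fin N, Un n i * τ n i) * (n : ℝ)⁻¹)⁻¹ = c n ^ 2 :=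
      inv_eq_of_mul_eq_one_left (by linear_combination h4)
    rw [h9, Real.sqrt_sq (hc n).le]
  have hulim (i : Fin N) : Tendsto (fun n => u n i) atTop (𝓝 (U i)) := by
    have h1 := hclim.mul (tendsto_pi_nhds.1 hUlim i)
    rw [one_mul] at h1
    refine h1.congr' ?_
    filter_upwards [hueq] with n hn
    rw [hn]; rfl
  constructor
  · intro j
    obtain ⟨y, hy⟩ := exists_partialFraction hα N
    have hUy (i : Fin N) : f i * U i / (2 * β) = y i := by
      have := eq_zero_of_cauchy_sum_eq_zero hα
        (y := fun i : Fin N => f i * U i / (2 * β) - y i) fun l => by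
          have h1 := congrFun hGU l
          simp only [Matrix.mulVec, dotProduct, hG, hF, Matrix.of_apply] at h1
          have h2 := hy (l : ℕ) (by positivity)
          rw [Finset.prod_eq_zero (Finset.mem_range.2 l.2) (by simp), Finset.sum_range] at h2
          simp only [sub_div, Finset.sum_sub_distrib]
          have h3 : ∑ i : Fin N, f i * f l / (2 * β * (α + (i : ℕ) + (l : ℕ))) * U i =
              f l * ∑ i : Fin N, f i * U i / (2 * β) / (α + (i : ℕ) + (l : ℕ)) := by
            rw [Finset.mul_sum]
            refine Finset.sum_congr rfl fun i _ => ?_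
            have : α + (i : ℕ) + (l : ℕ) ≠ 0 := by positivity
            field_simp
          rw [h3] at h1
          have h4 := mul_left_cancel₀ (hf l) (h1.trans (mul_one _).symm)
          rw [h4]
          linarith
      have h1 := congrFun this i
      simp only [Pi.zero_apply] at h1
      linarith
    have h1 : Tendsto (fun n => c n * τ n j - ∑ i : Fin N, u n i * scaledGram s b τ n i j) atTop
        (𝓝 (1 * f j - ∑ i : Fin N, U i * (f i * f j / (2 * β * (α + (i : ℕ) + j))))) :=
      (hclim.mul (hτ j)).sub (tendsto_finsetSum _ fun i _ => (hulim i).mul (hgram i j))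
    have h2 : 1 * f j - ∑ i : Fin N, U i * (f i * f j / (2 * β * (α + (i : ℕ) + j))) =
        f j * ∏ i ∈ Finset.range N, ((j : ℝ) - i) / (α + i + j) := by
      rw [hy j (by positivity), Finset.sum_range, mul_sub, mul_one, one_mul, Finset.mul_sum]
      congr 1
      refine Finset.sum_congr rfl fun i _ => ?_
      rw [← hUy i]
      have : α + (i : ℕ) + j ≠ 0 := by positivity
      field_simp
    rw [h2] at h1
    refine h1.congr' ?_
    filter_upwards [eventually_gt_atTop 0] with n hn
    exact (hξ' hn j).symm
  · intro ρ hρ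
    obtain ⟨C₀, hC₀⟩ := hτbd ρ hρ
    have hC₀0 : 0 ≤ C₀ := le_trans (by positivity) (hC₀ 0 0)
    choose C hC using fun i : Fin N =>
      exists_bound_scaledGram hα hβ hS hB hs0 hb0 hs hb hτbd i hρ
    refine ⟨2 * C₀ + ∑ i : Fin N, (|U i| + 1) * C i, ?_⟩
    filter_upwards [eventually_all.2 hC, eventually_gt_atTop 0,
      hclim.eventually_le_const (show (1 : ℝ) < 2 by norm_num),
      eventually_all.2 fun i => (hulim i).abs.eventually_le_const (lt_add_one |U i|)]
      with n hCn hn hcn hun j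
    rw [hξ' hn j]
    have h1 : |c n * τ n j| * ρ ^ j ≤ 2 * C₀ := by
      rw [abs_mul, abs_of_pos (hc n), mul_assoc]
      have := hC₀ n j
      gcongr
    have h2 : |∑ i : Fin N, u n i * scaledGram s b τ n i j| * ρ ^ j ≤
        ∑ i : Fin N, (|U i| + 1) * C i := by
      calc _ ≤ (∑ i : Fin N, |u n i * scaledGram s b τ n i j|) * ρ ^ j := by
            gcongr
            exact Finset.abs_sum_le_sum_abs _ _
        _ ≤ _ := by
            rw [Finset.sum_mul]
            refine Finset.sum_le_sum fun i _ => ?_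
            rw [abs_mul, mul_assoc]
            have := hCn i j
            have := hun i
            gcongr
    have h3 := mul_le_mul_of_nonneg_right
      (abs_sub (c n * τ n j) (∑ i : Fin N, u n i * scaledGram s b τ n i j)) (pow_nonneg hρ.le j)
    linarith

section Orthonormal

variable {F : ℝ[X] →ₗ[ℝ] ℝ[X] →ₗ[ℝ] ℝ} {P P' : ℕ → ℝ[X]}

/-- Fourier expansion with respect to a graded orthonormal family. -/
lemma eq_sum_smul_of_degree_lt (hdeg : ∀ n, (P n).degree = n)
    (hon : ∀ n m, F (P n) (P m) = if n = m then 1 else 0) {n : ℕ} {p : ℝ[X]}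
    (hp : p.degree < n) : p = ∑ k ∈ Finset.range n, F p (P k) • P k := by
  obtain ⟨a, ha⟩ : ∃ a : ℕ → ℝ, p = ∑ k ∈ Finset.range n, a k • P k := by
    induction n generalizing p with
    | zero =>
      refine ⟨0, ?_⟩
      simpa using hp
    | succ n ih =>
      have hlc : (P n).coeff n ≠ 0 := coeff_ne_zero_of_eq_degree (hdeg n)
      obtain ⟨a, ha⟩ := ih (p := p - (p.coeff n / (P n).coeff n) • P n) (by
        rw [degree_lt_iff_coeff_zero] at hp ⊢
        intro m hm
        rcases hm.eq_or_lt with rfl | hm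
        · simp [hlc]
        · rw [coeff_sub, coeff_smul, hp m hm,
            coeff_eq_zero_of_degree_lt (p := P n) (n := m) (by rw [hdeg]; exact_mod_cast hm)]
          simp)
      refine ⟨Function.update a n (p.coeff n / (P n).coeff n), ?_⟩
      rw [Finset.sum_range_succ, Function.update_self]
      rw [sub_eq_iff_eq_add] at ha
      conv_lhs => rw [ha]
      congr 1
      refine Finset.sum_congr rfl fun k hk => ?_
      rw [Function.update_of_ne (Finset.mem_range.1 hk).ne]
  conv_lhs => rw [ha]
  refine Finset.sum_congr rfl fun l hl => ?_
  rw [ha]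
  simp only [map_sum, LinearMap.sum_apply, map_smul, LinearMap.smul_apply, hon, smul_eq_mul,
    mul_ite, mul_one, mul_zero, Finset.sum_ite_eq', hl, if_true]

lemma apply_eq_zero_of_degree_lt (hdeg : ∀ n, (P n).degree = n)
    (hon : ∀ n m, F (P n) (P m) = if n = m then 1 else 0) {n : ℕ} {p : ℝ[X]}
    (hp : p.degree < n) : F (P n) p = 0 := by
  rw [eq_sum_smul_of_degree_lt hdeg hon hp, map_sum]
  refine Finset.sum_eq_zero fun k hk => ?_
  rw [map_smul, hon, if_neg (Finset.mem_range.1 hk).ne', smul_zero]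

/-- Graded orthonormal families with positive leading coefficients are unique. -/
lemma orthonormal_unique (hdeg : ∀ n, (P n).degree = n) (hlc : ∀ n, 0 < (P n).leadingCoeff)
    (hon : ∀ n m, F (P n) (P m) = if n = m then 1 else 0)
    (hdeg' : ∀ n, (P' n).degree = n) (hlc' : ∀ n, 0 < (P' n).leadingCoeff)
    (hon' : ∀ n m, F (P' n) (P' m) = if n = m then 1 else 0) (n : ℕ) : P n = P' n := by
  set κ := (P n).leadingCoeff / (P' n).leadingCoeff with hκ
  have hκ0 : 0 < κ := div_pos (hlc n) (hlc' n)
  have hco : (P n).coeff n = κ * (P' n).coeff n := by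
    have h1 := hlc' n
    rw [leadingCoeff, natDegree_eq_of_degree_eq_some (hdeg' n)] at h1
    rw [hκ, leadingCoeff, leadingCoeff, natDegree_eq_of_degree_eq_some (hdeg n),
      natDegree_eq_of_degree_eq_some (hdeg' n), div_mul_cancel₀ _ h1.ne']
  have hR : (P n - κ • P' n).degree < n := by
    rw [degree_lt_iff_coeff_zero]
    intro m hm
    rcases hm.eq_or_lt with rfl | hm
    · rw [coeff_sub, coeff_smul, hco, smul_eq_mul, sub_self]
    · have h1 : ((n : ℕ) : WithBot ℕ) < m := by exact_mod_cast hm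
      rw [coeff_sub, coeff_smul, coeff_eq_zero_of_degree_lt ((hdeg n).trans_lt h1),
        coeff_eq_zero_of_degree_lt ((hdeg' n).trans_lt h1), smul_zero, sub_self]
  have hR0 : P n - κ • P' n = 0 := by
    rw [eq_sum_smul_of_degree_lt hdeg hon hR]
    refine Finset.sum_eq_zero fun k hk => ?_
    have hk' : (P k).degree < n := by
      rw [hdeg]; exact_mod_cast Finset.mem_range.1 hk
    rw [map_sub, LinearMap.sub_apply, map_smul, LinearMap.smul_apply,
      apply_eq_zero_of_degree_lt hdeg hon hk', apply_eq_zero_of_degree_lt hdeg' hon' hk',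
      smul_zero, sub_zero, zero_smul]
  rw [sub_eq_zero] at hR0
  have h1 := hon n n
  rw [hR0, map_smul, map_smul, LinearMap.smul_apply, hon', if_pos rfl] at h1
  simp only [smul_eq_mul, mul_one] at h1
  have h2 : κ = 1 := by nlinarith
  rw [hR0, h2, one_smul]

end Orthonormal

lemma sobInner_zero_eq (μ : Measure ℝ) (r : ℕ) (M : ℕ → ℝ) (p q : ℝ[X]) :
    sobInner μ 0 r M p q = (∫ x, p.eval x * q.eval x ∂μ) +
      ∑ i ∈ Finset.range (r + 1), M i * (i.factorial : ℝ) ^ 2 * p.coeff i * q.coeff i := by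
  rw [sobInner]
  congr 1
  refine Finset.sum_congr rfl fun i _ => ?_
  simp only [← coeff_zero_eq_eval_zero, coeff_iterate_derivative, zero_add,
    Nat.descFactorial_self, nsmul_eq_mul]
  ring

/-- The discrete Sobolev inner product at the origin as a bilinear form. -/
def sobForm (μ : Measure ℝ) (hint : ∀ p : ℝ[X], Integrable (fun x => p.eval x) μ) (r : ℕ)
    (M : ℕ → ℝ) : ℝ[X] →ₗ[ℝ] ℝ[X] →ₗ[ℝ] ℝ :=
  have hint2 (p q : ℝ[X]) : Integrable (fun x => p.eval x * q.eval x) μ := by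
    simpa using hint (p * q)
  LinearMap.mk₂ ℝ (sobInner μ 0 r M)
    (fun p p' q => by
      simp only [sobInner_zero_eq, eval_add, add_mul, coeff_add, mul_add, Finset.sum_add_distrib]
      rw [integral_add (hint2 _ _) (hint2 _ _)]
      ring)
    (fun a p q => by
      simp only [sobInner_zero_eq, eval_smul, smul_eq_mul, coeff_smul, mul_add, Finset.mul_sum,
        mul_assoc, integral_const_mul]
      congr 1
      exact Finset.sum_congr rfl fun i _ => by ring)
    (fun p q q' => by
      simp only [sobInner_zero_eq, eval_add, coeff_add, mul_add, Finset.sum_add_distrib]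
      rw [integral_add (hint2 _ _) (hint2 _ _)]
      ring)
    (fun a p q => by
      simp only [sobInner_zero_eq, eval_smul, smul_eq_mul, coeff_smul, mul_add, Finset.mul_sum,
        mul_left_comm _ a, integral_const_mul])

lemma sobForm_apply {μ : Measure ℝ} (hint : ∀ p : ℝ[X], Integrable (fun x => p.eval x) μ)
    (r : ℕ) (M : ℕ → ℝ) (p q : ℝ[X]) : sobForm μ hint r M p q = sobInner μ 0 r M p q := rfl

lemma coeff_comp_neg_X (p : ℝ[X]) (j : ℕ) : (p.comp (-X)).coeff j = (-1) ^ j * p.coeff j := by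
  have : (-X : ℝ[X]) = C (-1) * X := by simp
  rw [this, comp_C_mul_X_coeff, mul_comm]

lemma IsOPS.isSobOPS_zero {μ : Measure ℝ} {P : ℕ → ℝ[X]} (hP : IsOPS μ P) :
    IsSobOPS μ 0 0 0 P :=
  ⟨hP.1, hP.2.1, fun n m => by simpa [sobInner] using hP.2.2 n m⟩

/-- For a symmetric measure, the Sobolev orthonormal polynomials at the origin have the parity of
their degree. -/
lemma IsSobOPS.coeff_eq_zero_of_odd {μ : Measure ℝ}
    (hint : ∀ p : ℝ[X], Integrable (fun x => p.eval x) μ) (hsym : μ.map (fun x => -x) = μ)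
    {r : ℕ} {M : ℕ → ℝ} {P : ℕ → ℝ[X]} (hP : IsSobOPS μ 0 r M P) {n j : ℕ} (hnj : Odd (n + j)) :
    (P n).coeff j = 0 := by
  have hinv (p q : ℝ[X]) : sobInner μ 0 r M (p.comp (-X)) (q.comp (-X)) = sobInner μ 0 r M p q := by
    rw [sobInner_zero_eq, sobInner_zero_eq]
    congr 1
    · conv_rhs => rw [← hsym]
      rw [integral_map measurable_neg.aemeasurable (by fun_prop)]
      simp
    · refine Finset.sum_congr rfl fun i _ => ?_
      rw [coeff_comp_neg_X, coeff_comp_neg_X]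
      have : ((-1 : ℝ) ^ i) * (-1) ^ i = 1 := by rw [← mul_pow]; simp
      linear_combination (M i * (i.factorial : ℝ) ^ 2 * p.coeff i * q.coeff i) * this
  have hsq (n : ℕ) : ((-1 : ℝ) ^ n) * (-1) ^ n = 1 := by rw [← mul_pow]; simp
  have hdeg (n : ℕ) : (((-1 : ℝ) ^ n) • (P n).comp (-X)).degree = n := by
    rw [smul_eq_C_mul, degree_C_mul (by simp), degree_comp_neg_X, hP.1]
  have huniq := orthonormal_unique (F := sobForm μ hint r M)
    (P' := fun n => ((-1 : ℝ) ^ n) • (P n).comp (-X)) hP.1 hP.2.1 hP.2.2 hdeg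
    (fun n => by
      rw [leadingCoeff, natDegree_eq_of_degree_eq_some (hdeg n), coeff_smul, coeff_comp_neg_X,
        smul_eq_mul, ← mul_assoc, hsq, one_mul]
      have := hP.2.1 n
      rwa [leadingCoeff, natDegree_eq_of_degree_eq_some (hP.1 n)] at this)
    (fun n m => by
      simp only [map_smul, LinearMap.smul_apply, sobForm_apply, hinv, hP.2.2, smul_eq_mul]
      split_ifs with h
      · subst h
        rw [mul_one, hsq]
      · simp) n
  have h1 := congrArg (fun p => p.coeff j) huniq
  simp only [coeff_smul, coeff_comp_neg_X, smul_eq_mul] at h1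
  rw [← mul_assoc, ← pow_add, hnj.neg_one_pow] at h1
  linarith

/-- Expansion of the coefficients of Sobolev orthonormal polynomials through those of the standard
orthonormal polynomials. -/
lemma IsSobOPS.exists_coeff_expansion {μ : Measure ℝ}
    (hint : ∀ p : ℝ[X], Integrable (fun x => p.eval x) μ) {r : ℕ} {M : ℕ → ℝ} {p q : ℕ → ℝ[X]}
    (hp : IsOPS μ p) (hq : IsSobOPS μ 0 r M q) :
    ∃ c : ℕ → ℝ, (∀ n, 0 < c n) ∧
      (∀ n j, (q n).coeff j = c n * (p n).coeff j - ∑ i ∈ Finset.range (r + 1),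
        M i * (i.factorial : ℝ) ^ 2 * (q n).coeff i *
          ∑ k ∈ Finset.range n, (p k).coeff i * (p k).coeff j) ∧
      ∀ n, c n * (c n + ∑ i ∈ Finset.range (r + 1),
        M i * (i.factorial : ℝ) ^ 2 * (q n).coeff i * (p n).coeff i) = 1 := by
  have hp0 := hp.isSobOPS_zero
  set F₀ := sobForm μ hint 0 0 with hF₀
  set F := sobForm μ hint r M with hF
  have hFF (f g : ℝ[X]) : F f g = F₀ f g + ∑ i ∈ Finset.range (r + 1),
      M i * (i.factorial : ℝ) ^ 2 * f.coeff i * g.coeff i := by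
    rw [hF, hF₀, sobForm_apply, sobForm_apply, sobInner_zero_eq, sobInner_zero_eq]
    simp
  have hlt {k n : ℕ} (h : k < n) : (p k).degree < n := by
    rw [hp.1]; exact_mod_cast h
  have hexp (n : ℕ) : q n = (∑ k ∈ Finset.range n, F₀ (q n) (p k) • p k) + F₀ (q n) (p n) • p n := by
    rw [← Finset.sum_range_succ (fun k => F₀ (q n) (p k) • p k)]
    exact eq_sum_smul_of_degree_lt (F := F₀) hp0.1 hp0.2.2
      (by rw [hq.1]; exact_mod_cast Nat.lt_succ_self n)
  have hlow {k n : ℕ} (h : k < n) : F₀ (q n) (p k) = -∑ i ∈ Finset.range (r + 1),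
      M i * (i.factorial : ℝ) ^ 2 * (q n).coeff i * (p k).coeff i := by
    have := apply_eq_zero_of_degree_lt (F := F) hq.1 hq.2.2 (hlt h)
    rw [hFF] at this
    linarith
  refine ⟨fun n => F₀ (q n) (p n), fun n => ?_, fun n j => ?_, fun n => ?_⟩
  · have h1 := congrArg (fun f => f.coeff n) (hexp n)
    simp only [coeff_add, finsetSum_coeff, coeff_smul, smul_eq_mul] at h1
    rw [Finset.sum_eq_zero fun k hk => by
      rw [coeff_eq_zero_of_degree_lt (hlt (Finset.mem_range.1 hk)), mul_zero], zero_add] at h1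
    have h2 := hq.2.1 n
    have h3 := hp.2.1 n
    rw [leadingCoeff, natDegree_eq_of_degree_eq_some (hq.1 n), h1] at h2
    rw [leadingCoeff, natDegree_eq_of_degree_eq_some (hp.1 n)] at h3
    exact (pos_iff_pos_of_mul_pos h2).2 h3
  · have h1 := congrArg (fun f => f.coeff j) (hexp n)
    simp only [coeff_add, finsetSum_coeff, coeff_smul, smul_eq_mul] at h1
    rw [h1, add_comm, sub_eq_add_neg]
    congr 1
    rw [Finset.sum_congr rfl fun k hk => by rw [hlow (Finset.mem_range.1 hk)]]
    simp only [neg_mul, Finset.sum_neg_distrib, Finset.sum_mul, Finset.mul_sum]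
    rw [Finset.sum_comm]
    congr 1
    exact Finset.sum_congr rfl fun i _ => Finset.sum_congr rfl fun k _ => by ring
  · have h1 : F (q n) (q n) = F₀ (q n) (p n) * F (q n) (p n) := by
      have h2 := congrArg (F (q n)) (hexp n)
      rw [map_add, map_sum, map_smul, smul_eq_mul] at h2
      rw [h2, Finset.sum_eq_zero, zero_add]
      intro k hk
      rw [map_smul, apply_eq_zero_of_degree_lt (F := F) hq.1 hq.2.2 (hlt (Finset.mem_range.1 hk)),
        smul_zero]
    have h2 : F (q n) (q n) = 1 := by
      rw [hF, sobForm_apply, hq.2.2, if_pos rfl]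
    rw [h2, hFF] at h1
    exact h1.symm

/-- The `k`-th coefficient of `phi ν`, as a power series in `z ^ 2`. -/
def phiCoeff (ν : ℝ) (k : ℕ) : ℝ := (-1) ^ k / (k.factorial * Real.Gamma (k + ν + 1))

lemma phi_eq_tsum (ν : ℝ) (z : ℂ) : phi ν z = ∑' k, (phiCoeff ν k : ℂ) * z ^ (2 * k) := by
  refine tsum_congr fun k => ?_
  have : ((k : ℂ) + (ν : ℂ) + 1) = ((k + ν + 1 : ℝ) : ℂ) := by push_cast; ring
  rw [this, Complex.Gamma_ofReal, phiCoeff]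
  push_cast
  ring

lemma phiCoeff_ne_zero {ν : ℝ} (hν : -1 < ν) (k : ℕ) : phiCoeff ν k ≠ 0 := by
  have h1 : 0 < (k : ℝ) + ν + 1 := by
    have : (0 : ℝ) ≤ k := by positivity
    linarith
  have := (Real.Gamma_pos_of_pos h1).ne'
  exact div_ne_zero (by simp) (by positivity)

lemma summable_phiCoeff {ν : ℝ} (hν : -1 < ν) {R : ℝ} (hR : 0 < R) :
    Summable fun k => |phiCoeff ν k| * R ^ k := by
  refine summable_of_ratio_test_tendsto_lt_one (l := 0) one_pos
    (Eventually.of_forall fun k => mul_ne_zero (abs_ne_zero.2 (phiCoeff_ne_zero hν k))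
      (by positivity)) ?_
  have h1 : Tendsto (fun k : ℕ => ((k : ℝ) + 1) * (k + (ν + 1))) atTop atTop :=
    (tendsto_natCast_atTop_atTop.atTop_add tendsto_const_nhds).atTop_mul_atTop₀
      (tendsto_natCast_atTop_atTop.atTop_add tendsto_const_nhds)
  refine (h1.const_div_atTop R).congr fun k => ?_
  have h2 : 0 < (k : ℝ) + ν + 1 := by
    have : (0 : ℝ) ≤ k := by positivity
    linarith
  have h3 := (Real.Gamma_pos_of_pos h2)
  have h4 : ((k + 1 : ℕ) : ℝ) + ν + 1 = (k + ν + 1) + 1 := by push_cast; ring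
  rw [phiCoeff, phiCoeff, h4, Real.Gamma_add_one h2.ne', Nat.factorial_succ]
  simp only [norm_mul, norm_pow, Real.norm_eq_abs, abs_div, abs_mul, abs_pow, abs_neg, abs_one,
    one_pow, Nat.abs_cast, abs_of_pos h2, abs_of_pos h3, abs_of_pos hR, Nat.cast_mul]
  rw [← add_assoc]
  push_cast
  rw [pow_succ]
  field_simp

lemma Gamma_add_nat_eq_mul_prod {x : ℝ} (hx : 0 < x) (N : ℕ) :
    Real.Gamma (x + N) = Real.Gamma x * ∏ i ∈ Finset.range N, (x + i) := by
  induction N with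
  | zero => simp
  | succ N ih =>
    rw [Finset.prod_range_succ, ← mul_assoc, ← ih, Nat.cast_succ, ← add_assoc,
      Real.Gamma_add_one (by positivity), mul_comm]

lemma phiCoeff_add_mul_prod {ν : ℝ} (hν : -1 < ν) (N k : ℕ) :
    phiCoeff ν (k + N) * ∏ i ∈ Finset.range N, (((k + N : ℕ) : ℝ) - i) / (ν + 1 + i + (k + N : ℕ)) =
      (-1) ^ N * phiCoeff (ν + 2 * N) k := by
  have h1 : ∏ i ∈ Finset.range N, (((k + N : ℕ) : ℝ) - i) = (k + N).descFactorial N := by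
    rw [Nat.descFactorial_eq_prod_range, Nat.cast_prod]
    refine Finset.prod_congr rfl fun i hi => ?_
    rw [Nat.cast_sub (by have := Finset.mem_range.1 hi; omega)]
  have h2 : ((k + N).factorial : ℝ) = k.factorial * (k + N).descFactorial N := by
    have := Nat.factorial_mul_descFactorial (Nat.le_add_left N k)
    rw [Nat.add_sub_cancel] at this
    exact_mod_cast this.symm
  have hx : 0 < ((k + N : ℕ) : ℝ) + ν + 1 := by
    have : (0 : ℝ) ≤ (k + N : ℕ) := by positivity
    linarith
  have h3 : (k : ℝ) + (ν + 2 * N) + 1 = (((k + N : ℕ) : ℝ) + ν + 1) + N := by push_cast; ring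
  have h4 : ∏ i ∈ Finset.range N, (ν + 1 + i + ((k + N : ℕ) : ℝ)) =
      ∏ i ∈ Finset.range N, (((k + N : ℕ) : ℝ) + ν + 1 + i) :=
    Finset.prod_congr rfl fun i _ => by ring
  have h5 : ∏ i ∈ Finset.range N, (((k + N : ℕ) : ℝ) + ν + 1 + i) ≠ 0 :=
    Finset.prod_ne_zero_iff.2 fun i _ => by positivity
  have h6 := (Real.Gamma_pos_of_pos hx).ne'
  have h7 : ((k + N).descFactorial N : ℝ) ≠ 0 := by
    intro h
    rw [h, mul_zero] at h2
    exact (Nat.factorial_pos _).ne' (by exact_mod_cast h2)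
  rw [Finset.prod_div_distrib, h1, h4, phiCoeff, phiCoeff, h3, Gamma_add_nat_eq_mul_prod hx, h2,
    pow_add]
  field_simp

lemma tsum_phiCoeff_mul_prod {ν : ℝ} (hν : -1 < ν) (N : ℕ) (z : ℂ) :
    ∑' j : ℕ, ((phiCoeff ν j * ∏ i ∈ Finset.range N, ((j : ℝ) - i) / (ν + 1 + i + j) : ℝ) : ℂ) *
      z ^ (2 * j) = (-1) ^ N * z ^ (2 * N) * phi (ν + 2 * N) z := by
  set G : ℕ → ℂ := fun j =>
    ((phiCoeff ν j * ∏ i ∈ Finset.range N, ((j : ℝ) - i) / (ν + 1 + i + j) : ℝ) : ℂ) * z ^ (2 * j)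
    with hG
  have hzero (j : ℕ) (hj : j < N) : G j = 0 := by
    simp only [hG]
    rw [Finset.prod_eq_zero (Finset.mem_range.2 hj) (by simp)]
    simp
  have hshift (k : ℕ) : G (k + N) =
      (-1) ^ N * z ^ (2 * N) * ((phiCoeff (ν + 2 * N) k : ℂ) * z ^ (2 * k)) := by
    simp only [hG]
    rw [phiCoeff_add_mul_prod hν, mul_add, pow_add]
    push_cast
    ring
  have hinj : Function.Injective fun k : ℕ => k + N := add_left_injective N
  rw [phi_eq_tsum, ← tsum_mul_left, ← tsum_congr hshift]
  refine (hinj.tsum_eq (f := G) fun j hj => ?_).symm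
  have : N ≤ j := by
    by_contra h
    exact hj (hzero j (not_le.1 h))
  exact ⟨j - N, Nat.sub_add_cancel this⟩

section Parity

variable {E : Type*} [AddCommMonoid E] {F : ℕ → E} {ε : ℕ}

lemma sum_range_two_mul_of_parity (hε : ε ≤ 1) (hF : ∀ k, Odd (k + ε) → F k = 0) (n : ℕ) :
    ∑ k ∈ Finset.range (2 * n), F k = ∑ k ∈ Finset.range n, F (2 * k + ε) := by
  induction n with
  | zero => simp
  | succ n ih =>
    rw [mul_add, mul_one, Finset.sum_range_succ, Finset.sum_range_succ, Finset.sum_range_succ, ih,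
      add_assoc]
    congr 1
    interval_cases ε
    · rw [hF (2 * n + 1) ⟨n, by ring⟩, add_zero, add_zero]
    · rw [hF (2 * n) ⟨n, by ring⟩, zero_add]

lemma sum_range_two_mul_add_of_parity (hε : ε ≤ 1) (hF : ∀ k, Odd (k + ε) → F k = 0) (n : ℕ) :
    ∑ k ∈ Finset.range (2 * n + ε), F k = ∑ k ∈ Finset.range n, F (2 * k + ε) := by
  rw [← sum_range_two_mul_of_parity hε hF]
  interval_cases ε
  · rfl
  · rw [Finset.sum_range_succ, hF (2 * n) ⟨n, by ring⟩, add_zero]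

lemma aeval_eq_tsum_of_parity {P : ℝ[X]} {n : ℕ} (hε : ε ≤ 1) (hdeg : P.natDegree = 2 * n + ε)
    (hP : ∀ j, Odd (j + ε) → P.coeff j = 0) (w : ℂ) :
    aeval w P = ∑' j, (P.coeff (2 * j + ε) : ℂ) * w ^ (2 * j + ε) := by
  rw [aeval_eq_sum_range' (show P.natDegree < 2 * (n + 1) by omega),
    sum_range_two_mul_of_parity hε fun k hk => by rw [hP k hk, zero_smul]]
  rw [tsum_eq_sum (s := Finset.range (n + 1))]
  · exact Finset.sum_congr rfl fun j _ => Complex.real_smul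
  · intro j hj
    rw [Finset.mem_range, not_lt] at hj
    rw [coeff_eq_zero_of_natDegree_lt (by omega), Complex.ofReal_zero, zero_mul]

end Parity

lemma exists_uniform_coeff_bound {τ : ℕ → ℕ → ℝ} {f : ℕ → ℝ}
    (hfin : ∀ n, (τ n).support.Finite) {ρ : ℝ} (hρ : 0 < ρ)
    (hf : Summable fun j => |f j| * ρ ^ j)
    (h : ∀ᶠ n in atTop, ∀ j, |τ n j - f j| * ρ ^ j ≤ 1) :
    ∃ C : ℝ, ∀ n j, |τ n j| * ρ ^ j ≤ C := by
  obtain ⟨N, hN⟩ := eventually_atTop.1 h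
  have hs (n : ℕ) : Summable fun j => |τ n j| * ρ ^ j :=
    summable_of_hasFiniteSupport ((hfin n).subset fun j hj => by
      simp only [Function.mem_support, ne_eq, mul_eq_zero, abs_eq_zero, not_or] at hj ⊢
      exact hj.1)
  have hnn (n : ℕ) : 0 ≤ ∑' j, |τ n j| * ρ ^ j := tsum_nonneg fun j => by positivity
  have hfn : 0 ≤ ∑' j, |f j| * ρ ^ j := tsum_nonneg fun j => by positivity
  refine ⟨1 + (∑' j, |f j| * ρ ^ j) + ∑ n ∈ Finset.range N, ∑' j, |τ n j| * ρ ^ j,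
    fun n j => ?_⟩
  rcases lt_or_ge n N with hn | hn
  · have h1 := (hs n).le_tsum j fun i _ => by positivity
    have h2 := Finset.single_le_sum (f := fun n => ∑' j, |τ n j| * ρ ^ j) (fun n _ => hnn n)
      (Finset.mem_range.2 hn)
    linarith
  · have h1 := hf.le_tsum j fun i _ => by positivity
    have h2 := hN n hn j
    have h3 : |τ n j| ≤ |τ n j - f j| + |f j| := by
      have := abs_add_le (τ n j - f j) (f j)
      rwa [sub_add_cancel] at this
    have h4 := mul_le_mul_of_nonneg_right h3 (pow_nonneg hρ.le j)
    have h5 := Finset.sum_nonneg (s := Finset.range N) fun n _ => hnn n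
    linarith

lemma tendsto_div_rpow_of_tendsto_div_mul {u : ℕ → ℝ} {A a : ℝ} (hA : A ≠ 0)
    (h : Tendsto (fun n : ℕ => u n / (A * (n : ℝ) ^ a)) atTop (𝓝 1)) :
    Tendsto (fun n : ℕ => u n / (n : ℝ) ^ a) atTop (𝓝 A) := by
  have := h.const_mul A
  rw [mul_one] at this
  refine this.congr fun n => ?_
  rw [← div_div, div_right_comm, mul_div_cancel₀ _ hA]

/-- Mehler–Heine asymptotics for the Sobolev orthonormal polynomials of a fixed parity `ε`. -/
lemma mehler_heine_sobolev_of_parity {μ : Measure ℝ}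
    (hint : ∀ p : ℝ[X], Integrable (fun x => p.eval x) μ) (hsym : μ.map (fun x => -x) = μ)
    {r : ℕ} {M : ℕ → ℝ} (hM : ∀ i ≤ 2 * r + 1, 0 < M i) {p q : ℕ → ℝ[X]} (hp : IsOPS μ p)
    (hq : IsSobOPS μ 0 (2 * r + 1) M q) {a b : ℕ → ℝ} (ha : ∀ n, 0 < a n) (hb : ∀ n, 0 < b n)
    {A B aexp bexp ν : ℝ} (hA : 0 < A) (hB : 0 < B) (hbexp : 0 < bexp) (hν : -1 < ν)
    (haA : Tendsto (fun n : ℕ => (a n) ^ (-(1 : ℝ) / 2) / (A * (n : ℝ) ^ aexp)) atTop (𝓝 1))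
    (hbB : Tendsto (fun n : ℕ => b n / (B * (n : ℝ) ^ bexp)) atTop (𝓝 1))
    (hlink : 2 * aexp + 1 = 2 * bexp * (ν + 1)) {ε : ℕ} (hε : ε ≤ 1)
    (hMH : ∀ K : Set ℂ, IsCompact K → TendstoUniformlyOn
      (fun (n : ℕ) (z : ℂ) => (((-1 : ℝ) ^ n * (a n) ^ ((1 : ℝ) / 2) : ℝ) : ℂ) *
        aeval (z / (b n : ℂ)) (p (2 * n + ε)))
      (fun z => z ^ ε * phi (ν + ε) z) atTop K)
    {K : Set ℂ} (hK : IsCompact K) :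
    TendstoUniformlyOn
      (fun (n : ℕ) (z : ℂ) => (((-1 : ℝ) ^ n * (a n) ^ ((1 : ℝ) / 2) : ℝ) : ℂ) *
        aeval (z / (b n : ℂ)) (q (2 * n + ε)))
      (fun z => z ^ ε *
        ((-1) ^ (r + 1) * z ^ (2 * (r + 1)) * phi (ν + ε + 2 * (r + 1 : ℕ)) z)) atTop K := by
  have hν' : -1 < ν + ε := by
    have : (0 : ℝ) ≤ ε := by positivity
    linarith
  set s : ℕ → ℝ := fun n => (-1) ^ n * a n ^ (-(1 : ℝ) / 2) * b n ^ ε with hsdef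
  have ha' (n : ℕ) : 0 < a n ^ (-(1 : ℝ) / 2) := Real.rpow_pos_of_pos (ha n) _
  have hs0 (n : ℕ) : s n ≠ 0 :=
    mul_ne_zero (mul_ne_zero (by simp) (ha' n).ne') (pow_ne_zero _ (hb n).ne')
  have hsb0 (n j : ℕ) : s n * b n ^ (2 * j) ≠ 0 := mul_ne_zero (hs0 n) (pow_ne_zero _ (hb n).ne')
  -- the rescaled coefficients of the polynomials of parity `ε`
  set T : (ℕ → ℝ[X]) → ℕ → ℕ → ℝ :=
    fun P n j => (P (2 * n + ε)).coeff (2 * j + ε) / (s n * b n ^ (2 * j)) with hT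
  have hTmul (P : ℕ → ℝ[X]) (n j : ℕ) :
      s n * b n ^ (2 * j) * T P n j = (P (2 * n + ε)).coeff (2 * j + ε) :=
    mul_div_cancel₀ _ (hsb0 n j)
  have hpar {r' : ℕ} {M' : ℕ → ℝ} {P : ℕ → ℝ[X]} (hP : IsSobOPS μ 0 r' M' P) (n i : ℕ)
      (hi : Odd (i + ε)) : (P (2 * n + ε)).coeff i = 0 :=
    hP.coeff_eq_zero_of_odd hint hsym
      (by rw [add_assoc, add_comm ε]; exact Even.add_odd ⟨n, by ring⟩ hi)
  have haeval {r' : ℕ} {M' : ℕ → ℝ} {P : ℕ → ℝ[X]} (hP : IsSobOPS μ 0 r' M' P) (n : ℕ) (z : ℂ) :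
      (((-1 : ℝ) ^ n * (a n) ^ ((1 : ℝ) / 2) : ℝ) : ℂ) * aeval (z / (b n : ℂ)) (P (2 * n + ε)) =
        z ^ ε * ∑' j, (T P n j : ℂ) * z ^ (2 * j) := by
    rw [aeval_eq_tsum_of_parity hε (natDegree_eq_of_degree_eq_some (hP.1 _)) (hpar hP n),
      ← tsum_mul_left, ← tsum_mul_left]
    refine tsum_congr fun j => ?_
    have h1 : a n ^ (-(1 : ℝ) / 2) * a n ^ ((1 : ℝ) / 2) = 1 := by
      rw [← Real.rpow_add (ha n)]; norm_num
    have h2 : ((-1 : ℝ) ^ n) * (-1) ^ n = 1 := by rw [← mul_pow]; simp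
    have h3 : (-1 : ℝ) ^ n * (a n) ^ ((1 : ℝ) / 2) * s n = b n ^ ε := by
      simp only [hsdef]
      linear_combination (b n ^ ε) * ((-1 : ℝ) ^ n) * (-1) ^ n * h1 + b n ^ ε * h2
    have h3' : (((-1 : ℝ) ^ n * (a n) ^ ((1 : ℝ) / 2) : ℝ) : ℂ) * (s n : ℂ) = (b n : ℂ) ^ ε := by
      exact_mod_cast h3
    have hb' : (b n : ℂ) ≠ 0 := by exact_mod_cast (hb n).ne'
    generalize (((-1 : ℝ) ^ n * (a n) ^ ((1 : ℝ) / 2) : ℝ) : ℂ) = x at h3' ⊢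
    rw [← hTmul, div_pow, pow_add, pow_add, Complex.ofReal_mul, Complex.ofReal_mul,
      Complex.ofReal_pow]
    field_simp
    linear_combination (z ^ (2 * j) * z ^ ε * (T P n j : ℂ)) * h3'
  have hfin (n : ℕ) : (T p n).support.Finite := by
    refine (Set.finite_Iic n).subset fun j hj => ?_
    by_contra hjn
    rw [Set.mem_Iic, not_le] at hjn
    refine hj ?_
    simp only [hT]
    rw [coeff_eq_zero_of_degree_lt, zero_div]
    rw [hp.1]
    exact_mod_cast (show 2 * n + ε < 2 * j + ε by omega)
  have hsum (R : ℝ) (hR : 0 < R) := summable_phiCoeff hν' hR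
  have hclose {ρ δ : ℝ} (hρ : 0 < ρ) (hδ : 0 < δ) :=
    eventually_coeff_le_of_tendstoUniformlyOn (ε := ε) hfin hsum (fun K hK => by
      simpa only [haeval hp.isSobOPS_zero, phi_eq_tsum] using hMH K hK) hρ hδ
  have hτ (i : ℕ) : Tendsto (fun n => T p n i) atTop (𝓝 (phiCoeff (ν + ε) i)) := by
    rw [Metric.tendsto_nhds]
    intro δ hδ
    filter_upwards [hclose one_pos (half_pos hδ)] with n hn
    have := hn i
    rw [one_pow, mul_one] at this
    rw [Real.dist_eq]
    linarith
  have hb2 := tendsto_div_rpow_of_tendsto_div_mul hB.ne' hbB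
  have hs : Tendsto (fun k : ℕ => s k ^ 2 / (k : ℝ) ^ (2 * bexp * (ν + ε + 1) - 1)) atTop
      (𝓝 ((A * B ^ ε) ^ 2)) := by
    refine (((tendsto_div_rpow_of_tendsto_div_mul hA.ne' haA).mul (hb2.pow ε)).pow 2).congr' ?_
    filter_upwards [eventually_gt_atTop 0] with n hn
    have hn' : (0 : ℝ) < n := by exact_mod_cast hn
    have h1 : 2 * bexp * (ν + ε + 1) - 1 = (aexp + bexp * ε) * (2 : ℕ) := by
      push_cast
      linear_combination -hlink
    have h2 : ((-1 : ℝ) ^ n) ^ 2 = 1 := by rw [← pow_mul, mul_comm, pow_mul]; simp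
    rw [h1, Real.rpow_mul_natCast hn'.le, Real.rpow_add hn', Real.rpow_mul_natCast hn'.le,
      div_pow, ← mul_div_mul_comm, div_pow]
    simp only [hsdef]
    rw [mul_assoc, mul_pow ((-1 : ℝ) ^ n), h2, one_mul]
  obtain ⟨c, hc, hcoeff, hnorm⟩ := hq.exists_coeff_expansion hint hp
  have hpar' (k j : ℕ) (hk : Odd (k + ε)) : (p k).coeff (2 * j + ε) = 0 :=
    hp.isSobOPS_zero.coeff_eq_zero_of_odd hint hsym
      (by rw [← add_assoc, add_right_comm]; exact hk.add_even ⟨j, by ring⟩)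
  have hr : 2 * r + 1 + 1 = 2 * (r + 1) := by ring
  obtain ⟨hlim, hbd⟩ := sobolev_coeff_asymptotics (N := r + 1) (α := ν + ε + 1) (β := bexp)
    (f := phiCoeff (ν + ε)) (τ := T p) (ξ := T q) (c := fun n => c (2 * n + ε))
    (m := fun i => M (2 * i + ε) * ((2 * i + ε).factorial : ℝ) ^ 2)
    (by linarith) hbexp (by positivity) hB hs0 hb hs hb2 hτ (phiCoeff_ne_zero hν')
    (fun ρ hρ => exists_uniform_coeff_bound hfin hρ (hsum ρ hρ) (hclose hρ one_pos))
    (fun i hi => mul_pos (hM _ (by omega)) (by positivity)) (fun n => hc _)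
    (fun n j => by
      simp only [hTmul]
      rw [hcoeff, hr, sum_range_two_mul_of_parity hε fun k hk => by rw [hpar hq n k hk]; ring,
        Finset.sum_range]
      congr 1
      refine Finset.sum_congr rfl fun i _ => ?_
      rw [sum_range_two_mul_add_of_parity hε fun k hk => by rw [hpar' k j hk, mul_zero]])
    (fun n => by
      simp only [hTmul]
      rw [← hnorm (2 * n + ε), hr,
        sum_range_two_mul_of_parity hε fun k hk => by rw [hpar hq n k hk]; ring,
        Finset.sum_range])
  simpa only [haeval hq, tsum_phiCoeff_mul_prod hν'] using
    tendstoUniformlyOn_of_coeff (ε := ε) hlim hbd hK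

/-- **Theorem 6 (symmetric Mehler–Heine asymptotics).** For a symmetric measure with
all masses `M_0,…,M_{2r+1}` positive, under the Mehler–Heine hypotheses on `p_{2n}`,
`p_{2n+1}` and the leading coefficient conditions,
`(-1)^n a_n^{1/2} q_{2n}(z/b_n) → (-1)^{r+1} z^{2r+2} φ_{ν+2r+2}(z)` and
`(-1)^n a_n^{1/2} q_{2n+1}(z/b_n) → (-1)^{r+1} z^{2r+3} φ_{ν+2r+3}(z)` uniformly on
compact subsets of `ℂ`. -/
theorem symmetric_mehler_heine_sobolev
    (μ : Measure ℝ) [IsFiniteMeasure μ]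
    (hsupp : (measSupport μ).Infinite)
    (hint : ∀ p : Polynomial ℝ, Integrable (fun x => p.eval x) μ)
    (hsym : μ.map (fun x => -x) = μ)
    (r : ℕ) (M : ℕ → ℝ) (hM : ∀ i ≤ 2 * r + 1, 0 < M i)
    (p : ℕ → Polynomial ℝ) (hp : IsOPS μ p)
    (q : ℕ → Polynomial ℝ) (hq : IsSobOPS μ 0 (2 * r + 1) M q)
    (a b : ℕ → ℝ) (ha : ∀ n, 0 < a n) (hb : ∀ n, 0 < b n)
    (A B bexp : ℝ) (aexp : ℝ) (hA : 0 < A) (hB : 0 < B) (hbexp : 0 < bexp)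
    (ν : ℝ) (hν : -1 < ν)
    (haA : Filter.Tendsto (fun n : ℕ => (a n) ^ (-(1 : ℝ) / 2) / (A * (n : ℝ) ^ aexp))
      Filter.atTop (nhds 1))
    (hbB : Filter.Tendsto (fun n : ℕ => b n / (B * (n : ℝ) ^ bexp)) Filter.atTop (nhds 1))
    (hlink : 2 * aexp + 1 = 2 * bexp * (ν + 1))
    (hMHeven : ∀ K : Set ℂ, IsCompact K →
      TendstoUniformlyOn
        (fun (n : ℕ) (z : ℂ) =>
          (((-1 : ℝ) ^ n * (a n) ^ ((1 : ℝ) / 2) : ℝ) : ℂ) *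
            Polynomial.aeval (z / (b n : ℂ)) (p (2 * n)))
        (fun z => phi ν z) Filter.atTop K)
    (hMHodd : ∀ K : Set ℂ, IsCompact K →
      TendstoUniformlyOn
        (fun (n : ℕ) (z : ℂ) =>
          (((-1 : ℝ) ^ n * (a n) ^ ((1 : ℝ) / 2) : ℝ) : ℂ) *
            Polynomial.aeval (z / (b n : ℂ)) (p (2 * n + 1)))
        (fun z => z * phi (ν + 1) z) Filter.atTop K)
    (hgammaEven : Filter.Tendsto
      (fun n : ℕ => (p (2 * n)).leadingCoeff / (p (2 * n + 1)).leadingCoeff * (b n / n))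
      Filter.atTop (nhds (1 / (2 * bexp))))
    (hgammaOdd : Filter.Tendsto
      (fun n : ℕ => (p (2 * n + 1)).leadingCoeff / (p (2 * n + 2)).leadingCoeff * (b n / n))
      Filter.atTop (nhds (1 / (2 * bexp)))) :
    ∀ K : Set ℂ, IsCompact K →
      (TendstoUniformlyOn
        (fun (n : ℕ) (z : ℂ) =>
          (((-1 : ℝ) ^ n * (a n) ^ ((1 : ℝ) / 2) : ℝ) : ℂ) *
            Polynomial.aeval (z / (b n : ℂ)) (q (2 * n)))
        (fun z => (-1 : ℂ) ^ (r + 1) * z ^ (2 * r + 2) * phi (ν + 2 * r + 2) z)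
        Filter.atTop K) ∧
      (TendstoUniformlyOn
        (fun (n : ℕ) (z : ℂ) =>
          (((-1 : ℝ) ^ n * (a n) ^ ((1 : ℝ) / 2) : ℝ) : ℂ) *
            Polynomial.aeval (z / (b n : ℂ)) (q (2 * n + 1)))
        (fun z => (-1 : ℂ) ^ (r + 1) * z ^ (2 * r + 3) * phi (ν + 2 * r + 3) z)
        Filter.atTop K) := by
  intro K hK
  have heven := mehler_heine_sobolev_of_parity hint hsym hM hp hq ha hb hA hB hbexp hν haA hbB hlink
    (zero_le_one' ℕ) (by simpa using hMHeven) hK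
  have hodd := mehler_heine_sobolev_of_parity hint hsym hM hp hq ha hb hA hB hbexp hν haA hbB hlink
    le_rfl (by simpa using hMHodd) hK
  refine ⟨heven.congr_right fun z _ => ?_, hodd.congr_right fun z _ => ?_⟩
  · have h : ν + (0 : ℕ) + 2 * (r + 1 : ℕ) = ν + 2 * r + 2 := by push_cast; ring
    simp only [h]
    ring
  · have h : ν + (1 : ℕ) + 2 * (r + 1 : ℕ) = ν + 2 * r + 3 := by push_cast; ring
    simp only [h]
    ring
end
end

section
/- Fix an integer j ≥ 0 and a mass M > 0, and let (q_n)_{n≥0} be the orthonormal polynomials with respect to (p,q)₁ = ∫ p q dμ + M p^{(j)}(c) q^{(j)}(c), with positive leading coefficients γ̃_n; let γ_n be the leading coefficient of p_n. Then for every n ≥ 1: (i) q_n(x) = (γ̃_n/γ_n)·[ p_n(x) − (M p_n^{(j)}(c)/(1 + M K_{n−1}^{(j,j)}(c,c))) · K_{n−1}^{(0,j)}(x,c) ] as an identity of polynomials, where K_m^{(k,h)}(x,c) = Σ_{i=0}^m p_i^{(k)}(x) p_i^{(h)}(c); and (ii) (γ_n/γ̃_n)² = 1 + M (p_n^{(j)}(c))²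 / (1 + M K_{n−1}^{(j,j)}(c,c)). -/
open MeasureTheory Polynomial Filter Topology

noncomputable section

/-- The inner product `(p,q)₁ = ∫ p q dμ + M p^{(j)}(c) q^{(j)}(c)` with a single mass. -/
def oneMassInner (μ : Measure ℝ) (c : ℝ) (j : ℕ) (M : ℝ) (p q : Polynomial ℝ) : ℝ :=
  (∫ x, p.eval x * q.eval x ∂μ) +
    M * (Polynomial.derivative^[j] p).eval c * (Polynomial.derivative^[j] q).eval c

/-- `Q` is the sequence of orthonormal polynomials for the one-mass inner product. -/
def IsOneMassOPS (μ : Measure ℝ) (c : ℝ) (j : ℕ) (M : ℝ) (Q : ℕ → Polynomial ℝ) : Prop :=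
  (∀ n, (Q n).degree = n) ∧ (∀ n, 0 < (Q n).leadingCoeff) ∧
    ∀ n m, oneMassInner μ c j M (Q n) (Q m) = if n = m then 1 else 0

/-- A linear map vanishing on the first `n` terms of a polynomial sequence vanishes on every
polynomial of degree less than `n`. -/
lemma Polynomial.Sequence.apply_eq_zero_of_degree_lt {K V : Type*} [Field K] [AddCommGroup V]
    [Module K V] (S : Polynomial.Sequence K) {n : ℕ} (T : K[X] →ₗ[K] V)
    (hT : ∀ i < n, T (S i) = 0) {f : K[X]} (hf : f.degree < n) : T f = 0 := by
  have hspan : Submodule.span K (S '' Set.Iio n) ≤ LinearMap.ker T := by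
    rw [Submodule.span_le]
    rintro _ ⟨i, hi, rfl⟩
    exact hT i hi
  rw [S.span_degreeLT fun i _ => by simp] at hspan
  exact hspan (mem_degreeLT.mpr hf)

/-- Pairing with the terms of an orthonormal polynomial sequence separates polynomials. -/
lemma Polynomial.Sequence.eq_zero_of_orthonormal {K : Type*} [Field K]
    (S : Polynomial.Sequence K) (B : LinearMap.BilinForm K K[X])
    (hS : ∀ i k, B (S i) (S k) = if i = k then 1 else 0)
    {f : K[X]} (hf : ∀ k, B f (S k) = 0) : f = 0 := by
  let b := S.basis fun i => by simp
  have hcoord (k : ℕ) : B.flip (S k) = b.coord k := by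
    refine b.ext fun i => ?_
    rw [b.coord_apply, b.repr_self, Finsupp.single_apply]
    simp [b, hS]
  refine b.ext_elem fun k => ?_
  rw [← b.coord_apply, ← hcoord]
  exact (hf k).trans (by simp)

/-- The bilinear form `(f, g) ↦ ∫ f g dμ` on polynomials. -/
def integralForm (μ : Measure ℝ) (hint : ∀ f : ℝ[X], Integrable (fun x => f.eval x) μ) :
    LinearMap.BilinForm ℝ ℝ[X] :=
  LinearMap.mk₂ ℝ (fun f g => ∫ x, f.eval x * g.eval x ∂μ)
    (fun f₁ f₂ g => by
      simp only [← eval_mul]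
      rw [← integral_add (hint _) (hint _)]
      simp [add_mul])
    (fun a f g => by simp [mul_assoc, integral_const_mul])
    (fun f g₁ g₂ => by
      simp only [← eval_mul]
      rw [← integral_add (hint _) (hint _)]
      simp [mul_add])
    (fun a f g => by simp [mul_left_comm, integral_const_mul])

/-- The functional `f ↦ f^{(j)}(c)` on polynomials. -/
def evalIterateDerivative (c : ℝ) (j : ℕ) : ℝ[X] →ₗ[ℝ] ℝ :=
  leval c ∘ₗ (derivative (R := ℝ)) ^ j

lemma evalIterateDerivative_apply (c : ℝ) (j : ℕ) (f : ℝ[X]) :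
    evalIterateDerivative c j f = (derivative^[j] f).eval c := by
  simp [evalIterateDerivative, Module.End.pow_apply]

/-- Orthonormal sequences under a rank-one perturbation of the bilinear form. -/
lemma Polynomial.Sequence.orthonormal_rankOne_perturbation
    (B B' : LinearMap.BilinForm ℝ ℝ[X]) (L : ℝ[X] →ₗ[ℝ] ℝ) {M : ℝ} (hM : 0 ≤ M)
    (hB' : ∀ f g, B' f g = B f g + M * L f * L g)
    (P Q : Polynomial.Sequence ℝ)
    (hP : ∀ i k, B (P i) (P k) = if i = k then 1 else 0)
    (hQ : ∀ i k, B' (Q i) (Q k) = if i = k then 1 else 0) (n : ℕ) :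
    (Q n = ((Q n).leadingCoeff / (P n).leadingCoeff) •
        (P n - (M * L (P n) / (1 + M * ∑ i ∈ Finset.range n, L (P i) ^ 2)) •
          ∑ i ∈ Finset.range n, L (P i) • P i)) ∧
    ((P n).leadingCoeff / (Q n).leadingCoeff) ^ 2 =
      1 + M * L (P n) ^ 2 / (1 + M * ∑ i ∈ Finset.range n, L (P i) ^ 2) := by
  set s := ∑ i ∈ Finset.range n, L (P i) ^ 2 with hs
  set a := M * L (P n) / (1 + M * s) with ha
  set u := ∑ i ∈ Finset.range n, L (P i) • P i with hu
  set l := (Q n).leadingCoeff / (P n).leadingCoeff with hl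
  have hden : 1 + M * s ≠ 0 := by positivity
  have hPlc : (P n).leadingCoeff ≠ 0 := by simp
  have hQlc : (Q n).leadingCoeff ≠ 0 := by simp
  have hLu : L u = s := by simp [hu, hs, sq]
  have hBu (k : ℕ) : B u (P k) = if k < n then L (P k) else 0 := by
    simp [hu, hP]
  have hudeg : u.degree < n := by
    rw [← mem_degreeLT]
    refine Submodule.sum_mem _ fun i hi => Submodule.smul_mem _ _ ?_
    rw [mem_degreeLT, P.degree_eq]
    exact_mod_cast Finset.mem_range.mp hi
  have hLr : M * L (P n - a • u) = a := by
    rw [map_sub, map_smul, hLu, smul_eq_mul, ha]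
    field_simp
    ring
  have hrP (i : ℕ) (hi : i < n) : B' (P n - a • u) (P i) = 0 := by
    rw [hB', hLr]
    simp [hBu, hP, hi, hi.ne']
  have hrlow {f : ℝ[X]} (hf : f.degree < n) : B' (P n - a • u) f = 0 :=
    P.apply_eq_zero_of_degree_lt (B' (P n - a • u)) hrP hf
  have hQlow {f : ℝ[X]} (hf : f.degree < n) : B' (Q n) f = 0 :=
    Q.apply_eq_zero_of_degree_lt (B' (Q n)) (fun i hi => by simp [hQ, hi.ne']) hf
  have hddeg : (Q n - l • (P n - a • u)).degree < n := by
    have hlead : (Q n - l • P n).degree < n := by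
      have hl0 : l ≠ 0 := div_ne_zero hQlc hPlc
      have := degree_sub_lt_left (p := Q n) (q := l • P n)
        (by rw [smul_eq_C_mul, degree_C_mul hl0, P.degree_eq, Q.degree_eq]) (Q.ne_zero n)
        (by rw [smul_eq_C_mul, leadingCoeff_mul, leadingCoeff_C, hl, div_mul_cancel₀ _ hPlc])
      rwa [Q.degree_eq] at this
    rw [← mem_degreeLT] at hlead hudeg ⊢
    rw [smul_sub, ← sub_add]
    exact add_mem hlead (Submodule.smul_mem _ _ (Submodule.smul_mem _ _ hudeg))
  have heq : Q n = l • (P n - a • u) := by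
    refine sub_eq_zero.mp (Q.eq_zero_of_orthonormal B' hQ fun k => ?_)
    rcases lt_or_ge k n with hk | hk
    · have hkdeg : (Q k).degree < n := by
        rw [Q.degree_eq]
        exact_mod_cast hk
      rw [map_sub, map_smul, LinearMap.sub_apply, LinearMap.smul_apply, hQlow hkdeg,
        hrlow hkdeg, smul_zero, sub_zero]
    · exact Q.apply_eq_zero_of_degree_lt (B'.flip (Q k))
        (fun i hi => by simp [hQ, (hi.trans_le hk).ne]) hddeg
  refine ⟨heq, ?_⟩
  have hnorm : B' (P n - a • u) (P n - a • u) = 1 + M * L (P n) ^ 2 / (1 + M * s) := by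
    rw [map_sub (B' (P n - a • u)), map_smul, hrlow hudeg, hB', hLr]
    simp only [map_sub, map_smul, LinearMap.sub_apply, LinearMap.smul_apply, hBu, hP, ha]
    simp
    ring
  have hone := hQ n n
  rw [heq] at hone
  simp only [map_smul, LinearMap.smul_apply] at hone
  rw [hnorm, if_pos trivial, smul_eq_mul, smul_eq_mul, hl] at hone
  rw [← mul_right_inj' (pow_ne_zero 2 (div_ne_zero hQlc hPlc))]
  rw [sq ((Q n).leadingCoeff / _), mul_assoc _ _ (1 + _), hone]
  field_simp

/-- **Fourier expansion with one mass.** For the orthonormal polynomials `q_n` of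
`(p,q)₁ = ∫ p q dμ + M p^{(j)}(c) q^{(j)}(c)`, with `γ̃_n`, `γ_n` the leading coefficients
of `q_n`, `p_n`:
(i) `q_n = (γ̃_n/γ_n)[p_n − (M p_n^{(j)}(c)/(1+M K_{n-1}^{(j,j)}(c,c))) K_{n-1}^{(0,j)}(·,c)]`;
(ii) `(γ_n/γ̃_n)² = 1 + M (p_n^{(j)}(c))²/(1+M K_{n-1}^{(j,j)}(c,c))`. -/
theorem one_mass_fourier_expansion
    (μ : Measure ℝ) [IsFiniteMeasure μ]
    (hsupp : (measSupport μ).Infinite)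
    (hint : ∀ p : Polynomial ℝ, Integrable (fun x => p.eval x) μ)
    (c : ℝ) (j : ℕ) (M : ℝ) (hM : 0 < M)
    (p : ℕ → Polynomial ℝ) (hp : IsOPS μ p)
    (q : ℕ → Polynomial ℝ) (hq : IsOneMassOPS μ c j M q)
    (n : ℕ) (hn : 1 ≤ n) :
    (q n = Polynomial.C ((q n).leadingCoeff / (p n).leadingCoeff) *
        (p n - Polynomial.C
            (M * (Polynomial.derivative^[j] (p n)).eval c /
              (1 + M * ∑ i ∈ Finset.range n, ((Polynomial.derivative^[j] (p i)).eval c) ^ 2)) *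
          ∑ i ∈ Finset.range n,
            Polynomial.C ((Polynomial.derivative^[j] (p i)).eval c) * p i)) ∧
    ((p n).leadingCoeff / (q n).leadingCoeff) ^ 2 =
      1 + M * ((Polynomial.derivative^[j] (p n)).eval c) ^ 2 /
        (1 + M * ∑ i ∈ Finset.range n, ((Polynomial.derivative^[j] (p i)).eval c) ^ 2) := by
  let B := integralForm μ hint
  let L := evalIterateDerivative c j
  let B' : LinearMap.BilinForm ℝ ℝ[X] := B + M • LinearMap.BilinForm.linMulLin L L
  have hB' (f g : ℝ[X]) : B' f g = B f g + M * L f * L g := by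
    simp [B', mul_assoc]
  have key := Polynomial.Sequence.orthonormal_rankOne_perturbation B B' L hM.le hB' ⟨p, hp.1⟩
    ⟨q, hq.1⟩ hp.2.2
    (fun i k => by
      rw [hB', ← hq.2.2 i k]
      simp only [L, evalIterateDerivative_apply]
      rfl) n
  simpa only [L, evalIterateDerivative_apply, smul_eq_C_mul] using key
end
end

section
/- Suppose there is a strictly increasing function f: ℕ → ℝ with 2f(0)+1 > 0 such that for every integer k ≥ 0 there exists a nonzero constant C_k with lim_{n→∞} p_n^{(k)}(c)/((−1)^n n^{f(k)}) = C_k. Then the leading coefficients γ̃_n of q_n and γ_n of p_n satisfy lim_{n→∞} γ̃_n/γ_n = 1. -/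
open MeasureTheory Polynomial Filter Topology

noncomputable section

section SobolevInner

variable {μ : Measure ℝ} {c : ℝ} {r : ℕ} {M : ℕ → ℝ}

theorem integrable_eval_mul_eval (hint : ∀ p : Polynomial ℝ, Integrable (fun x => p.eval x) μ)
    (p q : Polynomial ℝ) : Integrable (fun x => p.eval x * q.eval x) μ := by
  simpa using hint (p * q)

theorem sobInner_add_left (hint : ∀ p : Polynomial ℝ, Integrable (fun x => p.eval x) μ)
    (p₁ p₂ q : Polynomial ℝ) :
    sobInner μ c r M (p₁ + p₂) q = sobInner μ c r M p₁ q + sobInner μ c r M p₂ q := by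
  simp only [sobInner, eval_add, iterate_map_add, add_mul, mul_add, Finset.sum_add_distrib]
  rw [integral_add (integrable_eval_mul_eval hint _ _) (integrable_eval_mul_eval hint _ _)]
  ring

theorem sobInner_smul_left (a : ℝ) (p q : Polynomial ℝ) :
    sobInner μ c r M (a • p) q = a * sobInner μ c r M p q := by
  simp only [sobInner, eval_smul, iterate_derivative_smul, smul_eq_mul, mul_add, Finset.mul_sum,
    mul_assoc, integral_const_mul]
  congr 1
  exact Finset.sum_congr rfl fun i _ => by ring

theorem sobInner_comm (p q : Polynomial ℝ) :
    sobInner μ c r M p q = sobInner μ c r M q p := by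
  simp only [sobInner]
  congr 1
  · exact integral_congr_ae (Eventually.of_forall fun x => mul_comm _ _)
  · exact Finset.sum_congr rfl fun i _ => by ring

theorem sobInner_add_right (hint : ∀ p : Polynomial ℝ, Integrable (fun x => p.eval x) μ)
    (p q₁ q₂ : Polynomial ℝ) :
    sobInner μ c r M p (q₁ + q₂) = sobInner μ c r M p q₁ + sobInner μ c r M p q₂ := by
  rw [sobInner_comm, sobInner_add_left hint, sobInner_comm q₁, sobInner_comm q₂]

theorem sobInner_smul_right (a : ℝ) (p q : Polynomial ℝ) :
    sobInner μ c r M p (a • q) = a * sobInner μ c r M p q := by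
  rw [sobInner_comm, sobInner_smul_left, sobInner_comm]

theorem integral_sq_le_sobInner_self (hM : ∀ i ≤ r, 0 ≤ M i) (p : Polynomial ℝ) :
    ∫ x, p.eval x * p.eval x ∂μ ≤ sobInner μ c r M p p := by
  refine le_add_of_nonneg_right (Finset.sum_nonneg fun i hi => ?_)
  rw [mul_assoc]
  exact mul_nonneg (hM i (Nat.lt_succ_iff.1 (Finset.mem_range.1 hi))) (mul_self_nonneg _)

theorem sobInner_self_nonneg (hM : ∀ i ≤ r, 0 ≤ M i) (p : Polynomial ℝ) :
    0 ≤ sobInner μ c r M p p :=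
  (integral_nonneg fun _ => mul_self_nonneg _).trans (integral_sq_le_sobInner_self hM p)

theorem sobInner_zero_mass (p q : Polynomial ℝ) :
    sobInner μ c r (fun _ => 0) p q = ∫ x, p.eval x * q.eval x ∂μ := by
  simp [sobInner]

theorem IsOPS.isSobOPS_zero_mass {P : ℕ → Polynomial ℝ} (hP : IsOPS μ P) :
    IsSobOPS μ c r (fun _ => 0) P :=
  ⟨hP.1, hP.2.1, fun n m => by rw [sobInner_zero_mass, hP.2.2]⟩

variable {Q : ℕ → Polynomial ℝ}

/-- Subtracting the right multiple of `Q n` lowers the degree. -/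
theorem IsSobOPS.degree_sub_lt (hQ : IsSobOPS μ c r M Q) {P : Polynomial ℝ} {n : ℕ}
    (hP : P.degree < (n + 1 : ℕ)) :
    (P - (P.coeff n / (Q n).leadingCoeff) • Q n).degree < n := by
  have hnat : (Q n).natDegree = n := natDegree_eq_of_degree_eq_some (hQ.1 n)
  have hlc : (Q n).coeff n = (Q n).leadingCoeff := by rw [leadingCoeff, hnat]
  have h0 := (hQ.2.1 n).ne'
  rw [degree_lt_iff_coeff_zero] at hP ⊢
  intro m hm
  rcases hm.eq_or_lt with rfl | hlt
  · simp [hlc, h0]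
  · simp [hP m hlt, coeff_eq_zero_of_natDegree_lt (hnat.trans_lt hlt)]

theorem IsSobOPS.sobInner_eq_zero (hint : ∀ p : Polynomial ℝ, Integrable (fun x => p.eval x) μ)
    (hQ : IsSobOPS μ c r M Q) {n d : ℕ} (hd : d ≤ n) {P : Polynomial ℝ} (hP : P.degree < d) :
    sobInner μ c r M P (Q n) = 0 := by
  induction d generalizing P with
  | zero =>
    have : P = 0 := by simpa using hP
    simp [this, sobInner]
  | succ d ih =>
    have h := ih (by omega) (hQ.degree_sub_lt hP)
    rw [← sub_add_cancel P ((P.coeff d / (Q d).leadingCoeff) • Q d), sobInner_add_left hint, h,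
      sobInner_smul_left, hQ.2.2, if_neg (by omega)]
    simp

/-- The extremal property of the leading coefficients. -/
theorem IsSobOPS.sq_coeff_div_le (hint : ∀ p : Polynomial ℝ, Integrable (fun x => p.eval x) μ)
    (hM : ∀ i ≤ r, 0 ≤ M i) (hQ : IsSobOPS μ c r M Q) {P : Polynomial ℝ} {n : ℕ}
    (hP : P.degree < (n + 1 : ℕ)) :
    (P.coeff n / (Q n).leadingCoeff) ^ 2 ≤ sobInner μ c r M P P := by
  set a := P.coeff n / (Q n).leadingCoeff
  have hR := hQ.sobInner_eq_zero hint le_rfl (hQ.degree_sub_lt hP)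
  set R := P - a • Q n
  have hPR : P = R + a • Q n := (sub_add_cancel _ _).symm
  have hnn := sobInner_self_nonneg (μ := μ) (c := c) hM R
  rw [hPR]
  simp only [sobInner_add_left hint, sobInner_add_right hint, sobInner_smul_left,
    sobInner_smul_right, hQ.2.2, hR, sobInner_comm (Q n) R]
  simp
  nlinarith

/-- Adding the masses does not increase the leading coefficients. -/
theorem IsSobOPS.leadingCoeff_le (hint : ∀ p : Polynomial ℝ, Integrable (fun x => p.eval x) μ)
    (hM : ∀ i ≤ r, 0 ≤ M i) (hQ : IsSobOPS μ c r M Q) {P : ℕ → Polynomial ℝ} (hP : IsOPS μ P)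
    (n : ℕ) : (Q n).leadingCoeff ≤ (P n).leadingCoeff := by
  have hdeg : (Q n).degree < (n + 1 : ℕ) := by
    rw [hQ.1 n]; exact_mod_cast Nat.lt_succ_self n
  have h := (hP.isSobOPS_zero_mass (c := c) (r := r)).sq_coeff_div_le hint (by simp) hdeg
  rw [sobInner_zero_mass] at h
  have h1 := h.trans (integral_sq_le_sobInner_self (c := c) hM (Q n))
  have hlc : (Q n).coeff n = (Q n).leadingCoeff := by
    rw [leadingCoeff, natDegree_eq_of_degree_eq_some (hQ.1 n)]
  rw [hQ.2.2, if_pos rfl, hlc] at h1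
  rw [← div_le_one (hP.2.1 n)]
  exact (abs_le_of_sq_le_sq' (by simpa using h1) zero_le_one).2

/-- A polynomial of small `μ`-norm interpolating `P n` and its derivatives at `c` bounds the
ratio of the leading coefficients. -/
theorem IsSobOPS.sq_leadingCoeff_div_le
    (hint : ∀ p : Polynomial ℝ, Integrable (fun x => p.eval x) μ)
    (hM : ∀ i ≤ r, 0 ≤ M i) (hQ : IsSobOPS μ c r M Q) {P : ℕ → Polynomial ℝ} (hP : IsOPS μ P)
    {n : ℕ} {R : Polynomial ℝ} (hR : R.degree < n)
    (hRc : ∀ i ≤ r, (derivative^[i] R).eval c = (derivative^[i] (P n)).eval c) :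
    ((P n).leadingCoeff / (Q n).leadingCoeff) ^ 2 ≤ 1 + ∫ x, R.eval x * R.eval x ∂μ := by
  have hP0 := hP.isSobOPS_zero_mass (c := c) (r := r)
  have hlt : (n : WithBot ℕ) < (n + 1 : ℕ) := by exact_mod_cast Nat.lt_succ_self n
  have hdeg : (P n + (-1 : ℝ) • R).degree < (n + 1 : ℕ) := by
    refine (degree_add_le _ _).trans_lt (max_lt ((hP.1 n).trans_lt hlt) ?_)
    exact (degree_smul_le _ _).trans_lt (hR.trans hlt)
  have hcoeff : (P n + (-1 : ℝ) • R).coeff n = (P n).leadingCoeff := by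
    rw [leadingCoeff, natDegree_eq_of_degree_eq_some (hP.1 n)]
    simp [coeff_eq_zero_of_degree_lt hR]
  have h := hQ.sq_coeff_div_le hint hM hdeg
  have hsob : sobInner μ c r M (P n + (-1 : ℝ) • R) (P n + (-1 : ℝ) • R) =
      sobInner μ c r (fun _ => 0) (P n + (-1 : ℝ) • R) (P n + (-1 : ℝ) • R) := by
    simp only [sobInner]
    congr 1
    refine Finset.sum_congr rfl fun i hi => ?_
    have hz : (derivative^[i] (P n + (-1 : ℝ) • R)).eval c = 0 := by
      rw [iterate_map_add, iterate_derivative_smul, eval_add, eval_smul,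
        hRc i (Nat.lt_succ_iff.1 (Finset.mem_range.1 hi))]
      simp
    rw [hz]
    simp only [mul_zero]
  rw [hcoeff, hsob] at h
  simp only [sobInner_add_left hint, sobInner_add_right hint, sobInner_smul_left,
    sobInner_smul_right, hP0.2.2, sobInner_comm (P n) R,
    hP0.sobInner_eq_zero hint le_rfl hR] at h
  rw [sobInner_zero_mass] at h
  simpa using h

end SobolevInner

/-- Averages of blocks of `N` combinations of `m` distinct orthonormal polynomials. -/
theorem IsOPS.integral_sq_sum_le {μ : Measure ℝ}
    (hint : ∀ p : Polynomial ℝ, Integrable (fun x => p.eval x) μ)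
    {P : ℕ → Polynomial ℝ} (hP : IsOPS μ P) (N m : ℕ) (k : Fin N → ℕ) (a : ℕ → Fin N → ℝ) :
    ∫ x, (∑ j, ∑ s ∈ Finset.range m, a s j • P (k j + s)).eval x *
      (∑ j, ∑ s ∈ Finset.range m, a s j • P (k j + s)).eval x ∂μ ≤
      N * ∑ s ∈ Finset.range m, ∑ j, a s j ^ 2 := by
  set R : Fin N → Polynomial ℝ := fun j => ∑ s ∈ Finset.range m, a s j • P (k j + s) with hR
  have hnorm : ∀ j, ∫ x, (R j).eval x * (R j).eval x ∂μ = ∑ s ∈ Finset.range m, a s j ^ 2 := by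
    intro j
    simp only [hR, eval_finsetSum, eval_smul, smul_eq_mul, Finset.sum_mul_sum]
    have hi : ∀ s t, Integrable (fun x => a s j * (P (k j + s)).eval x *
        (a t j * (P (k j + t)).eval x)) μ := fun s t => by
      simpa using integrable_eval_mul_eval hint (a s j • P (k j + s)) (a t j • P (k j + t))
    rw [integral_finsetSum _ fun s _ => integrable_finsetSum _ fun t _ => hi s t]
    refine Finset.sum_congr rfl fun s hs => ?_
    rw [integral_finsetSum _ fun t _ => hi s t]
    simp only [mul_mul_mul_comm (a s j), integral_const_mul, hP.2.2, add_right_inj]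
    simp [Finset.mem_range.1 hs, sq]
  calc ∫ x, (∑ j, R j).eval x * (∑ j, R j).eval x ∂μ
      ≤ ∫ x, N * ∑ j, (R j).eval x * (R j).eval x ∂μ := by
        refine integral_mono (integrable_eval_mul_eval hint _ _)
          ((integrable_finsetSum _ fun j _ => integrable_eval_mul_eval hint _ _).const_mul _)
          fun x => ?_
        have := sq_sum_le_card_mul_sum_sq (s := Finset.univ) (f := fun j => (R j).eval x)
        simpa [eval_finsetSum, sq] using this
    _ = N * ∑ s ∈ Finset.range m, ∑ j, a s j ^ 2 := by
        rw [integral_const_mul, integral_finsetSum _ fun j _ => integrable_eval_mul_eval hint _ _,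
          Finset.sum_comm]
        simp only [hnorm]

theorem tendsto_nat_div_add_div {d : ℕ} (hd : 0 < d) (s : ℕ) :
    Tendsto (fun n : ℕ => ((n / d + s : ℕ) : ℝ) / n) atTop (𝓝 (d : ℝ)⁻¹) := by
  have h1 := (tendsto_nat_floor_mul_div_atTop (R := ℝ) (a := (d : ℝ)⁻¹) (by positivity)).comp
    tendsto_natCast_atTop_atTop
  have h2 := (tendsto_const_div_atTop_nhds_zero_nat (s : ℝ))
  have h3 := h1.add h2
  rw [add_zero] at h3
  refine h3.congr fun n => ?_
  have : ⌊(d : ℝ)⁻¹ * n⌋₊ = n / d := by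
    rw [inv_mul_eq_div, Nat.floor_div_eq_div]
  simp only [Function.comp_apply, this]
  push_cast
  ring

/-- Comparison of a sequence of power growth at `n / d + s` with the power at `n`. -/
theorem tendsto_div_rpow_of_power_growth {u : ℕ → ℝ} {α L : ℝ}
    (hu : Tendsto (fun n : ℕ => u n / ((-1 : ℝ) ^ n * (n : ℝ) ^ α)) atTop (𝓝 L))
    {d : ℕ} (hd : 0 < d) (s : ℕ) :
    Tendsto (fun n : ℕ => (-1 : ℝ) ^ (n / d + s) * u (n / d + s) / (n : ℝ) ^ α) atTop
      (𝓝 (L * ((d : ℝ)⁻¹) ^ α)) := by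
  have hk : Tendsto (fun n : ℕ => n / d + s) atTop atTop :=
    tendsto_atTop_mono (fun n => Nat.le_add_right _ s) (Nat.tendsto_div_const_atTop hd.ne')
  have hr := (tendsto_nat_div_add_div hd s).rpow_const (p := α)
    (Or.inl (by positivity))
  refine ((hu.comp hk).mul hr).congr' ?_
  filter_upwards [hk.eventually_gt_atTop 0, eventually_gt_atTop 0] with n hn hn0
  simp only [Function.comp_apply]
  have hk0 : (0 : ℝ) < ((n / d + s : ℕ) : ℝ) := by exact_mod_cast hn
  have hn0' : (0 : ℝ) < (n : ℝ) := by exact_mod_cast hn0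
  generalize n / d + s = k at hk0 ⊢
  rw [Real.div_rpow hk0.le hn0'.le]
  have h1 := (Real.rpow_pos_of_pos hk0 α).ne'
  have h2 := (Real.rpow_pos_of_pos hn0' α).ne'
  have h3 : ((-1 : ℝ) ^ k) * (-1) ^ k = 1 := by rw [← mul_pow]; simp
  have h4 : ((-1 : ℝ) ^ k) ≠ 0 := by simp
  field_simp
  linear_combination (-u k) * h3

theorem det_generalized_vandermonde_ne_zero {f C : ℕ → ℝ} (hf : StrictMono f)
    (hC : ∀ k, C k ≠ 0) (N : ℕ) :
    (Matrix.of fun i j : Fin N =>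
      C i * (((2 ^ ((j : ℕ) + 1) : ℕ) : ℝ)⁻¹) ^ f i).det ≠ 0 := by
  set y : Fin N → ℝ := fun i => (2⁻¹ : ℝ) ^ f i with hy
  have hinj : Function.Injective y := by
    intro i j h
    have := (Real.rpow_right_inj (by norm_num : (0 : ℝ) < 2⁻¹) (by norm_num)).1 h
    exact Fin.ext (hf.injective this)
  have hmat : (Matrix.of fun i j : Fin N => C i * (((2 ^ ((j : ℕ) + 1) : ℕ) : ℝ)⁻¹) ^ f i) =
      Matrix.diagonal (fun i : Fin N => C i * y i) * Matrix.vandermonde y := by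
    ext i j
    simp only [Matrix.of_apply, Matrix.diagonal_mul, Matrix.vandermonde_apply, hy]
    rw [mul_assoc, ← pow_succ', ← Real.rpow_natCast, ← Real.rpow_mul (by norm_num), mul_comm (f i),
      Real.rpow_mul (by norm_num), Real.rpow_natCast]
    push_cast
    rw [inv_pow]
  rw [hmat, Matrix.det_mul, Matrix.det_diagonal]
  refine mul_ne_zero (Finset.prod_ne_zero_iff.2 fun i _ => mul_ne_zero (hC i) ?_)
    (Matrix.det_vandermonde_ne_zero_iff.2 hinj)
  exact (Real.rpow_pos_of_pos (by norm_num) _).ne'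

theorem tendsto_mulVec {N : ℕ} {A : ℕ → Matrix (Fin N) (Fin N) ℝ}
    {A₀ : Matrix (Fin N) (Fin N) ℝ} {u : ℕ → Fin N → ℝ} {u₀ : Fin N → ℝ}
    (hA : Tendsto A atTop (𝓝 A₀)) (hu : Tendsto u atTop (𝓝 u₀)) :
    Tendsto (fun n => (A n).mulVec (u n)) atTop (𝓝 (A₀.mulVec u₀)) := by
  have hcont : Continuous fun z : Matrix (Fin N) (Fin N) ℝ × (Fin N → ℝ) => z.1.mulVec z.2 :=
    continuous_fst.matrix_mulVec continuous_snd
  exact (hcont.tendsto (A₀, u₀)).comp (hA.prodMk_nhds hu)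

/-- Solutions of linear systems depend continuously on the data. -/
theorem exists_bounded_solutions {N : ℕ} {A : ℕ → Matrix (Fin N) (Fin N) ℝ}
    {A₀ : Matrix (Fin N) (Fin N) ℝ} {u : ℕ → Fin N → ℝ} {u₀ : Fin N → ℝ}
    (hA : Tendsto A atTop (𝓝 A₀)) (hu : Tendsto u atTop (𝓝 u₀)) (hdet : A₀.det ≠ 0) :
    ∀ᶠ n in atTop, (A n).mulVec ((A n)⁻¹.mulVec (u n)) = u n ∧
      ∑ j, ((A n)⁻¹.mulVec (u n)) j ^ 2 < 1 + ∑ j, (A₀⁻¹.mulVec u₀) j ^ 2 := by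
  have hd : Tendsto (fun n => (A n).det) atTop (𝓝 A₀.det) :=
    ((continuous_id.matrix_det).tendsto A₀).comp hA
  have hinv : Tendsto (fun n => (A n)⁻¹) atTop (𝓝 A₀⁻¹) := by
    have hc : ContinuousAt Ring.inverse A₀.det := by
      rw [Ring.inverse_eq_inv']
      exact continuousAt_inv₀ hdet
    exact (continuousAt_matrix_inv A₀ hc).tendsto.comp hA
  have hb : Tendsto (fun n => (A n)⁻¹.mulVec (u n)) atTop (𝓝 (A₀⁻¹.mulVec u₀)) :=
    tendsto_mulVec hinv hu
  have hs : Tendsto (fun n => ∑ j, ((A n)⁻¹.mulVec (u n)) j ^ 2) atTop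
      (𝓝 (∑ j, (A₀⁻¹.mulVec u₀) j ^ 2)) :=
    tendsto_finsetSum _ fun j _ => ((tendsto_pi_nhds.1 hb) j).pow 2
  filter_upwards [hd.eventually_ne hdet, hs.eventually_lt_const (lt_one_add _)] with n h1 h2
  refine ⟨?_, h2⟩
  rw [Matrix.mulVec_mulVec, Matrix.mul_nonsing_inv _ (isUnit_iff_ne_zero.2 h1), Matrix.one_mulVec]

/-- The derivatives of `p n` at `c` are matched by polynomials of lower degree and small norm. -/
theorem exists_interpolant_small_norm {μ : Measure ℝ}
    (hint : ∀ p : Polynomial ℝ, Integrable (fun x => p.eval x) μ) {c : ℝ} (r : ℕ)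
    {p : ℕ → Polynomial ℝ} (hp : IsOPS μ p) {f : ℕ → ℝ} (hf : StrictMono f)
    {C : ℕ → ℝ} (hC : ∀ k, C k ≠ 0)
    (hlim : ∀ k, Tendsto
      (fun n : ℕ => (derivative^[k] (p n)).eval c / ((-1 : ℝ) ^ n * (n : ℝ) ^ (f k)))
      atTop (𝓝 (C k))) {ε : ℝ} (hε : 0 < ε) :
    ∀ᶠ n : ℕ in atTop, ∃ R : Polynomial ℝ, R.degree < n ∧
      (∀ i ≤ r, (derivative^[i] R).eval c = (derivative^[i] (p n)).eval c) ∧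
      ∫ x, R.eval x * R.eval x ∂μ ≤ ε := by
  set N := r + 1
  set A₀ : Matrix (Fin N) (Fin N) ℝ :=
    Matrix.of fun i j => C i * (((2 ^ ((j : ℕ) + 1) : ℕ) : ℝ)⁻¹) ^ f i
  set k : ℕ → Fin N → ℕ := fun n j => n / 2 ^ ((j : ℕ) + 1)
  set A : ℕ → ℕ → Matrix (Fin N) (Fin N) ℝ := fun s n => Matrix.of fun i j =>
    (-1 : ℝ) ^ (k n j + s) * (derivative^[i] (p (k n j + s))).eval c / (n : ℝ) ^ f i
  set u : ℕ → Fin N → ℝ := fun n i => (-1 : ℝ) ^ n * (derivative^[i] (p n)).eval c / (n : ℝ) ^ f i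
  set u₀ : Fin N → ℝ := fun i => C i
  have hA : ∀ s, Tendsto (A s) atTop (𝓝 A₀) := fun s =>
    tendsto_pi_nhds.2 fun i => tendsto_pi_nhds.2 fun j =>
      tendsto_div_rpow_of_power_growth (hlim i) (by positivity) s
  have hu : Tendsto u atTop (𝓝 u₀) := tendsto_pi_nhds.2 fun i => by
    simpa using tendsto_div_rpow_of_power_growth (hlim i) one_pos 0
  set S := 1 + ∑ j, (A₀⁻¹.mulVec u₀) j ^ 2
  have hS : 0 < S := by positivity
  obtain ⟨m, hm⟩ := exists_nat_gt (N * S / ε)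
  have hm0 : (0 : ℝ) < m := lt_of_le_of_lt (by positivity) hm
  have hev : ∀ᶠ n in atTop, ∀ s ∈ Finset.range m,
      (A s n).mulVec ((A s n)⁻¹.mulVec (u n)) = u n ∧ ∑ j, ((A s n)⁻¹.mulVec (u n)) j ^ 2 < S :=
    (Filter.eventually_all_finset _).2 fun s _ =>
      exists_bounded_solutions (hA s) hu (det_generalized_vandermonde_ne_zero hf hC N)
  filter_upwards [hev, eventually_ge_atTop (2 * m), eventually_gt_atTop 0] with n hn hnm hn0
  set b : ℕ → Fin N → ℝ := fun s => (A s n)⁻¹.mulVec (u n)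
  set a : ℕ → Fin N → ℝ := fun s j => (m : ℝ)⁻¹ * ((-1) ^ n * (-1) ^ (k n j + s)) * b s j with ha
  have hsq : ∀ s j, a s j ^ 2 = ((m : ℝ)⁻¹) ^ 2 * b s j ^ 2 := fun s j => by
    have h1 : ∀ l : ℕ, ((-1 : ℝ) ^ l) ^ 2 = 1 := fun l => by rw [← pow_mul', pow_mul]; simp
    simp only [ha, mul_pow, h1, mul_one]
  refine ⟨∑ j, ∑ s ∈ Finset.range m, a s j • p (k n j + s), ?_, ?_, ?_⟩
  · refine (degree_lt_iff_coeff_zero _ _).2 fun l hl => ?_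
    simp only [finsetSum_coeff, coeff_smul]
    refine Finset.sum_eq_zero fun j _ => Finset.sum_eq_zero fun s hs => ?_
    have hkn : k n j ≤ n / 2 := by
      refine Nat.div_le_div_left ?_ two_pos
      rw [pow_succ]
      exact Nat.le_mul_of_pos_left 2 (by positivity)
    have hs' := Finset.mem_range.1 hs
    rw [coeff_eq_zero_of_degree_lt, smul_zero]
    rw [hp.1]
    exact_mod_cast (by omega : k n j + s < l)
  · intro i hi
    simp only [iterate_derivative_sum, iterate_derivative_smul, eval_finsetSum, eval_smul,
      smul_eq_mul]
    rw [Finset.sum_comm]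
    have hn0' : (n : ℝ) ^ f i ≠ 0 := (Real.rpow_pos_of_pos (by exact_mod_cast hn0) _).ne'
    have hrow : ∀ s ∈ Finset.range m,
        ∑ j, a s j * (derivative^[i] (p (k n j + s))).eval c =
          (m : ℝ)⁻¹ * (derivative^[i] (p n)).eval c := by
      intro s hs
      have h := congrFun (hn s hs).1 ⟨i, Nat.lt_succ_of_le hi⟩
      simp only [Matrix.mulVec, dotProduct] at h
      have h2 : ((-1 : ℝ) ^ n) * (-1) ^ n = 1 := by rw [← mul_pow]; simp
      calc ∑ j, a s j * (derivative^[i] (p (k n j + s))).eval c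
          = (m : ℝ)⁻¹ * (-1) ^ n * (n : ℝ) ^ f i *
              ∑ j, A s n ⟨i, Nat.lt_succ_of_le hi⟩ j * b s j := by
            rw [Finset.mul_sum]
            refine Finset.sum_congr rfl fun j _ => ?_
            simp only [ha, A, Matrix.of_apply]
            field_simp
        _ = (m : ℝ)⁻¹ * (-1) ^ n * (n : ℝ) ^ f i * u n ⟨i, Nat.lt_succ_of_le hi⟩ := by
            rw [← h]; rfl
        _ = (m : ℝ)⁻¹ * (((-1 : ℝ) ^ n) * (-1) ^ n) * (derivative^[i] (p n)).eval c := by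
            simp only [u]
            field_simp
        _ = _ := by rw [h2, mul_one]
    rw [Finset.sum_congr rfl hrow, Finset.sum_const, Finset.card_range, nsmul_eq_mul]
    field_simp
  · refine (hp.integral_sq_sum_le hint N m (k n) a).trans ?_
    simp only [hsq, ← Finset.mul_sum]
    have hsum : ∑ s ∈ Finset.range m, ∑ j, b s j ^ 2 ≤ m * S := by
      refine (Finset.sum_le_sum fun s hs => (hn s hs).2.le).trans ?_
      simp
    calc (N : ℝ) * (((m : ℝ)⁻¹) ^ 2 * ∑ s ∈ Finset.range m, ∑ j, b s j ^ 2)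
        ≤ N * (((m : ℝ)⁻¹) ^ 2 * (m * S)) := by gcongr
      _ = N * S / m := by field_simp
      _ ≤ ε := by
        rw [div_lt_iff₀ hε] at hm
        rw [div_le_iff₀ hm0]
        linarith

/-- **Asymptotics of leading coefficients.** Under the power-type asymptotics for the
derivatives `p_n^{(k)}(c)`, the leading coefficients of the Sobolev orthonormal
polynomials and of the standard orthonormal polynomials satisfy `γ̃_n/γ_n → 1`. -/
theorem leading_coefficients_ratio
    (μ : Measure ℝ) [IsFiniteMeasure μ]
    (hsupp : (measSupport μ).Infinite)
    (hint : ∀ p : Polynomial ℝ, Integrable (fun x => p.eval x) μ)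
    (c : ℝ) (r : ℕ) (M : ℕ → ℝ) (hM : ∀ i ≤ r, 0 ≤ M i)
    (p : ℕ → Polynomial ℝ) (hp : IsOPS μ p)
    (q : ℕ → Polynomial ℝ) (hq : IsSobOPS μ c r M q)
    (f : ℕ → ℝ) (hf : StrictMono f) (hf0 : 0 < 2 * f 0 + 1)
    (C : ℕ → ℝ) (hC : ∀ k, C k ≠ 0)
    (hlim : ∀ k, Filter.Tendsto
      (fun n : ℕ => (Polynomial.derivative^[k] (p n)).eval c / ((-1 : ℝ) ^ n * (n : ℝ) ^ (f k)))
      Filter.atTop (nhds (C k))) :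
    Filter.Tendsto (fun n : ℕ => (q n).leadingCoeff / (p n).leadingCoeff)
      Filter.atTop (nhds 1) := by
  have hinv : Tendsto (fun n : ℕ => ((p n).leadingCoeff / (q n).leadingCoeff) ^ 2)
      atTop (𝓝 1) := by
    refine tendsto_order.2 ⟨fun a ha => Eventually.of_forall fun n => ha.trans_le ?_,
      fun a ha => ?_⟩
    · exact one_le_pow₀ ((one_le_div (hq.2.1 n)).2 (hq.leadingCoeff_le hint hM hp n))
    · filter_upwards [exists_interpolant_small_norm hint r hp hf hC hlim
        (half_pos (sub_pos.2 ha))] with n ⟨R, hR, hRc, hRε⟩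
      have := hq.sq_leadingCoeff_div_le hint hM hp hR hRc
      linarith
  have h := (hinv.sqrt).inv₀ (by simp)
  rw [Real.sqrt_one, inv_one] at h
  refine h.congr fun n => ?_
  rw [Real.sqrt_sq (div_nonneg (hp.2.1 n).le (hq.2.1 n).le), inv_div]
end
end

section
/- Assume all masses M_0, …, M_r are strictly positive, and assume there are sequences a_n, b_n > 0 with a_n^{−1/2}/(A n^a) → 1 and b_n/(B n^b) → 1 for constants A, B, b > 0 and a ∈ ℝ, and ν > −1 with 2a+1 = b(ν+1), such that for every j = 0,…,r+1, uniformly on compact subsets of ℂ, (−1)^n (a_n^{1/2}/b_n^j) p_n^{[2j]}(c + z²/b_n) → φ_{ν+2j}(z). Then for all sufficiently large n the connection formula q_n(x) = Σ_{j=0}^{r+1} λ_{j,n} (x−c)^j p_{n−j}^{[2j]}(x) holds with uniquely determined coefficients, and lim_{n→∞} λ_{j,n} = 0 for j = 0,…,r while lim_{n→∞} λ_{r+1,n} = 1. -/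
open MeasureTheory Polynomial Filter Topology

noncomputable section

/-- The modified measure `dμ_j(x) = (x-c)^j dμ(x)`. -/
def muMod (μ : Measure ℝ) (c : ℝ) (j : ℕ) : Measure ℝ :=
  μ.withDensity fun x => ENNReal.ofReal ((x - c) ^ j)

/-- `P` is a sequence of orthonormal polynomials for the bilinear form `B`. -/
structure IsOrthoSeq (B : LinearMap.BilinForm ℝ ℝ[X]) (P : ℕ → ℝ[X]) : Prop where
  degree : ∀ n, (P n).degree = n
  coeff_pos : ∀ n, 0 < (P n).coeff n
  orth : ∀ n m, B (P n) (P m) = if n = m then 1 else 0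

lemma degree_sub_smul_lt {p s : ℝ[X]} {m : ℕ} (hs : s.degree = m) (hs0 : s.coeff m ≠ 0)
    (hp : p.degree < (m + 1 : ℕ)) : (p - (p.coeff m / s.coeff m) • s).degree < m := by
  rw [degree_lt_iff_coeff_zero] at hp ⊢
  intro k hk
  rcases hk.eq_or_lt with rfl | hlt
  · simp [hs0]
  · have : s.coeff k = 0 := coeff_eq_zero_of_degree_lt (by rw [hs]; exact_mod_cast hlt)
    simp [hp k hlt, this]

namespace IsOrthoSeq

variable {B : LinearMap.BilinForm ℝ ℝ[X]} {P : ℕ → ℝ[X]}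

lemma apply_eq_zero (h : IsOrthoSeq B P) {n : ℕ} {p : ℝ[X]} (hp : p.degree < n) :
    B (P n) p = 0 := by
  suffices H : ∀ m ≤ n, ∀ p : ℝ[X], p.degree < m → B (P n) p = 0 from H n le_rfl p hp
  intro m
  induction m with
  | zero =>
    intro _ p hp
    have : p = 0 := by
      rw [← degree_eq_bot]
      exact Nat.WithBot.lt_zero_iff.mp (by exact_mod_cast hp)
    simp [this]
  | succ m ih =>
    intro hm p hp
    have h1 := ih (by omega) _ (degree_sub_smul_lt (h.degree m) (h.coeff_pos m).ne' hp)
    rw [map_sub, map_smul, h.orth, if_neg (by omega)] at h1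
    simpa using h1

lemma apply_eq_coeff_div (h : IsOrthoSeq B P) {n : ℕ} {p : ℝ[X]} (hp : p.degree < (n + 1 : ℕ)) :
    B (P n) p = p.coeff n / (P n).coeff n := by
  have h1 := h.apply_eq_zero (degree_sub_smul_lt (h.degree n) (h.coeff_pos n).ne' hp)
  rw [map_sub, map_smul, h.orth, if_pos rfl] at h1
  simpa [sub_eq_zero] using h1

lemma degree_lt_succ (h : IsOrthoSeq B P) (n : ℕ) : (P n).degree < (n + 1 : ℕ) := by
  rw [h.degree]; exact_mod_cast Nat.lt_succ_self n

lemma coeff_sq_le (h : IsOrthoSeq B P) (hsymm : ∀ p q, B p q = B q p) (hpos : ∀ p, 0 ≤ B p p)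
    {n : ℕ} {p : ℝ[X]} (hp : p.degree < (n + 1 : ℕ)) :
    p.coeff n ^ 2 ≤ (P n).coeff n ^ 2 * B p p := by
  set t := p.coeff n / (P n).coeff n with ht
  have h1 := hpos (p - t • P n)
  have h2 : B (P n) p = t := h.apply_eq_coeff_div hp
  have h3 : B (P n) (P n) = 1 := by simp [h.orth]
  simp only [map_sub, map_smul, LinearMap.sub_apply, LinearMap.smul_apply, hsymm p (P n), h2, h3,
    smul_eq_mul] at h1
  have h4 : p.coeff n = (P n).coeff n * t := by
    rw [ht]; field_simp [(h.coeff_pos n).ne']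
  rw [h4, mul_pow]
  exact mul_le_mul_of_nonneg_left (by nlinarith) (sq_nonneg _)

lemma eq_zero_of_apply_eq_zero (h : IsOrthoSeq B P) {n : ℕ} {p : ℝ[X]} (hp : p.degree < n)
    (h0 : ∀ k < n, B (P k) p = 0) : p = 0 := by
  by_contra hne
  have hd : p.natDegree < n := (natDegree_lt_iff_degree_lt hne).mpr hp
  have h1 := h0 _ hd
  rw [h.apply_eq_coeff_div (by
    rw [degree_eq_natDegree hne]; exact_mod_cast Nat.lt_succ_self _)] at h1
  rcases div_eq_zero_iff.mp h1 with h2 | h2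
  · exact hne (leadingCoeff_eq_zero.mp h2)
  · exact (h.coeff_pos _).ne' h2

lemma eq_smul_of_orthogonal (h : IsOrthoSeq B P) {n : ℕ} {p : ℝ[X]}
    (hp : p.degree < (n + 1 : ℕ)) (h0 : ∀ k < n, B (P k) p = 0) :
    p = (p.coeff n / (P n).coeff n) • P n := by
  rw [← sub_eq_zero]
  refine h.eq_zero_of_apply_eq_zero (degree_sub_smul_lt (h.degree n) (h.coeff_pos n).ne' hp) ?_
  intro k hk
  rw [map_sub, map_smul, h0 k hk, h.orth, if_neg (by omega)]
  simp

end IsOrthoSeq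

section Christoffel

variable {B B' : LinearMap.BilinForm ℝ ℝ[X]} {P P' : ℕ → ℝ[X]} {c : ℝ}

lemma degree_X_sub_C_pow_mul_lt {p : ℝ[X]} {m n j : ℕ} (hp : p.degree = m) (h : m + j < n) :
    ((X - C c) ^ j * p).degree < (n : WithBot ℕ) := by
  rw [degree_mul, degree_pow, degree_X_sub_C, hp]
  simp only [nsmul_eq_mul, mul_one]
  rw [add_comm]
  exact_mod_cast h

lemma coeff_X_sub_C_pow_mul {p : ℝ[X]} {m : ℕ} (hp : p.degree = m) (j : ℕ) :
    ((X - C c) ^ j * p).coeff (m + j) = p.coeff m := by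
  have hd : ((X - C c) ^ j).natDegree = j := by simp
  rw [add_comm, coeff_mul_add_eq_of_natDegree_le hd.le (natDegree_eq_of_degree_eq_some hp).le]
  have : ((X - C c) ^ j).coeff j = 1 := by
    have := (monic_X_sub_C c).pow j
    rwa [Monic, leadingCoeff, hd] at this
  rw [this, one_mul]

/-- The Christoffel transform by `(x - c)²` does not increase leading coefficients. -/
lemma christoffel_coeff_le (h : IsOrthoSeq B P) (h' : IsOrthoSeq B' P')
    (hsymm : ∀ p q, B p q = B q p) (hpos : ∀ p, 0 ≤ B p p)
    (hBB : ∀ p q, B' p q = B ((X - C c) * p) ((X - C c) * q)) (m : ℕ) :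
    (P' m).coeff m ^ 2 ≤ (P (m + 1)).coeff (m + 1) ^ 2 := by
  have h1 := h.coeff_sq_le hsymm hpos (p := (X - C c) ^ 1 * P' m) (n := m + 1)
    (degree_X_sub_C_pow_mul_lt (h'.degree m) (by omega))
  rw [coeff_X_sub_C_pow_mul (h'.degree m), pow_one, ← hBB, h'.orth] at h1
  simpa using h1

/-- The Christoffel transform by `(x - c)²` decreases leading coefficients by a factor controlled
by the Christoffel-Darboux kernel at `c`. -/
lemma coeff_le_christoffel (h : IsOrthoSeq B P) (h' : IsOrthoSeq B' P')
    (hsymm' : ∀ p q, B' p q = B' q p) (hpos' : ∀ p, 0 ≤ B' p p)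
    (hBB : ∀ p q, B' p q = B ((X - C c) * p) ((X - C c) * q)) (m : ℕ)
    (hK : 0 < ∑ k ∈ Finset.range (m + 1), (P k).eval c ^ 2) :
    (P (m + 1)).coeff (m + 1) ^ 2 ≤ (P' m).coeff m ^ 2 *
      (1 + (P (m + 1)).eval c ^ 2 / ∑ k ∈ Finset.range (m + 1), (P k).eval c ^ 2) := by
  set K := ∑ k ∈ Finset.range (m + 1), (P k).eval c ^ 2 with hKdef
  set s : ℝ[X] := ∑ k ∈ Finset.range (m + 1), ((P (m + 1)).eval c * (P k).eval c / K) • P k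
    with hs
  have hsdeg : s.degree < (m + 1 : ℕ) := by
    rw [degree_lt_iff_coeff_zero]
    intro k hk
    rw [hs, finsetSum_coeff]
    refine Finset.sum_eq_zero fun i hi => ?_
    rw [coeff_smul, coeff_eq_zero_of_degree_lt, smul_zero]
    rw [h.degree]
    rw [Finset.mem_range] at hi
    exact_mod_cast (by omega : i < k)
  have hsc : s.eval c = (P (m + 1)).eval c := by
    rw [hs, eval_finsetSum]
    simp only [eval_smul, smul_eq_mul]
    rw [Finset.sum_congr rfl (g := fun k => (P (m + 1)).eval c / K * (P k).eval c ^ 2)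
      (fun k _ => by ring), ← Finset.mul_sum, ← hKdef]
    field_simp
  have hroot : (X - C c) ∣ P (m + 1) - s := by
    rw [dvd_iff_isRoot, IsRoot, eval_sub, hsc, sub_self]
  obtain ⟨R, hR⟩ := hroot
  have hBs : ∀ i < m + 1, B (P i) s = (P (m + 1)).eval c * (P i).eval c / K := by
    intro i hi
    rw [hs, map_sum, Finset.sum_eq_single i]
    · simp [h.orth]
    · intro k _ hk
      simp [h.orth, hk.symm]
    · intro hi'
      exact absurd (Finset.mem_range.mpr hi) hi'
  have hBl : ∀ t, B s t = ∑ k ∈ Finset.range (m + 1),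
      (P (m + 1)).eval c * (P k).eval c / K * B (P k) t := by
    intro t
    rw [hs, map_sum, LinearMap.sum_apply]
    simp only [map_smul, LinearMap.smul_apply, smul_eq_mul]
  have hss : B s s = (P (m + 1)).eval c ^ 2 / K := by
    rw [hBl]
    rw [Finset.sum_congr rfl (g := fun k => ((P (m + 1)).eval c / K) ^ 2 * (P k).eval c ^ 2)]
    · rw [← Finset.mul_sum, ← hKdef]
      field_simp
    · intro k hk
      rw [hBs k (Finset.mem_range.mp hk)]
      ring
  have hPs : B (P (m + 1)) s = 0 := h.apply_eq_zero hsdeg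
  have hsP : B s (P (m + 1)) = 0 := by
    rw [hBl]
    refine Finset.sum_eq_zero fun k hk => ?_
    rw [Finset.mem_range] at hk
    rw [h.orth, if_neg (by omega), mul_zero]
  have hRR : B' R R = 1 + (P (m + 1)).eval c ^ 2 / K := by
    rw [hBB, ← hR, map_sub, map_sub, LinearMap.sub_apply, LinearMap.sub_apply, hss, hPs, hsP,
      h.orth]
    simp
  have hRd : R.degree = m := by
    have hd : (P (m + 1) - s).degree = (m + 1 : ℕ) := by
      rw [degree_sub_eq_left_of_degree_lt (by rw [h.degree]; exact hsdeg), h.degree]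
    rw [hR, degree_mul, degree_X_sub_C] at hd
    have hR0 : R ≠ 0 := by
      rintro rfl
      rw [degree_zero, WithBot.add_bot] at hd
      exact WithBot.bot_ne_natCast _ hd
    rw [degree_eq_natDegree hR0] at hd ⊢
    norm_cast at hd ⊢
    omega
  have hRc : R.coeff m = (P (m + 1)).coeff (m + 1) := by
    have := coeff_X_sub_C_pow_mul (c := c) hRd 1
    rw [pow_one, ← hR, coeff_sub, coeff_eq_zero_of_degree_lt hsdeg, sub_zero] at this
    exact this.symm
  rw [← hRc, ← hRR]
  refine h'.coeff_sq_le hsymm' hpos' ?_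
  rw [hRd]
  exact_mod_cast Nat.lt_succ_self m

end Christoffel

section Connection

variable {L : ℝ[X] →ₗ[ℝ] ℝ} {c : ℝ}

/-- The bilinear form `(p, q) ↦ L ((x - c)^(2j) p q)` attached to a linear functional `L`. -/
def weightedForm (L : ℝ[X] →ₗ[ℝ] ℝ) (c : ℝ) (j : ℕ) : LinearMap.BilinForm ℝ ℝ[X] :=
  LinearMap.mk₂ ℝ (fun p q => L ((X - C c) ^ (2 * j) * (p * q)))
    (fun p p' q => by rw [← map_add]; congr 1; ring)
    (fun t p q => by rw [← map_smul]; congr 1; simp only [smul_eq_C_mul]; ring)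
    (fun p q q' => by rw [← map_add]; congr 1; ring)
    (fun t p q => by rw [← map_smul]; congr 1; simp only [smul_eq_C_mul]; ring)

lemma weightedForm_apply (j : ℕ) (p q : ℝ[X]) :
    weightedForm L c j p q = L ((X - C c) ^ (2 * j) * (p * q)) := rfl

lemma weightedForm_symm (j : ℕ) (p q : ℝ[X]) :
    weightedForm L c j p q = weightedForm L c j q p := by
  simp only [weightedForm_apply, mul_comm p q]

lemma weightedForm_nonneg (hL : ∀ p, 0 ≤ L (p * p)) (j : ℕ) (p : ℝ[X]) :
    0 ≤ weightedForm L c j p p := by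
  rw [weightedForm_apply]
  convert hL ((X - C c) ^ j * p) using 2
  ring

lemma weightedForm_succ (j : ℕ) (p q : ℝ[X]) :
    weightedForm L c (j + 1) p q = weightedForm L c j ((X - C c) * p) ((X - C c) * q) := by
  simp only [weightedForm_apply]
  congr 1
  ring

lemma weightedForm_zero_pow_mul {j s : ℕ} (hjs : j ≤ s) (p q : ℝ[X]) :
    weightedForm L c 0 ((X - C c) ^ j * p) ((X - C c) ^ s * q) =
      weightedForm L c j p ((X - C c) ^ (s - j) * q) := by
  obtain ⟨t, rfl⟩ := Nat.exists_eq_add_of_le hjs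
  simp only [weightedForm_apply, Nat.add_sub_cancel_left]
  congr 1
  ring

lemma exists_sum_add_pow_mul (f : ℝ[X]) (p : ℕ → ℝ[X]) (k : ℕ)
    (hp : ∀ j < k, (p j).eval c ≠ 0) :
    ∃ (l : ℕ → ℝ) (g : ℝ[X]),
      f = (∑ j ∈ Finset.range k, C (l j) * (X - C c) ^ j * p j) + (X - C c) ^ k * g := by
  induction k with
  | zero => exact ⟨0, f, by simp⟩
  | succ k ih =>
    obtain ⟨l, g, hg⟩ := ih fun j hj => hp j (by omega)
    have hroot : (X - C c) ∣ g - C (g.eval c / (p k).eval c) * p k := by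
      rw [dvd_iff_isRoot]
      simp [hp k (Nat.lt_succ_self k)]
    obtain ⟨g', hg'⟩ := hroot
    refine ⟨Function.update l k (g.eval c / (p k).eval c), g', ?_⟩
    rw [Finset.sum_range_succ, Function.update_self]
    rw [Finset.sum_congr rfl (g := fun j => C (l j) * (X - C c) ^ j * p j)
      (fun j hj => by rw [Function.update_of_ne (Finset.mem_range.mp hj).ne])]
    rw [pow_succ, mul_assoc _ (X - C c) g', ← hg']
    conv_lhs => rw [hg]
    ring

lemma eq_zero_of_sum_pow_mul_eq_zero (k : ℕ) (p : ℕ → ℝ[X]) (l : ℕ → ℝ)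
    (hp : ∀ j < k, (p j).eval c ≠ 0)
    (h : ∑ j ∈ Finset.range k, C (l j) * (X - C c) ^ j * p j = 0) : ∀ j < k, l j = 0 := by
  induction k generalizing p l with
  | zero => intro j hj; omega
  | succ k ih =>
    rw [Finset.sum_range_succ'] at h
    have h0 : l 0 = 0 := by
      have := congrArg (eval c) h
      simpa [eval_finsetSum, hp 0 (Nat.succ_pos k)] using this
    have h1 : (X - C c) *
        ∑ j ∈ Finset.range k, C (l (j + 1)) * (X - C c) ^ j * p (j + 1) = 0 := by
      rw [← h, h0, Finset.mul_sum]
      simp only [map_zero, zero_mul, add_zero]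
      exact Finset.sum_congr rfl fun j _ => by ring
    have h2 := ih (fun j => p (j + 1)) (fun j => l (j + 1)) (fun j hj => hp _ (by omega))
      ((mul_eq_zero.mp h1).resolve_left (X_sub_C_ne_zero c))
    intro j hj
    cases j with
    | zero => exact h0
    | succ j => exact h2 j (by omega)

/-- A polynomial of degree `n` orthogonal to `(x - c)^s h` for all `h` of degree `< n - s` is a
combination of the polynomials `(x - c)^j p_{n-j}^{[2j]}`, `j ≤ s`. -/
lemma exists_connection {P : ℕ → ℕ → ℝ[X]} {s n : ℕ} (hsn : s ≤ n)
    (hP : ∀ j ≤ s, IsOrthoSeq (weightedForm L c j) (P j))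
    (hne : ∀ j < s, (P j (n - j)).eval c ≠ 0) {f : ℝ[X]} (hf : f.degree = n)
    (horth : ∀ h : ℝ[X], h.degree < (n - s : ℕ) →
      weightedForm L c 0 f ((X - C c) ^ s * h) = 0) :
    ∃ l : ℕ → ℝ, f = ∑ j ∈ Finset.range (s + 1), C (l j) * (X - C c) ^ j * P j (n - j) := by
  obtain ⟨l, g, hg⟩ := exists_sum_add_pow_mul (c := c) f (fun j => P j (n - j)) s hne
  have hpdeg : ((X - C c) ^ s * g).degree ≤ (n : WithBot ℕ) := by
    have : (X - C c) ^ s * g =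
        f - ∑ j ∈ Finset.range s, C (l j) * (X - C c) ^ j * P j (n - j) := by
      rw [eq_sub_iff_add_eq, add_comm]; exact hg.symm
    rw [this]
    refine (degree_sub_le _ _).trans (max_le hf.le ((degree_sum_le _ _).trans ?_))
    refine Finset.sup_le fun j hj => ?_
    rw [Finset.mem_range] at hj
    rw [mul_assoc]
    rw [← smul_eq_C_mul]
    refine (degree_smul_le _ _).trans ?_
    have := degree_X_sub_C_pow_mul_lt (c := c) (n := n + 1) (j := j)
      ((hP j (by omega)).degree (n - j)) (by omega)
    exact Order.lt_succ_iff.mp (by exact_mod_cast this)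
  have hgdeg : g.degree < (n - s + 1 : ℕ) := by
    by_cases hg0 : g = 0
    · rw [hg0, degree_zero]; exact WithBot.bot_lt_coe _
    · rw [degree_mul, degree_pow, degree_X_sub_C, degree_eq_natDegree hg0] at hpdeg
      rw [degree_eq_natDegree hg0]
      simp only [nsmul_eq_mul, mul_one] at hpdeg
      norm_cast at hpdeg ⊢
      omega
  have hgorth : ∀ k < n - s, weightedForm L c s (P s k) g = 0 := by
    intro k hk
    have hd : (P s k).degree < (n - s : ℕ) := by
      rw [(hP s le_rfl).degree]; exact_mod_cast hk
    have h1 := horth (P s k) hd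
    rw [hg, map_add, LinearMap.add_apply, map_sum, LinearMap.sum_apply,
      Finset.sum_eq_zero, zero_add, weightedForm_zero_pow_mul le_rfl, Nat.sub_self, pow_zero,
      one_mul, weightedForm_symm] at h1
    · exact h1
    · intro j hj
      rw [Finset.mem_range] at hj
      rw [mul_assoc, ← smul_eq_C_mul, map_smul, LinearMap.smul_apply,
        weightedForm_zero_pow_mul hj.le, (hP j hj.le).apply_eq_zero, smul_zero]
      exact degree_X_sub_C_pow_mul_lt ((hP s le_rfl).degree k) (by omega)
  have hgP := (hP s le_rfl).eq_smul_of_orthogonal hgdeg hgorth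
  refine ⟨Function.update l s (g.coeff (n - s) / (P s (n - s)).coeff (n - s)), ?_⟩
  rw [Finset.sum_range_succ, Function.update_self]
  rw [Finset.sum_congr rfl (g := fun j => C (l j) * (X - C c) ^ j * P j (n - j))
    (fun j hj => by rw [Function.update_of_ne (Finset.mem_range.mp hj).ne])]
  conv_lhs => rw [hg, hgP]
  rw [smul_eq_C_mul]
  ring

lemma taylor_coeff_sum (N : ℕ) (p : ℕ → ℝ[X]) (l : ℕ → ℝ) (i : ℕ) :
    (taylor c (∑ j ∈ Finset.range N, C (l j) * (X - C c) ^ j * p j)).coeff i =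
      ∑ j ∈ Finset.range N, l j * if j ≤ i then (taylor c (p j)).coeff (i - j) else 0 := by
  rw [map_sum, finsetSum_coeff]
  refine Finset.sum_congr rfl fun j _ => ?_
  rw [taylor_mul, taylor_mul, taylor_pow, map_sub, taylor_X, taylor_C, taylor_C,
    add_sub_cancel_right, mul_assoc, coeff_C_mul, coeff_X_pow_mul']

lemma abs_mul_abs_eval_le {N i : ℕ} (hi : i < N) (p : ℕ → ℝ[X]) (l : ℕ → ℝ) {f : ℝ[X]}
    (hf : f = ∑ j ∈ Finset.range N, C (l j) * (X - C c) ^ j * p j) :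
    |l i| * |(p i).eval c| ≤ |(taylor c f).coeff i| +
      ∑ j ∈ Finset.range i, |l j| * |(taylor c (p j)).coeff (i - j)| := by
  have h1 := taylor_coeff_sum (c := c) N p l i
  rw [← hf] at h1
  have h2 : ∑ j ∈ Finset.range N, l j * (if j ≤ i then (taylor c (p j)).coeff (i - j) else 0) =
      ∑ j ∈ Finset.range (i + 1), l j * (taylor c (p j)).coeff (i - j) := by
    rw [← Finset.sum_subset (Finset.range_mono hi)]
    · refine Finset.sum_congr rfl fun j hj => ?_
      rw [if_pos (by rw [Finset.mem_range] at hj; omega)]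
    · intro j _ hj
      rw [if_neg (by rw [Finset.mem_range] at hj; omega), mul_zero]
  rw [h2, Finset.sum_range_succ, Nat.sub_self, taylor_coeff_zero] at h1
  rw [← abs_mul, (by linarith : l i * (p i).eval c = (taylor c f).coeff i -
    ∑ j ∈ Finset.range i, l j * (taylor c (p j)).coeff (i - j))]
  refine (abs_sub _ _).trans (add_le_add le_rfl ((Finset.abs_sum_le_sum_abs _ _).trans ?_))
  exact Finset.sum_le_sum fun j _ => (abs_mul _ _).le

end Connection

section Asymptotic

open Asymptotics

lemma norm_coeff_le_of_norm_eval_le {p : ℂ[X]} {K : ℝ} (hK : 0 ≤ K)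
    (h : ∀ z : ℂ, ‖z‖ = 1 → ‖p.eval z‖ ≤ K) (k : ℕ) : ‖p.coeff k‖ ≤ K := by
  by_cases hk : k ∈ p.support
  · refine le_of_sq_le_sq ?_ hK
    have h1 : ‖p.coeff k‖ ^ 2 ≤ ∑ i ∈ p.support, ‖p.coeff i‖ ^ 2 :=
      Finset.single_le_sum (f := fun i => ‖p.coeff i‖ ^ 2) (fun i _ => sq_nonneg _) hk
    rw [sum_sq_norm_coeff_eq_circleAverage] at h1
    refine h1.trans (Real.circleAverage_mono_on_of_le_circle ?_ ?_)
    · exact ContinuousOn.circleIntegrable' (by fun_prop)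
    · intro z hz
      have hz1 : ‖z‖ = 1 := by simpa using hz
      exact pow_le_pow_left₀ (norm_nonneg _) (h z hz1) 2
  · rw [notMem_support_iff.mp hk, norm_zero]
    exact hK

lemma mehlerHeine_coeff_bounds {c : ℝ} {f : ℕ → ℝ[X]} {s b : ℕ → ℝ} (hs : ∀ n, 0 < s n)
    (hb : ∀ n, 0 < b n) {G : ℂ → ℂ} (hG : G 0 ≠ 0)
    (h : TendstoUniformlyOn
      (fun (n : ℕ) (z : ℂ) => (((-1 : ℝ) ^ n * s n : ℝ) : ℂ) *
        Polynomial.aeval ((c : ℂ) + z ^ 2 / (b n : ℂ)) (f n)) G atTop (Metric.closedBall 0 1)) :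
    (∀ k, (fun n => (taylor c (f n)).coeff k) =O[atTop] fun n => b n ^ k / s n) ∧
      (fun n => 1 / s n) =O[atTop] fun n => (f n).eval c := by
  constructor
  · have hcont : ContinuousOn G (Metric.closedBall 0 1) := by
      refine h.continuousOn (Frequently.of_forall fun n => ?_)
      refine Continuous.continuousOn ?_
      simp only [aeval_def, eval₂_eq_eval_map]
      fun_prop
    obtain ⟨K, hK⟩ := (isCompact_closedBall (0 : ℂ) 1).exists_bound_of_continuousOn hcont
    have hK0 : 0 ≤ K := (norm_nonneg _).trans (hK 0 (by simp))
    rw [Metric.tendstoUniformlyOn_iff] at h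
    intro k
    refine IsBigO.of_bound (K + 1) ?_
    filter_upwards [h 1 one_pos] with n hn
    set g : ℂ[X] := (((taylor c (f n)).map (algebraMap ℝ ℂ))).comp (C ((b n : ℂ)⁻¹) * X) with hg
    have hgeval : ∀ w : ℂ, g.eval w = aeval ((c : ℂ) + w / (b n : ℂ)) (f n) := by
      intro w
      rw [hg, eval_comp, eval_map_algebraMap, taylor_apply, aeval_comp]
      congr 1
      simp only [map_add, aeval_X, aeval_C, Complex.coe_algebraMap, eval_mul, eval_C, eval_X]
      congr 1
      ring
    have hgb : ∀ z : ℂ, ‖z‖ = 1 → ‖g.eval z‖ ≤ (K + 1) / s n := by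
      intro z hz
      obtain ⟨w, hw⟩ := IsAlgClosed.exists_pow_nat_eq z two_pos
      have hw1 : ‖w‖ = 1 := by
        rw [← hw, norm_pow] at hz
        exact (pow_eq_one_iff_of_nonneg (norm_nonneg w) two_ne_zero).mp hz
      have hwm : w ∈ Metric.closedBall (0 : ℂ) 1 := by simp [hw1]
      have h1 := hn w hwm
      rw [dist_eq_norm, hw, ← hgeval] at h1
      have h2 := (norm_le_insert (G w) _).trans (add_le_add (hK w hwm) h1.le)
      rw [norm_mul, Complex.norm_real] at h2
      rw [le_div_iff₀ (hs n), mul_comm]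
      simpa [abs_of_pos (hs n)] using h2
    have h1 := norm_coeff_le_of_norm_eval_le (by have := hs n; positivity) hgb k
    rw [hg, comp_C_mul_X_coeff, coeff_map, norm_mul, norm_pow, norm_inv] at h1
    simp only [Complex.coe_algebraMap, Complex.norm_real, Real.norm_eq_abs, abs_of_pos (hb n)] at h1
    rw [Real.norm_eq_abs, Real.norm_eq_abs,
      abs_of_pos (div_pos (pow_pos (hb n) k) (hs n))]
    have hbk := pow_pos (hb n) k
    have hsn := hs n
    rw [inv_pow, ← div_eq_mul_inv, div_le_iff₀ hbk] at h1
    refine h1.trans (le_of_eq ?_)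
    ring
  · have h1 := (h.tendsto_at (x := 0) (by simp)).norm
    have h2 : ∀ᶠ n in atTop, ‖G 0‖ / 2 < s n * |(f n).eval c| := by
      have hpos : ‖G 0‖ / 2 < ‖G 0‖ := half_lt_self (norm_pos_iff.mpr hG)
      filter_upwards [h1.eventually_const_lt hpos] with n hn
      have : aeval ((c : ℂ) + 0 ^ 2 / (b n : ℂ)) (f n) = (((f n).eval c : ℝ) : ℂ) := by
        rw [zero_pow two_ne_zero, zero_div, add_zero]
        exact aeval_algebraMap_apply_eq_algebraMap_eval c (f n)
      rw [this, norm_mul, Complex.norm_real, Complex.norm_real] at hn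
      simpa [abs_of_pos (hs n)] using hn
    refine IsBigO.of_bound (2 / ‖G 0‖) ?_
    filter_upwards [h2] with n hn
    have hg := norm_pos_iff.mpr hG
    have hsn := hs n
    rw [Real.norm_eq_abs, Real.norm_eq_abs, abs_of_pos (by positivity), div_mul_eq_mul_div,
      div_le_div_iff₀ hsn hg]
    linarith

lemma rpow_le_of_le_mul {x k n t : ℝ} (hk : 0 < k) (hkn : k ≤ n) (hn : n ≤ t * k) :
    n ^ x ≤ t ^ |x| * k ^ x := by
  have hn0 : 0 < n := hk.trans_le hkn
  have h1 : 1 ≤ n / k := (one_le_div hk).mpr hkn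
  have h2 : n / k ≤ t := (div_le_iff₀ hk).mpr hn
  rw [← div_le_iff₀ (Real.rpow_pos_of_pos hk x), ← Real.div_rpow hn0.le hk.le]
  exact (Real.rpow_le_rpow_of_exponent_le h1 (le_abs_self x)).trans
    (Real.rpow_le_rpow (by positivity) h2 (abs_nonneg x))

lemma rpow_isBigO_sum {x : ℝ} {u : ℕ → ℝ} (hu : ∀ n, 0 ≤ u n)
    (h : (fun n : ℕ => (n : ℝ) ^ x) =O[atTop] u) :
    (fun n : ℕ => (n : ℝ) ^ (x + 1)) =O[atTop] fun n => ∑ k ∈ Finset.range n, u k := by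
  obtain ⟨K, hK, hKu⟩ := h.exists_pos
  obtain ⟨N, hN⟩ := eventually_atTop.mp hKu.bound
  refine IsBigO.of_bound (2 * (3 ^ |x| * K)) ?_
  filter_upwards [eventually_ge_atTop (2 * N + 2)] with n hn
  have hn0 : (0 : ℝ) < n := by exact_mod_cast (by omega : 0 < n)
  rw [Real.norm_of_nonneg (by positivity),
    Real.norm_of_nonneg (Finset.sum_nonneg fun k _ => hu k), Real.rpow_add_one hn0.ne']
  have hterm : ∀ k ∈ Finset.Ico (n / 2) n, (n : ℝ) ^ x ≤ 3 ^ |x| * K * u k := by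
    intro k hk
    rw [Finset.mem_Ico] at hk
    have hk0 : (0 : ℝ) < k := by exact_mod_cast (by omega : 0 < k)
    have h1 := hN k (by omega)
    rw [Real.norm_of_nonneg (by positivity), Real.norm_of_nonneg (hu k)] at h1
    have h2 : (n : ℝ) ^ x ≤ 3 ^ |x| * (k : ℝ) ^ x :=
      rpow_le_of_le_mul hk0 (by exact_mod_cast hk.2.le)
        (by exact_mod_cast (by omega : n ≤ 3 * k))
    refine h2.trans ?_
    rw [mul_assoc]
    exact mul_le_mul_of_nonneg_left h1 (by positivity)
  have h3 := Finset.sum_le_sum hterm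
  rw [Finset.sum_const, Nat.card_Ico, nsmul_eq_mul, ← Finset.mul_sum] at h3
  have h4 : ∑ k ∈ Finset.Ico (n / 2) n, u k ≤ ∑ k ∈ Finset.range n, u k := by
    refine Finset.sum_le_sum_of_subset_of_nonneg ?_ fun k _ _ => hu k
    intro k hk
    rw [Finset.mem_Ico] at hk
    exact Finset.mem_range.mpr hk.2
  have h5 : (n : ℝ) ≤ 2 * ((n - n / 2 : ℕ) : ℝ) := by
    exact_mod_cast (by omega : n ≤ 2 * (n - n / 2))
  have h6 : 0 < (n : ℝ) ^ x := Real.rpow_pos_of_pos hn0 x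
  have h7 : 3 ^ |x| * K * ∑ k ∈ Finset.Ico (n / 2) n, u k ≤
      3 ^ |x| * K * ∑ k ∈ Finset.range n, u k :=
    mul_le_mul_of_nonneg_left h4 (by positivity)
  calc (n : ℝ) ^ x * n ≤ (n : ℝ) ^ x * (2 * ((n - n / 2 : ℕ) : ℝ)) :=
        mul_le_mul_of_nonneg_left h5 h6.le
    _ = 2 * (((n - n / 2 : ℕ) : ℝ) * (n : ℝ) ^ x) := by ring
    _ ≤ 2 * (3 ^ |x| * K * ∑ k ∈ Finset.range n, u k) := by linarith
    _ = _ := by ring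

lemma isTheta_rpow_sub (j : ℕ) (x : ℝ) :
    (fun n : ℕ => ((n - j : ℕ) : ℝ) ^ x) =Θ[atTop] fun n : ℕ => (n : ℝ) ^ x := by
  refine IsTheta.rpow (Eventually.of_forall fun n => Nat.cast_nonneg _)
    (Eventually.of_forall fun n => Nat.cast_nonneg _) ⟨?_, ?_⟩
  · refine IsBigO.of_bound 1 (Eventually.of_forall fun n => ?_)
    rw [RCLike.norm_natCast, RCLike.norm_natCast, one_mul]
    exact_mod_cast Nat.sub_le n j
  · refine IsBigO.of_bound 2 ?_
    filter_upwards [eventually_ge_atTop (2 * j)] with n hn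
    rw [RCLike.norm_natCast, RCLike.norm_natCast]
    exact_mod_cast (by omega : n ≤ 2 * (n - j))

lemma christoffel_ratio_isBigO {B B' : LinearMap.BilinForm ℝ ℝ[X]} {P P' : ℕ → ℝ[X]} {c x : ℝ}
    (h : IsOrthoSeq B P) (h' : IsOrthoSeq B' P')
    (hsymm : ∀ p q, B p q = B q p) (hpos : ∀ p, 0 ≤ B p p)
    (hsymm' : ∀ p q, B' p q = B' q p) (hpos' : ∀ p, 0 ≤ B' p p)
    (hBB : ∀ p q, B' p q = B ((X - C c) * p) ((X - C c) * q))
    (hP : (fun n => (P n).eval c) =Θ[atTop] fun n : ℕ => (n : ℝ) ^ x) :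
    (fun n => (P n).coeff n ^ 2 / (P' (n - 1)).coeff (n - 1) ^ 2 - 1) =O[atTop]
      fun n : ℕ => (n : ℝ)⁻¹ := by
  have h1 : (fun n => (P n).eval c ^ 2) =Θ[atTop] fun n : ℕ => (n : ℝ) ^ (2 * x) := by
    refine (hP.pow 2).trans_eventuallyEq (Eventually.of_forall fun n => ?_)
    simp only
    rw [mul_comm, Real.rpow_mul (Nat.cast_nonneg _)]
    norm_cast
  have hKn := rpow_isBigO_sum (fun n => sq_nonneg ((P n).eval c)) h1.2
  have h2 : (fun n => (P n).eval c ^ 2 * (n : ℝ)) =O[atTop]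
      fun n : ℕ => ∑ k ∈ Finset.range n, (P k).eval c ^ 2 := by
    refine (IsBigO.trans_eventuallyEq (h1.1.mul (isBigO_refl (fun n : ℕ => (n : ℝ)) atTop))
      ?_).trans hKn
    filter_upwards [eventually_gt_atTop 0] with n hn
    rw [Real.rpow_add_one (by positivity)]
  obtain ⟨K, hK, hKb⟩ := h2.exists_pos
  refine IsBigO.of_bound K ?_
  filter_upwards [hKb.bound, eventually_gt_atTop 0] with n hn hn0
  obtain ⟨m, rfl⟩ := Nat.exists_eq_succ_of_ne_zero hn0.ne'
  have hm0 : (0 : ℝ) < (m + 1 : ℕ) := by positivity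
  have hsum : 0 < ∑ k ∈ Finset.range (m + 1), (P k).eval c ^ 2 := by
    rw [Finset.sum_range_succ']
    refine add_pos_of_nonneg_of_pos (Finset.sum_nonneg fun _ _ => sq_nonneg _) ?_
    rw [eq_C_of_degree_le_zero (h.degree 0).le, eval_C]
    exact pow_pos (h.coeff_pos 0) 2
  have h3 := coeff_le_christoffel h h' hsymm' hpos' hBB m hsum
  have h4 := christoffel_coeff_le h h' hsymm hpos hBB m
  have hp' : 0 < (P' m).coeff m ^ 2 := pow_pos (h'.coeff_pos m) 2
  simp only [Nat.succ_eq_add_one, Nat.add_sub_cancel] at hn ⊢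
  rw [Real.norm_of_nonneg (by positivity), Real.norm_of_nonneg hsum.le] at hn
  rw [Real.norm_of_nonneg (by rw [sub_nonneg, one_le_div hp']; exact h4),
    Real.norm_of_nonneg (by positivity)]
  rw [mul_comm, ← div_le_iff₀ hp'] at h3
  have h5 : (P (m + 1)).eval c ^ 2 / ∑ k ∈ Finset.range (m + 1), (P k).eval c ^ 2 ≤
      K * ((m + 1 : ℕ) : ℝ)⁻¹ := by
    rw [div_le_iff₀ hsum, mul_right_comm, ← div_eq_mul_inv, le_div_iff₀ hm0]
    exact hn
  linarith

end Asymptotic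

section Sobolev

open Asymptotics

variable {L : ℝ[X] →ₗ[ℝ] ℝ} {c : ℝ} {r : ℕ} {w : ℕ → ℝ}

/-- The discrete Sobolev form attached to a linear functional `L`, with weights on the Taylor
coefficients at `c`. -/
def sobolevForm (L : ℝ[X] →ₗ[ℝ] ℝ) (c : ℝ) (r : ℕ) (w : ℕ → ℝ) : LinearMap.BilinForm ℝ ℝ[X] :=
  LinearMap.mk₂ ℝ (fun p q => weightedForm L c 0 p q + ∑ i ∈ Finset.range (r + 1),
      w i * (taylor c p).coeff i * (taylor c q).coeff i)
    (fun p p' q => by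
      simp only [map_add, LinearMap.add_apply, coeff_add, mul_add, add_mul, Finset.sum_add_distrib]
      ring)
    (fun t p q => by
      simp only [map_smul, LinearMap.smul_apply, coeff_smul, smul_eq_mul, mul_add, Finset.mul_sum]
      congr 1
      exact Finset.sum_congr rfl fun i _ => by ring)
    (fun p q q' => by
      simp only [map_add, coeff_add, mul_add, Finset.sum_add_distrib]
      ring)
    (fun t p q => by
      simp only [map_smul, coeff_smul, smul_eq_mul, mul_add, Finset.mul_sum]
      congr 1
      exact Finset.sum_congr rfl fun i _ => by ring)

lemma sobolevForm_apply (p q : ℝ[X]) :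
    sobolevForm L c r w p q = weightedForm L c 0 p q + ∑ i ∈ Finset.range (r + 1),
      w i * (taylor c p).coeff i * (taylor c q).coeff i := rfl

lemma sobolevForm_symm (p q : ℝ[X]) :
    sobolevForm L c r w p q = sobolevForm L c r w q p := by
  rw [sobolevForm_apply, sobolevForm_apply, weightedForm_symm]
  congr 1
  exact Finset.sum_congr rfl fun i _ => by ring

lemma sobolevForm_self_ge (hw : ∀ i ≤ r, 0 ≤ w i) (p : ℝ[X]) :
    weightedForm L c 0 p p ≤ sobolevForm L c r w p p := by
  rw [sobolevForm_apply]
  refine le_add_of_nonneg_right (Finset.sum_nonneg fun i hi => ?_)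
  rw [Finset.mem_range] at hi
  rw [mul_assoc]
  exact mul_nonneg (hw i (by omega)) (mul_self_nonneg _)

lemma sobolevForm_self_ge_coeff (hL : ∀ p, 0 ≤ L (p * p)) (hw : ∀ i ≤ r, 0 ≤ w i) (p : ℝ[X])
    {i : ℕ} (hi : i ≤ r) : w i * (taylor c p).coeff i ^ 2 ≤ sobolevForm L c r w p p := by
  rw [sobolevForm_apply]
  refine le_add_of_nonneg_of_le (weightedForm_nonneg hL 0 p) ?_
  have := Finset.single_le_sum (s := Finset.range (r + 1))
    (f := fun i => w i * (taylor c p).coeff i * (taylor c p).coeff i)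
    (fun i hi => by
      rw [Finset.mem_range] at hi
      rw [mul_assoc]
      exact mul_nonneg (hw i (by omega)) (mul_self_nonneg _))
    (Finset.mem_range.mpr (Nat.lt_succ_of_le hi))
  refine le_trans (le_of_eq ?_) this
  ring

lemma taylor_X_sub_C_pow_mul_coeff {i s : ℕ} (his : i < s) (p : ℝ[X]) :
    (taylor c ((X - C c) ^ s * p)).coeff i = 0 := by
  rw [taylor_mul, taylor_pow, map_sub, taylor_X, taylor_C, add_sub_cancel_right,
    coeff_X_pow_mul', if_neg (by omega)]

lemma sobolevForm_pow_mul (p q : ℝ[X]) :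
    sobolevForm L c r w p ((X - C c) ^ (r + 1) * q) =
      weightedForm L c 0 p ((X - C c) ^ (r + 1) * q) := by
  rw [sobolevForm_apply, Finset.sum_eq_zero, add_zero]
  intro i hi
  rw [taylor_X_sub_C_pow_mul_coeff (Finset.mem_range.mp hi), mul_zero]

lemma coeff_sq_le_coeff_zero_sq (hL : ∀ p, 0 ≤ L (p * p)) {P P' : ℕ → ℝ[X]} {j n : ℕ}
    (h : IsOrthoSeq (weightedForm L c 0) P) (h' : IsOrthoSeq (weightedForm L c j) P')
    (hjn : j ≤ n) : (P' (n - j)).coeff (n - j) ^ 2 ≤ (P n).coeff n ^ 2 := by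
  obtain ⟨m, rfl⟩ := Nat.exists_eq_add_of_le' hjn
  rw [Nat.add_sub_cancel]
  have h1 := h.coeff_sq_le (weightedForm_symm 0) (weightedForm_nonneg hL 0)
    (p := (X - C c) ^ j * P' m) (n := m + j)
    (degree_X_sub_C_pow_mul_lt (h'.degree m) (by omega))
  rw [coeff_X_sub_C_pow_mul (h'.degree m), weightedForm_zero_pow_mul le_rfl, Nat.sub_self,
    pow_zero, one_mul, h'.orth] at h1
  simpa using h1

lemma sobolev_coeff_le (hL : ∀ p, 0 ≤ L (p * p)) (hw : ∀ i ≤ r, 0 ≤ w i) {P q : ℕ → ℝ[X]}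
    (h : IsOrthoSeq (weightedForm L c 0) P) (hq : IsOrthoSeq (sobolevForm L c r w) q) (n : ℕ) :
    (q n).coeff n ^ 2 ≤ (P n).coeff n ^ 2 := by
  have h1 := h.coeff_sq_le (weightedForm_symm 0) (weightedForm_nonneg hL 0) (hq.degree_lt_succ n)
  have h2 := sobolevForm_self_ge (L := L) (c := c) hw (q n)
  rw [hq.orth, if_pos rfl] at h2
  exact h1.trans (mul_le_of_le_one_right (sq_nonneg _) h2)

lemma sobolev_coeff_ge_and_taylor_le (hL : ∀ p, 0 ≤ L (p * p)) (hw : ∀ i ≤ r, 0 ≤ w i)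
    {P P' q : ℕ → ℝ[X]} (h : IsOrthoSeq (weightedForm L c 0) P)
    (h' : IsOrthoSeq (weightedForm L c (r + 1)) P')
    (hq : IsOrthoSeq (sobolevForm L c r w) q) {n : ℕ} (hn : r + 1 ≤ n) :
    (P' (n - (r + 1))).coeff (n - (r + 1)) ^ 2 ≤ (q n).coeff n ^ 2 ∧
      ∀ i ≤ r, w i * (taylor c (q n)).coeff i ^ 2 ≤
        2 * ((P n).coeff n ^ 2 / (P' (n - (r + 1))).coeff (n - (r + 1)) ^ 2 - 1) := by
  have h0 := sobolev_coeff_le hL hw h hq n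
  have hpos : ∀ p, 0 ≤ sobolevForm L c r w p p := fun p =>
    (weightedForm_nonneg hL 0 p).trans (sobolevForm_self_ge hw p)
  obtain ⟨m, rfl⟩ := Nat.exists_eq_add_of_le' hn
  rw [Nat.add_sub_cancel]
  set e := (X - C c) ^ (r + 1) * P' m with he
  have hed : e.degree < (m + (r + 1) + 1 : ℕ) :=
    degree_X_sub_C_pow_mul_lt (h'.degree m) (by omega)
  have hec : e.coeff (m + (r + 1)) = (P' m).coeff m := coeff_X_sub_C_pow_mul (h'.degree m) _
  have hee : sobolevForm L c r w e e = 1 := by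
    rw [he, sobolevForm_pow_mul, weightedForm_zero_pow_mul le_rfl, Nat.sub_self, pow_zero,
      one_mul, h'.orth, if_pos rfl]
  have h1 := hq.coeff_sq_le sobolevForm_symm hpos hed
  rw [hee, hec, mul_one] at h1
  refine ⟨h1, fun i hi => ?_⟩
  have h2 := hq.apply_eq_coeff_div hed
  rw [hec] at h2
  have h3 := sobolevForm_self_ge_coeff hL hw (q (m + (r + 1)) - e) (c := c) hi
  have hti : (taylor c (q (m + (r + 1)) - e)).coeff i =
      (taylor c (q (m + (r + 1)))).coeff i := by
    rw [map_sub, coeff_sub, he, taylor_X_sub_C_pow_mul_coeff (by omega), sub_zero]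
  rw [hti, map_sub, map_sub, LinearMap.sub_apply, LinearMap.sub_apply,
    sobolevForm_symm e (q (m + (r + 1))), hee, h2, hq.orth, if_pos rfl] at h3
  refine h3.trans ?_
  have hg := h'.coeff_pos m
  have hgq := hq.coeff_pos (m + (r + 1))
  have hg0 := h.coeff_pos (m + (r + 1))
  set g := (P' m).coeff m
  set gq := (q (m + (r + 1))).coeff (m + (r + 1))
  set g0 := (P (m + (r + 1))).coeff (m + (r + 1))
  have h4 : gq ≤ g0 := le_of_sq_le_sq h0 hg0.le
  have h5 : g ≤ gq := le_of_sq_le_sq h1 hgq.le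
  have h6 : g / g0 ≤ g / gq := div_le_div_of_nonneg_left hg.le hgq h4
  set t := g / g0 with ht
  have ht0 : 0 < t := div_pos hg hg0
  have ht1 : t ≤ 1 := (div_le_one hg0).mpr (h5.trans h4)
  have h7 : g0 ^ 2 / g ^ 2 = 1 / t ^ 2 := by rw [ht]; field_simp
  rw [h7]
  have h8 : 2 - t ≤ 1 / t ^ 2 := by
    rw [le_div_iff₀ (by positivity)]
    nlinarith [sq_nonneg (t - 1), mul_nonneg ht0.le (sub_nonneg.mpr ht1)]
  linarith

end Sobolev

section Limit

open Asymptotics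

variable {L : ℝ[X] →ₗ[ℝ] ℝ} {c : ℝ} {r : ℕ} {w : ℕ → ℝ}

lemma isLittleO_natCast_rpow_of_lt {x y : ℝ} (h : x < y) :
    (fun n : ℕ => (n : ℝ) ^ x) =o[atTop] fun n : ℕ => (n : ℝ) ^ y := by
  rw [isLittleO_iff_tendsto']
  · refine ((tendsto_rpow_neg_atTop (sub_pos.mpr h)).comp tendsto_natCast_atTop_atTop).congr' ?_
    filter_upwards [eventually_gt_atTop 0] with n hn
    rw [Function.comp_apply, neg_sub, Real.rpow_sub (by exact_mod_cast hn)]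
  · filter_upwards [eventually_gt_atTop 0] with n hn h0
    exact absurd h0 (Real.rpow_pos_of_pos (by exact_mod_cast hn) _).ne'

lemma leadingCoeff_ratio_isBigO (hL : ∀ p, 0 ≤ L (p * p)) {P : ℕ → ℕ → ℝ[X]} {N : ℕ} {e : ℕ → ℝ}
    (hP : ∀ j ≤ N, IsOrthoSeq (weightedForm L c j) (P j))
    (he : ∀ j ≤ N, (fun n => (P j n).eval c) =Θ[atTop] fun n : ℕ => (n : ℝ) ^ e j)
    (j : ℕ) (hj : j ≤ N) :
    (fun n => (P 0 n).coeff n ^ 2 / (P j (n - j)).coeff (n - j) ^ 2 - 1) =O[atTop]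
      fun n : ℕ => (n : ℝ)⁻¹ := by
  induction j with
  | zero =>
    refine (isBigO_zero _ _).congr_left fun n => ?_
    rw [Nat.sub_zero, div_self (pow_pos ((hP 0 hj).coeff_pos n) 2).ne', sub_self]
  | succ j ih =>
    have hj' : j ≤ N := by omega
    have h1 := ih hj'
    have h2 := (christoffel_ratio_isBigO (hP j hj') (hP (j + 1) hj) (weightedForm_symm j)
      (weightedForm_nonneg hL j) (weightedForm_symm (j + 1)) (weightedForm_nonneg hL (j + 1))
      (weightedForm_succ j) (he j hj')).comp_tendsto (tendsto_sub_atTop_nat j)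
    have h3 : (fun n : ℕ => (P j (n - j)).coeff (n - j) ^ 2 /
        (P (j + 1) (n - (j + 1))).coeff (n - (j + 1)) ^ 2 - 1) =O[atTop]
        fun n : ℕ => (n : ℝ)⁻¹ := by
      have h4 := (isTheta_rpow_sub j (-1)).1
      simp only [Real.rpow_neg_one] at h4
      exact h2.trans h4
    have h5 : (fun n : ℕ => (n : ℝ)⁻¹) =O[atTop] fun _ => (1 : ℝ) :=
      tendsto_inv_atTop_nhds_zero_nat.isBigO_one ℝ
    have h6 : (fun n : ℕ => (P j (n - j)).coeff (n - j) ^ 2 /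
        (P (j + 1) (n - (j + 1))).coeff (n - (j + 1)) ^ 2) =O[atTop] fun _ => (1 : ℝ) := by
      refine ((h3.trans h5).add (isBigO_refl (fun _ : ℕ => (1 : ℝ)) atTop)).congr_left fun n => ?_
      ring
    have h7 := (h1.mul h6).congr_right (fun n => mul_one ((n : ℝ)⁻¹))
    refine (h7.add h3).congr_left fun n => ?_
    have := (hP j hj').coeff_pos (n - j)
    have := (hP (j + 1) hj).coeff_pos (n - (j + 1))
    field_simp
    ring

/-- The convergence of the connection coefficients, under power-type bounds on the Taylor
coefficients at `c` of the orthonormal polynomials `p_n^{[2j]}`. -/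
theorem tendsto_connection_coefficients (hL : ∀ p, 0 ≤ L (p * p)) (hw : ∀ i ≤ r, 0 < w i)
    {P : ℕ → ℕ → ℝ[X]} (hP : ∀ j ≤ r + 1, IsOrthoSeq (weightedForm L c j) (P j))
    {q : ℕ → ℝ[X]} (hq : IsOrthoSeq (sobolevForm L c r w) q) {σ β : ℝ} (hσ : -1 / 2 < σ)
    (hβ : 0 ≤ β)
    (hup : ∀ j ≤ r + 1, ∀ k, (fun n => (taylor c (P j n)).coeff k) =O[atTop]
      fun n : ℕ => (n : ℝ) ^ (σ + β * (j + k)))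
    (hlow : ∀ j ≤ r + 1, (fun n : ℕ => (n : ℝ) ^ (σ + β * j)) =O[atTop]
      fun n => (P j n).eval c) :
    ∃ N : ℕ, ∃ lam : ℕ → ℕ → ℝ,
      (∀ n ≥ N,
        (q n = ∑ j ∈ Finset.range (r + 2), C (lam n j) * (X - C c) ^ j * P j (n - j)) ∧
        ∀ lam' : ℕ → ℝ,
          (q n = ∑ j ∈ Finset.range (r + 2), C (lam' j) * (X - C c) ^ j * P j (n - j)) →
          ∀ j ≤ r + 1, lam' j = lam n j) ∧
      (∀ j ≤ r, Tendsto (fun n : ℕ => lam n j) atTop (𝓝 0)) ∧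
      Tendsto (fun n : ℕ => lam n (r + 1)) atTop (𝓝 1) := by
  have hw0 : ∀ i ≤ r, 0 ≤ w i := fun i hi => (hw i hi).le
  have htheta : ∀ j ≤ r + 1, (fun n => (P j n).eval c) =Θ[atTop]
      fun n : ℕ => (n : ℝ) ^ (σ + β * j) := by
    intro j hj
    refine ⟨?_, hlow j hj⟩
    simpa [taylor_coeff_zero] using hup j hj 0
  have hlow' : ∀ j ≤ r + 1, (fun n : ℕ => (n : ℝ) ^ (σ + β * j)) =O[atTop]
      fun n => (P j (n - j)).eval c := fun j hj =>
    (isTheta_rpow_sub j (σ + β * j)).2.trans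
      ((hlow j hj).comp_tendsto (tendsto_sub_atTop_nat j))
  have hup' : ∀ j ≤ r + 1, ∀ k, (fun n => (taylor c (P j (n - j))).coeff k) =O[atTop]
      fun n : ℕ => (n : ℝ) ^ (σ + β * (j + k)) := fun j hj k =>
    ((hup j hj k).comp_tendsto (tendsto_sub_atTop_nat j)).trans (isTheta_rpow_sub j _).1
  have hne : ∀ᶠ n : ℕ in atTop, ∀ j < r + 2, (P j (n - j)).eval c ≠ 0 := by
    refine (Filter.eventually_all_finite (Set.finite_Iio (r + 2))).mpr fun j hj => ?_
    obtain ⟨K, hK⟩ := (hlow' j (Nat.lt_succ_iff.mp hj)).bound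
    filter_upwards [hK, eventually_gt_atTop 0] with n hn hn0 h0
    rw [h0, norm_zero, mul_zero] at hn
    have : 0 < (n : ℝ) ^ (σ + β * j) := Real.rpow_pos_of_pos (by exact_mod_cast hn0) _
    exact this.ne' (norm_le_zero_iff.mp hn)
  obtain ⟨N₀, hN₀⟩ := eventually_atTop.mp hne
  have hexists : ∀ n, ∃ l : ℕ → ℝ, max N₀ (r + 1) ≤ n →
      q n = ∑ j ∈ Finset.range (r + 2), C (l j) * (X - C c) ^ j * P j (n - j) := by
    intro n
    by_cases hn : max N₀ (r + 1) ≤ n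
    · obtain ⟨l, hl⟩ := exists_connection (s := r + 1) (n := n) (le_of_max_le_right hn) hP
        (fun j hj => hN₀ n (le_of_max_le_left hn) j (by omega)) (hq.degree n) (by
          intro h hh
          rw [← sobolevForm_pow_mul (w := w)]
          refine hq.apply_eq_zero ?_
          by_cases h0 : h = 0
          · rw [h0, mul_zero, degree_zero]; exact WithBot.bot_lt_coe _
          · have := le_of_max_le_right hn
            rw [degree_eq_natDegree h0] at hh
            refine degree_X_sub_C_pow_mul_lt (degree_eq_natDegree h0) ?_
            have hh' : h.natDegree < n - (r + 1) := by exact_mod_cast hh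
            omega)
      exact ⟨l, fun _ => hl⟩
    · exact ⟨0, fun h => absurd h hn⟩
  choose lam hlam using hexists
  have hratio := leadingCoeff_ratio_isBigO hL hP htheta (r + 1) le_rfl
  have htaylor : ∀ i ≤ r, (fun n => (taylor c (q n)).coeff i) =O[atTop]
      fun n : ℕ => (n : ℝ) ^ (-1 / 2 : ℝ) := by
    intro i hi
    refine IsBigO.of_pow two_ne_zero ?_
    have h1 : (fun n => (taylor c (q n)).coeff i ^ 2) =O[atTop]
        fun n => (P 0 n).coeff n ^ 2 /
          (P (r + 1) (n - (r + 1))).coeff (n - (r + 1)) ^ 2 - 1 := by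
      refine IsBigO.of_bound (2 / w i) ?_
      filter_upwards [eventually_ge_atTop (r + 1)] with n hn
      have h2 := (sobolev_coeff_ge_and_taylor_le hL hw0 (hP 0 (by omega)) (hP (r + 1) le_rfl)
        hq hn).2 i hi
      rw [Real.norm_of_nonneg (sq_nonneg _), div_mul_eq_mul_div, le_div_iff₀ (hw i hi), mul_comm]
      exact h2.trans (mul_le_mul_of_nonneg_left (le_abs_self _) zero_le_two)
    refine (h1.trans hratio).congr_right fun n => ?_
    rw [Pi.pow_apply, ← Real.rpow_natCast, ← Real.rpow_mul (Nat.cast_nonneg n)]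
    norm_num [Real.rpow_neg_one]
  have hzero : ∀ i ≤ r, Tendsto (fun n => lam n i) atTop (𝓝 0) := by
    intro i
    induction i using Nat.strong_induction_on with
    | _ i ih =>
      intro hi
      have h1 : (fun n => (taylor c (q n)).coeff i) =o[atTop]
          fun n : ℕ => (n : ℝ) ^ (σ + β * i) := by
        refine (htaylor i hi).trans_isLittleO ?_
        have : -1 / 2 < σ + β * i := by
          have : 0 ≤ β * i := mul_nonneg hβ (Nat.cast_nonneg i)
          linarith
        exact isLittleO_natCast_rpow_of_lt this
      have h2 : (fun n => ∑ j ∈ Finset.range i,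
          |lam n j| * |(taylor c (P j (n - j))).coeff (i - j)|) =o[atTop]
          fun n : ℕ => (n : ℝ) ^ (σ + β * i) := by
        refine IsLittleO.fun_sum fun j hj => ?_
        rw [Finset.mem_range] at hj
        have h3 : (fun n => |lam n j|) =o[atTop] fun _ => (1 : ℝ) :=
          ((isLittleO_one_iff ℝ).mpr (ih j hj (by omega))).abs_left
        have h4 := (hup' j (by omega) (i - j)).abs_left
        refine (h3.mul_isBigO h4).congr_right fun n => ?_
        rw [one_mul, Nat.cast_sub hj.le]
        congr 2
        ring
      have h5 : (fun n => lam n i * (P i (n - i)).eval c) =o[atTop]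
          fun n : ℕ => (n : ℝ) ^ (σ + β * i) := by
        refine IsBigO.trans_isLittleO (IsBigO.of_bound 1 ?_) (h1.abs_left.add h2)
        filter_upwards [eventually_ge_atTop (max N₀ (r + 1))] with n hn
        have h6 := abs_mul_abs_eval_le (by omega : i < r + 2) (fun j => P j (n - j)) (lam n)
          (hlam n hn)
        rw [one_mul, norm_mul]
        exact h6.trans (le_abs_self _)
      have h7 := (h5.trans_isBigO (hlow' i (by omega))).tendsto_div_nhds_zero
      refine h7.congr' ?_
      filter_upwards [hne] with n hn
      exact mul_div_cancel_right₀ _ (hn i (by omega))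
  refine ⟨max N₀ (r + 1), lam, fun n hn => ⟨hlam n hn, fun lam' hlam' j hj => ?_⟩, hzero, ?_⟩
  · have h1 := eq_zero_of_sum_pow_mul_eq_zero (r + 2) (fun j => P j (n - j))
      (fun j => lam' j - lam n j) (hN₀ n (le_of_max_le_left hn)) (by
        simp only [C_sub, sub_mul, Finset.sum_sub_distrib]
        rw [← hlam', ← hlam n hn, sub_self]) j (by omega)
    exact sub_eq_zero.mp h1
  · set g : ℕ → ℕ → ℝ := fun j n => (P j (n - j)).coeff (n - j) with hg
    have hgpos : ∀ j ≤ r + 1, ∀ n, 0 < g j n := fun j hj n => (hP j hj).coeff_pos (n - j)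
    set ρ : ℕ → ℝ := fun n => g 0 n ^ 2 / g (r + 1) n ^ 2 with hρ
    have hρ1 : Tendsto ρ atTop (𝓝 1) := by
      have := (hratio.trans_tendsto tendsto_inv_atTop_nhds_zero_nat).add_const 1
      simpa [hρ, hg] using this
    have hbound : ∀ n x, 0 ≤ x → g (r + 1) n ^ 2 ≤ g 0 n ^ 2 → x ^ 2 ≤ g 0 n ^ 2 →
        x / g (r + 1) n ≤ ρ n := by
      intro n x hx h1 h2
      have h3 := hgpos (r + 1) le_rfl n
      have h4 : 1 ≤ ρ n := (one_le_div (by positivity)).mpr h1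
      have h5 : (x / g (r + 1) n) ^ 2 ≤ ρ n := by
        rw [div_pow]
        exact div_le_div_of_nonneg_right h2 (by positivity)
      have h6 : 0 ≤ x / g (r + 1) n := by positivity
      nlinarith
    have hgle : ∀ j ≤ r + 1, ∀ n ≥ r + 1, g j n ^ 2 ≤ g 0 n ^ 2 := fun j hj n hn =>
      coeff_sq_le_coeff_zero_sq hL (hP 0 (by omega)) (hP j hj) (by omega)
    have hqlim : Tendsto (fun n => (q n).coeff n / g (r + 1) n) atTop (𝓝 1) := by
      refine tendsto_of_tendsto_of_tendsto_of_le_of_le' tendsto_const_nhds hρ1 ?_ ?_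
      · filter_upwards [eventually_ge_atTop (r + 1)] with n hn
        rw [one_le_div (hgpos (r + 1) le_rfl n)]
        exact le_of_sq_le_sq (sobolev_coeff_ge_and_taylor_le hL hw0 (hP 0 (by omega))
          (hP (r + 1) le_rfl) hq hn).1 (hq.coeff_pos n).le
      · filter_upwards [eventually_ge_atTop (r + 1)] with n hn
        exact hbound n _ (hq.coeff_pos n).le (hgle (r + 1) le_rfl n hn)
          (sobolev_coeff_le hL hw0 (hP 0 (by omega)) hq n)
    have hsum : Tendsto (fun n => ∑ j ∈ Finset.range (r + 1), lam n j * (g j n / g (r + 1) n))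
        atTop (𝓝 0) := by
      have : (0 : ℝ) = ∑ j ∈ Finset.range (r + 1), 0 := by simp
      rw [this]
      refine tendsto_finsetSum _ fun j hj => ?_
      rw [Finset.mem_range] at hj
      have h1 : (fun n => g j n / g (r + 1) n) =O[atTop] fun _ => (1 : ℝ) := by
        refine IsBigO.trans (IsBigO.of_bound 1 ?_) (hρ1.isBigO_one ℝ)
        filter_upwards [eventually_ge_atTop (r + 1)] with n hn
        have h2 := hbound n _ (hgpos j hj.le n).le (hgle (r + 1) le_rfl n hn)
          (hgle j hj.le n hn)
        rw [Real.norm_of_nonneg (div_pos (hgpos j hj.le n) (hgpos (r + 1) le_rfl n)).le, one_mul]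
        exact h2.trans (le_abs_self _)
      have h3 := ((isLittleO_one_iff ℝ).mpr (hzero j (by omega))).mul_isBigO h1
      exact (isLittleO_one_iff ℝ).mp (h3.congr_right fun _ => mul_one 1)
    have hdiff := hqlim.sub hsum
    rw [sub_zero] at hdiff
    refine hdiff.congr' ?_
    filter_upwards [eventually_ge_atTop (max N₀ (r + 1))] with n hn
    have hn' : r + 1 ≤ n := le_of_max_le_right hn
    have h1 : (q n).coeff n = ∑ j ∈ Finset.range (r + 2), lam n j * g j n := by
      conv_lhs => rw [hlam n hn]
      rw [finsetSum_coeff]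
      refine Finset.sum_congr rfl fun j hj => ?_
      rw [Finset.mem_range] at hj
      rw [mul_assoc, coeff_C_mul]
      have h2 := coeff_X_sub_C_pow_mul (c := c) ((hP j (by omega)).degree (n - j)) j
      rw [Nat.sub_add_cancel (by omega)] at h2
      rw [h2]
    have h3 := hgpos (r + 1) le_rfl n
    rw [h1, Finset.sum_div, Finset.sum_range_succ,
      Finset.sum_congr rfl fun j _ => mul_div_assoc (lam n j) (g j n) (g (r + 1) n),
      add_sub_cancel_left]
    exact mul_div_cancel_right₀ _ h3.ne'

end Limit

section Measure

open Asymptotics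

/-- Integration of polynomials against a measure with finite moments. -/
def polyIntegral (μ : Measure ℝ) (hint : ∀ p : ℝ[X], Integrable (fun x => p.eval x) μ) :
    ℝ[X] →ₗ[ℝ] ℝ where
  toFun p := ∫ x, p.eval x ∂μ
  map_add' p q := by
    simp only [eval_add]
    exact integral_add (hint p) (hint q)
  map_smul' t p := by
    simp only [eval_smul, smul_eq_mul, RingHom.id_apply]
    exact integral_const_mul t _

variable {μ : Measure ℝ} {hint : ∀ p : ℝ[X], Integrable (fun x => p.eval x) μ} {c : ℝ}

lemma polyIntegral_apply (p : ℝ[X]) : polyIntegral μ hint p = ∫ x, p.eval x ∂μ := rfl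

lemma polyIntegral_mul_self_nonneg (p : ℝ[X]) : 0 ≤ polyIntegral μ hint (p * p) := by
  rw [polyIntegral_apply]
  refine integral_nonneg fun x => ?_
  rw [eval_mul]
  exact mul_self_nonneg _

lemma integral_muMod_even (j : ℕ) (f : ℝ → ℝ) :
    ∫ x, f x ∂(muMod μ c (2 * j)) = ∫ x, (x - c) ^ (2 * j) * f x ∂μ := by
  rw [muMod, integral_withDensity_eq_integral_toReal_smul (by fun_prop)
    (Eventually.of_forall fun x => ENNReal.ofReal_lt_top)]
  refine integral_congr_ae (Eventually.of_forall fun x => ?_)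
  simp only [smul_eq_mul]
  rw [ENNReal.toReal_ofReal (by rw [pow_mul]; positivity)]

lemma coeff_pos_of_degree_eq {p : ℝ[X]} {n : ℕ} (hd : p.degree = n) (hl : 0 < p.leadingCoeff) :
    0 < p.coeff n := by
  rwa [leadingCoeff, natDegree_eq_of_degree_eq_some hd] at hl

lemma IsOPS.isOrthoSeq {j : ℕ} {P : ℕ → ℝ[X]} (h : IsOPS (muMod μ c (2 * j)) P) :
    IsOrthoSeq (weightedForm (polyIntegral μ hint) c j) P where
  degree := h.1
  coeff_pos n := coeff_pos_of_degree_eq (h.1 n) (h.2.1 n)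
  orth n m := by
    rw [← h.2.2 n m, integral_muMod_even, weightedForm_apply, polyIntegral_apply]
    simp only [eval_mul, eval_pow, eval_sub, eval_X, eval_C]

lemma iterate_derivative_eval_eq (p : ℝ[X]) (i : ℕ) :
    (derivative^[i] p).eval c = i.factorial * (taylor c p).coeff i := by
  rw [taylor_coeff, ← factorial_smul_hasseDeriv]
  simp

lemma IsSobOPS.isOrthoSeq {r : ℕ} {M : ℕ → ℝ} {q : ℕ → ℝ[X]} (h : IsSobOPS μ c r M q) :
    IsOrthoSeq (sobolevForm (polyIntegral μ hint) c r fun i => M i * (i.factorial : ℝ) ^ 2) q where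
  degree := h.1
  coeff_pos n := coeff_pos_of_degree_eq (h.1 n) (h.2.1 n)
  orth n m := by
    rw [← h.2.2 n m, sobInner, sobolevForm_apply, weightedForm_apply, polyIntegral_apply]
    simp only [mul_zero, pow_zero, one_mul, eval_mul, iterate_derivative_eval_eq]
    congr 1
    exact Finset.sum_congr rfl fun i _ => by ring

end Measure

lemma phi_zero_ne_zero {ν : ℝ} (hν : -1 < ν) : phi ν 0 ≠ 0 := by
  have h : phi ν 0 = 1 / Complex.Gamma ((ν : ℂ) + 1) := by
    rw [phi, tsum_eq_single 0]
    · simp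
    · intro k hk
      simp [hk]
  rw [h]
  refine one_div_ne_zero (Complex.Gamma_ne_zero_of_re_pos ?_)
  rw [Complex.add_re, Complex.ofReal_re, Complex.one_re]
  linarith

/-- **Connection coefficients under Mehler–Heine hypotheses.** With all the masses
positive and the Mehler–Heine hypotheses on `p_n^{[2j]}`, for large `n` the connection
formula holds with uniquely determined coefficients and `λ_{j,n} → 0` for `j ≤ r` while
`λ_{r+1,n} → 1`. -/
theorem connection_coefficients_under_MH
    (μ : Measure ℝ) [IsFiniteMeasure μ]
    (hsupp : (measSupport μ).Infinite)
    (hint : ∀ p : Polynomial ℝ, Integrable (fun x => p.eval x) μ)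
    (c : ℝ) (r : ℕ) (M : ℕ → ℝ) (hM : ∀ i ≤ r, 0 < M i)
    (P : ℕ → ℕ → Polynomial ℝ)
    (hP : ∀ j ≤ r + 1, IsOPS (muMod μ c (2 * j)) (P j))
    (q : ℕ → Polynomial ℝ) (hq : IsSobOPS μ c r M q)
    (a b : ℕ → ℝ) (ha : ∀ n, 0 < a n) (hb : ∀ n, 0 < b n)
    (A B bexp : ℝ) (aexp : ℝ) (hA : 0 < A) (hB : 0 < B) (hbexp : 0 < bexp)
    (ν : ℝ) (hν : -1 < ν)
    (haA : Filter.Tendsto (fun n : ℕ => (a n) ^ (-(1 : ℝ) / 2) / (A * (n : ℝ) ^ aexp))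
      Filter.atTop (nhds 1))
    (hbB : Filter.Tendsto (fun n : ℕ => b n / (B * (n : ℝ) ^ bexp)) Filter.atTop (nhds 1))
    (hlink : 2 * aexp + 1 = bexp * (ν + 1))
    (hMH : ∀ j ≤ r + 1, ∀ K : Set ℂ, IsCompact K →
      TendstoUniformlyOn
        (fun (n : ℕ) (z : ℂ) =>
          (((-1 : ℝ) ^ n * ((a n) ^ ((1 : ℝ) / 2) / (b n) ^ j) : ℝ) : ℂ) *
            Polynomial.aeval ((c : ℂ) + z ^ 2 / (b n : ℂ)) (P j n))
        (fun z => phi (ν + 2 * j) z) Filter.atTop K) :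
    ∃ N : ℕ, ∃ lam : ℕ → ℕ → ℝ,
      (∀ n ≥ N,
        (q n = ∑ j ∈ Finset.range (r + 2),
          Polynomial.C (lam n j) * (Polynomial.X - Polynomial.C c) ^ j * P j (n - j)) ∧
        ∀ lam' : ℕ → ℝ,
          (q n = ∑ j ∈ Finset.range (r + 2),
            Polynomial.C (lam' j) * (Polynomial.X - Polynomial.C c) ^ j * P j (n - j)) →
          ∀ j ≤ r + 1, lam' j = lam n j) ∧
      (∀ j ≤ r, Filter.Tendsto (fun n : ℕ => lam n j) Filter.atTop (nhds 0)) ∧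
      Filter.Tendsto (fun n : ℕ => lam n (r + 1)) Filter.atTop (nhds 1) := by
  have hα : (fun n => (a n) ^ (-(1 : ℝ) / 2)) =Θ[atTop] fun n : ℕ => (n : ℝ) ^ aexp :=
    (Asymptotics.isTheta_of_div_tendsto_nhds_ne_zero haA one_ne_zero).symm.trans
      ((Asymptotics.isTheta_const_mul_left hA.ne').mpr (Asymptotics.isTheta_refl _ _))
  have hβ : b =Θ[atTop] fun n : ℕ => (n : ℝ) ^ bexp :=
    (Asymptotics.isTheta_of_div_tendsto_nhds_ne_zero hbB one_ne_zero).symm.trans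
      ((Asymptotics.isTheta_const_mul_left hB.ne').mpr (Asymptotics.isTheta_refl _ _))
  have hscale : ∀ j k : ℕ, (fun n => b n ^ k / (a n ^ ((1 : ℝ) / 2) / b n ^ j)) =Θ[atTop]
      fun n : ℕ => (n : ℝ) ^ (aexp + bexp * (j + k)) := by
    intro j k
    refine EventuallyEq.trans_isTheta (Eventually.of_forall fun n => ?_)
      ((hα.mul (hβ.pow (j + k))).trans_eventuallyEq ?_)
    · have := ha n
      have := hb n
      simp only
      rw [neg_div, Real.rpow_neg (ha n).le, pow_add]
      field_simp
    · filter_upwards [eventually_gt_atTop 0] with n hn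
      rw [Real.rpow_add (by exact_mod_cast hn), Real.rpow_mul (Nat.cast_nonneg n)]
      norm_cast
  have hbounds := fun j (hj : j ≤ r + 1) => mehlerHeine_coeff_bounds
    (s := fun n => a n ^ ((1 : ℝ) / 2) / b n ^ j)
    (fun n => div_pos (Real.rpow_pos_of_pos (ha n) _) (pow_pos (hb n) j)) hb
    (phi_zero_ne_zero (by have : (0 : ℝ) ≤ 2 * j := by positivity
                          linarith : -1 < ν + 2 * j))
    (hMH j hj _ (isCompact_closedBall 0 1))
  have hσ : -1 / 2 < aexp := by
    have : 0 < bexp * (ν + 1) := mul_pos hbexp (by linarith)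
    linarith
  refine tendsto_connection_coefficients (L := polyIntegral μ hint) polyIntegral_mul_self_nonneg
    (fun i hi => mul_pos (hM i hi) (by positivity)) (fun j hj => (hP j hj).isOrthoSeq)
    hq.isOrthoSeq hσ hbexp.le (fun j hj k => ((hbounds j hj).1 k).trans (hscale j k).1)
    fun j hj => ?_
  have h0 := (hscale j 0).2
  simp only [Nat.cast_zero, add_zero, pow_zero] at h0
  exact h0.trans (hbounds j hj).2
end
end
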